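/- arXiv:2511.02790 — 3 statements merged into one kernel-verified Lean document; each statement's English description precedes it below -/
import Mathlib

section
/- Let g ≥ 3. There exist constants c = c(g) > 0 and K_0 = K_0(g) such that for all integers K ≥ K_0, all integers M with g^{K−1} < M ≤ g^K, and all integers k_1, k_2, k_3 satisfying: |k_i − μ_K| ≤ C_g for i = 1,2,3; k_1 + k_2 + k_3 ≡ M (mod g−1); gcd(k_i, k_j) = 1 for i ≠ j; and gcd(k_i, g) = 1 for each i, the following hold. Writing r_N for the number of triples (n_1,n_2,n_3) ∈ N_1 × N_2 × N_3 with n_1+n_2+n_3 = M and r_S for the number of triples (s_1,s_2,s_3) ∈ S_g(k_1) × S_g(k_2) × S_g(k_3) with s_1+s_2+s_3 = M, one has |r_N − ((g−1)² c_g(k_1,k_2,k_3)/(4 k_1 k_2 k_3)) · r_S| ≤ c · M² K^{−29/6}, and moreover |r_N − c_g(k_1,k_2,k_3) · M²/((2πσ²)^{3/2} K^{9/2})| ≤ c · M² (log K)⁴ K^{−19/4}. -/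
set_option autoImplicit false

noncomputable section

/-- Base-`g` digit sum. -/
def digitSum (g n : ℕ) : ℕ := (Nat.digits g n).sum

/-- `S_g(k)`: naturals below `g^K` with base-`g` digit sum `k`. -/
def Sset (g K : ℕ) (k : ℤ) : Finset ℕ :=
  (Finset.range (g ^ K)).filter fun n => (digitSum g n : ℤ) = k

/-- `N_g(k)`: elements of `S_g(k)` divisible by `k` (Niven numbers with digit sum `k`). -/
def Nset (g K : ℕ) (k : ℤ) : Finset ℕ :=
  (Sset g K k).filter fun n => k ∣ (n : ℤ)

/-- The average digit sum `μ_K = (g-1)K/2`. -/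
def muK (g K : ℕ) : ℝ := ((g : ℝ) - 1) * K / 2

/-- `C_g = g(g-1) ∏_{p ≤ 10g², p prime} p`. -/
def Cg (g : ℕ) : ℕ := g * (g - 1) * ∏ p ∈ (Finset.Iic (10 * g ^ 2)).filter Nat.Prime, p

/-- `c_g(k₁,k₂,k₃) = (4/(g-1)²) ∏ᵢ gcd(g-1, kᵢ)`. -/
def cgk (g : ℕ) (k1 k2 k3 : ℤ) : ℝ :=
  4 / ((g : ℝ) - 1) ^ 2 * (Int.gcd ((g : ℤ) - 1) k1 : ℝ) * (Int.gcd ((g : ℤ) - 1) k2 : ℝ) *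
    (Int.gcd ((g : ℤ) - 1) k3 : ℝ)

/-- Number of representations of `M` as `s₁+s₂+s₃` with `sᵢ ∈ S_g(kᵢ)`. -/
def rS (g K : ℕ) (k1 k2 k3 : ℤ) (M : ℕ) : ℕ :=
  ((Sset g K k1 ×ˢ Sset g K k2 ×ˢ Sset g K k3).filter
    fun p => p.1 + p.2.1 + p.2.2 = M).card

/-- Number of representations of `M` as `n₁+n₂+n₃` with `nᵢ ∈ N_g(kᵢ)`. -/
def rN (g K : ℕ) (k1 k2 k3 : ℤ) (M : ℕ) : ℕ :=
  ((Nset g K k1 ×ˢ Nset g K k2 ×ˢ Nset g K k3).filter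
    fun p => p.1 + p.2.1 + p.2.2 = M).card

namespace NivenSum

open Finset MeasureTheory

/-- The additive character `x ↦ exp(2πix)`. -/
def e (x : ℝ) : ℂ := Complex.exp (Complex.I * ((2 * Real.pi * x : ℝ) : ℂ))

lemma e_add (x y : ℝ) : e (x + y) = e x * e y := by
  simp only [e, ← Complex.exp_add]
  congr 1
  push_cast
  ring

@[simp] lemma e_zero : e 0 = 1 := by simp [e]

@[simp] lemma norm_e (x : ℝ) : ‖e x‖ = 1 := by
  rw [e, mul_comm, Complex.norm_exp_ofReal_mul_I]

lemma e_neg (x : ℝ) : e (-x) = starRingEnd ℂ (e x) := by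
  simp only [e, ← Complex.exp_conj, map_mul, Complex.conj_I, Complex.conj_ofReal]
  congr 1
  push_cast
  ring

lemma e_eq_one_iff (x : ℝ) : e x = 1 ↔ ∃ n : ℤ, x = n := by
  rw [e, Complex.exp_eq_one_iff]
  refine exists_congr fun n => ?_
  have h : (2 * Real.pi * Complex.I : ℂ) ≠ 0 := Complex.two_pi_I_ne_zero
  constructor
  · intro hx
    have : (x : ℂ) = n := by
      apply mul_right_cancel₀ h
      rw [← hx]; push_cast; ring
    exact_mod_cast this
  · rintro rfl
    push_cast; ring

@[simp] lemma e_int (n : ℤ) : e n = 1 := (e_eq_one_iff _).2 ⟨n, rfl⟩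

lemma e_nat_mul (n : ℕ) (x : ℝ) : e (n * x) = e x ^ n := by
  simp only [e, ← Complex.exp_nat_mul]
  congr 1
  push_cast
  ring

@[fun_prop] lemma continuous_e : Continuous e := by
  unfold e
  fun_prop

lemma norm_e_sub_one_le (x : ℝ) : ‖e x - 1‖ ≤ 2 * Real.pi * |x| := by
  refine Real.norm_exp_I_mul_ofReal_sub_one_le.trans_eq ?_
  rw [Real.norm_eq_abs, abs_mul, abs_of_pos (by positivity)]

lemma sum_e_mul_div (q : ℕ) (hq : 0 < q) (m : ℤ) :
    ∑ a ∈ range q, e (a * (m / q)) = if (q : ℤ) ∣ m then (q : ℂ) else 0 := by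
  have hq' : (q : ℝ) ≠ 0 := by positivity
  simp only [e_nat_mul]
  have hone : e (m / q) = 1 ↔ (q : ℤ) ∣ m := by
    rw [e_eq_one_iff]
    refine exists_congr fun n => ?_
    rw [div_eq_iff hq']
    constructor
    · intro h
      have : m = n * q := by exact_mod_cast h
      rw [this, mul_comm]
    · rintro rfl
      push_cast; ring
  split_ifs with h
  · rw [hone.2 h]; simp
  · have h1 : e (m / q) - 1 ≠ 0 := sub_ne_zero.2 fun h' => h (hone.1 h')
    have h2 := mul_geom_sum (e (m / q)) q
    rw [← e_nat_mul, mul_div_cancel₀ _ hq', e_int, sub_self] at h2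
    exact (mul_eq_zero.1 h2).resolve_left h1

lemma integral_e_mul_int (w : ℕ) (hw : 0 < w) (m : ℤ) :
    (w : ℂ) * ∫ x in (-(1 / (2 * w)) : ℝ)..(1 / (2 * w)), e (x * (w * m)) =
      if m = 0 then 1 else 0 := by
  have hw' : (w : ℝ) ≠ 0 := by positivity
  have hwc : (w : ℂ) ≠ 0 := by exact_mod_cast hw.ne'
  split_ifs with h
  · subst h
    simp only [Int.cast_zero, mul_zero, e_zero, intervalIntegral.integral_const]
    rw [Complex.real_smul]
    push_cast
    field_simp
    norm_num
  · have hm : (m : ℂ) ≠ 0 := by exact_mod_cast h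
    have hc : (Complex.I * (2 * Real.pi * (w * m)) : ℂ) ≠ 0 := by
      have := Real.pi_ne_zero
      simp [hm, hwc, this]
    have h1 : ∀ x : ℝ, e (x * (w * m)) = Complex.exp ((Complex.I * (2 * Real.pi * (w * m))) * x) := by
      intro x
      rw [e]; congr 1; push_cast; ring
    simp only [h1]
    rw [integral_exp_mul_complex hc]
    have h2 : Complex.exp ((Complex.I * (2 * Real.pi * (w * m))) * ((1 / (2 * w) : ℝ) : ℂ)) =
        Complex.exp ((Complex.I * (2 * Real.pi * (w * m))) * ((-(1 / (2 * w)) : ℝ) : ℂ)) := by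
      rw [Complex.exp_eq_exp_iff_exists_int]
      refine ⟨m, ?_⟩
      push_cast
      field_simp
      ring
    rw [h2, sub_self, zero_div, mul_zero]

/-! ### Digit sums -/

lemma digitSum_add_mul {g : ℕ} (hg : 1 < g) {d : ℕ} (hd : d < g) (m : ℕ) :
    digitSum g (d + g * m) = d + digitSum g m := by
  rcases Nat.eq_zero_or_pos d with rfl | hd0
  · rcases Nat.eq_zero_or_pos m with rfl | hm
    · simp [digitSum]
    · rw [digitSum, Nat.digits_add g hg _ _ hd (Or.inr hm.ne')]; simp [digitSum]
  · rw [digitSum, Nat.digits_add g hg _ _ hd (Or.inl hd0.ne')]; simp [digitSum]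

lemma digitSum_add_pow_mul {g : ℕ} (hg : 1 < g) (t : ℕ) :
    ∀ {r : ℕ}, r < g ^ t → ∀ m : ℕ, digitSum g (r + g ^ t * m) = digitSum g r + digitSum g m := by
  induction t with
  | zero =>
    intro r hr m
    have : r = 0 := by simpa using hr
    subst this
    simp [digitSum]
  | succ t ih =>
    intro r hr m
    have hd : r % g < g := Nat.mod_lt _ (by omega)
    have hr' : r / g < g ^ t := by
      rw [Nat.div_lt_iff_lt_mul (by omega)]; rwa [pow_succ] at hr
    have h1 : r + g ^ (t + 1) * m = r % g + g * (r / g + g ^ t * m) := by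
      conv_lhs => rw [← Nat.mod_add_div r g]
      ring
    have h2 : digitSum g r = r % g + digitSum g (r / g) := by
      conv_lhs => rw [← Nat.mod_add_div r g]
      exact digitSum_add_mul hg hd _
    rw [h1, digitSum_add_mul hg hd, ih hr', h2, add_assoc]

lemma digitSum_le {g : ℕ} (hg : 1 < g) (t : ℕ) :
    ∀ {r : ℕ}, r < g ^ t → digitSum g r ≤ g * t := by
  induction t with
  | zero =>
    intro r hr
    have : r = 0 := by simpa using hr
    subst this
    simp [digitSum]
  | succ t ih =>
    intro r hr
    have hd : r % g < g := Nat.mod_lt _ (by omega)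
    have hr' : r / g < g ^ t := by
      rw [Nat.div_lt_iff_lt_mul (by omega)]; rwa [pow_succ] at hr
    have h2 : digitSum g r = r % g + digitSum g (r / g) := by
      conv_lhs => rw [← Nat.mod_add_div r g]
      exact digitSum_add_mul hg hd _
    have := ih hr'
    rw [h2]; linarith

lemma digitSum_modEq {g : ℕ} (hg : 3 ≤ g) (n : ℕ) :
    (n : ℤ) ≡ digitSum g n [ZMOD (g : ℤ) - 1] := by
  have h : g % (g - 1) = 1 := by
    conv_lhs => rw [show g = 1 + (g - 1) by omega]
    rw [show 1 + (g - 1) - 1 = g - 1 by omega, Nat.add_mod_right, Nat.mod_eq_of_lt (by omega)]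
  have := (Int.natCast_modEq_iff).2 (Nat.modEq_digits_sum (g - 1) g h n)
  rwa [Nat.cast_sub (by omega : 1 ≤ g), Nat.cast_one] at this

lemma sum_range_mul {α : Type*} [AddCommMonoid α] (g N : ℕ) (F : ℕ → α) :
    ∑ n ∈ range (g * N), F n = ∑ d ∈ range g, ∑ m ∈ range N, F (d + g * m) := by
  rw [sum_comm, mul_comm]
  induction N with
  | zero => simp
  | succ N ih =>
    rw [add_mul, one_mul, sum_range_add, ih, sum_range_succ]
    congr 1
    exact sum_congr rfl fun d _ => by rw [add_comm, mul_comm]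

/-! ### Exponential sums over numbers with weighted digit sum -/

lemma norm_one_add_e_le (x : ℝ) : ‖1 + e x‖ ≤ 2 - 4 * ‖(x : UnitAddCircle)‖ ^ 2 := by
  rw [UnitAddCircle.norm_eq, sq_abs]
  set y := x - round x with hy
  have hxy : e x = e y := by
    have : x = y + ((round x : ℤ) : ℝ) := by rw [hy]; ring
    rw [this, e_add, e_int, mul_one]
  have hy2 : |y| ≤ 1 / 2 := abs_sub_round x
  have hfac : 1 + e y = e (y / 2) * (2 * Real.cos (Real.pi * y) : ℝ) := by
    have h1 : e y = e (y / 2) * e (y / 2) := by rw [← e_add]; ring_nf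
    have h2 : (1 : ℂ) = e (y / 2) * e (-(y / 2)) := by rw [← e_add]; simp
    rw [h1]
    nth_rewrite 1 [h2]
    rw [← mul_add]
    congr 1
    simp only [e]
    push_cast
    rw [Complex.cos, mul_div_cancel₀ _ two_ne_zero, add_comm]
    congr 2 <;> ring
  have hpi := Real.pi_pos
  have habs : |Real.pi * y| ≤ Real.pi / 2 := by
    rw [abs_mul, abs_of_pos hpi]; nlinarith
  have hcos0 : 0 ≤ Real.cos (Real.pi * y) :=
    Real.cos_nonneg_of_mem_Icc ⟨(abs_le.1 habs).1, (abs_le.1 habs).2⟩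
  have hcos := Real.cos_le_one_sub_mul_cos_sq (x := Real.pi * y) (by linarith)
  have h3 : 2 / Real.pi ^ 2 * (Real.pi * y) ^ 2 = 2 * y ^ 2 := by field_simp
  rw [hxy, hfac, norm_mul, norm_e, one_mul, Complex.norm_real, Real.norm_eq_abs,
    abs_of_nonneg (by positivity)]
  linarith

lemma norm_sum_e_mul_le {g : ℕ} (hg : 2 ≤ g) (x : ℝ) :
    ‖∑ d ∈ range g, e (d * x)‖ ≤ g * Real.exp (-(4 / g) * ‖(x : UnitAddCircle)‖ ^ 2) := by
  obtain ⟨k, rfl⟩ := Nat.exists_eq_add_of_le hg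
  have h2 : ‖∑ d ∈ range (2 + k), e (d * x)‖ ≤ ((2 + k : ℕ) : ℝ) - 4 * ‖(x : UnitAddCircle)‖ ^ 2 := by
    rw [sum_range_add]
    refine (norm_add_le _ _).trans ?_
    have ha : ‖∑ d ∈ range 2, e (d * x)‖ ≤ 2 - 4 * ‖(x : UnitAddCircle)‖ ^ 2 := by
      simpa [sum_range_succ] using norm_one_add_e_le x
    have hb : ‖∑ d ∈ range k, e (((2 + d : ℕ) : ℝ) * x)‖ ≤ k := by
      refine (norm_sum_le _ _).trans ?_
      simp
    have hc : ((2 + k : ℕ) : ℝ) = 2 + k := by push_cast; rfl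
    linarith
  refine h2.trans ?_
  have hpos : (0 : ℝ) < ((2 + k : ℕ) : ℝ) := by positivity
  have := Real.add_one_le_exp (-(4 / ((2 + k : ℕ) : ℝ)) * ‖(x : UnitAddCircle)‖ ^ 2)
  calc ((2 + k : ℕ) : ℝ) - 4 * ‖(x : UnitAddCircle)‖ ^ 2
      = ((2 + k : ℕ) : ℝ) * (-(4 / ((2 + k : ℕ) : ℝ)) * ‖(x : UnitAddCircle)‖ ^ 2 + 1) := by
        field_simp; ring
    _ ≤ _ := by gcongr

/-- The exponential sum `∑_{n < g^K} e(θ s_g(n) + α n)`. -/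
def digitExpSum (g K : ℕ) (θ α : ℝ) : ℂ :=
  ∑ n ∈ range (g ^ K), e (θ * digitSum g n + α * n)

lemma norm_digitExpSum_le {g : ℕ} (hg : 2 ≤ g) (K : ℕ) (θ : ℝ) : ∀ α : ℝ,
    ‖digitExpSum g K θ α‖ ≤ (g : ℝ) ^ K * Real.exp (-(4 / g) *
      ∑ t ∈ range K, ‖((θ + g ^ t * α : ℝ) : UnitAddCircle)‖ ^ 2) := by
  induction K with
  | zero => intro α; simp [digitExpSum, digitSum]
  | succ K ih =>
    intro α
    have h : digitExpSum g (K + 1) θ α =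
        (∑ d ∈ range g, e (d * (θ + α))) * digitExpSum g K θ (g * α) := by
      rw [digitExpSum, pow_succ', sum_range_mul, digitExpSum, sum_mul_sum]
      refine sum_congr rfl fun d hd => sum_congr rfl fun m _ => ?_
      rw [digitSum_add_mul (by omega) (mem_range.1 hd), ← e_add]
      push_cast
      ring_nf
    rw [h, norm_mul, sum_range_succ']
    refine (mul_le_mul (norm_sum_e_mul_le hg _) (ih _) (norm_nonneg _) (by positivity)).trans_eq ?_
    have h2 : ∀ t : ℕ, (θ + (g : ℝ) ^ (t + 1) * α) = θ + g ^ t * (g * α) := fun t => by ring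
    simp only [h2, pow_zero, one_mul]
    rw [mul_add, Real.exp_add]
    ring

lemma sq_norm_sub_le (a b : UnitAddCircle) : ‖a - b‖ ^ 2 ≤ 2 * (‖a‖ ^ 2 + ‖b‖ ^ 2) := by
  have := norm_sub_le a b
  nlinarith [norm_nonneg (a - b), sq_nonneg (‖a‖ - ‖b‖)]

lemma sum_add_sum_succ_le (K : ℕ) (u : ℕ → ℝ) (hu : ∀ t, 0 ≤ u t) :
    ∑ t ∈ range (K - 1), (u (t + 1) + u t) ≤ 2 * ∑ t ∈ range K, u t := by
  rcases K with _ | K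
  · simp
  · rw [Nat.add_sub_cancel, sum_add_distrib, two_mul]
    refine add_le_add ?_ ?_
    · rw [sum_range_succ']; linarith [hu 0]
    · rw [sum_range_succ]; linarith [hu K]

lemma sum_sq_norm_frequency_le (g K : ℕ) (θ α : ℝ) :
    ∑ t ∈ range (K - 1), ‖((((g : ℝ) - 1) * g ^ t * α : ℝ) : UnitAddCircle)‖ ^ 2 ≤
      4 * ∑ t ∈ range K, ‖((θ + g ^ t * α : ℝ) : UnitAddCircle)‖ ^ 2 := by
  have h := sum_add_sum_succ_le K (fun t => ‖((θ + g ^ t * α : ℝ) : UnitAddCircle)‖ ^ 2)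
    (fun t => by positivity)
  have h2 : ∑ t ∈ range (K - 1), ‖((((g : ℝ) - 1) * g ^ t * α : ℝ) : UnitAddCircle)‖ ^ 2 ≤
      ∑ t ∈ range (K - 1), 2 * (‖((θ + g ^ (t + 1) * α : ℝ) : UnitAddCircle)‖ ^ 2 +
        ‖((θ + g ^ t * α : ℝ) : UnitAddCircle)‖ ^ 2) := by
    refine sum_le_sum fun t _ => ?_
    refine le_trans (le_of_eq ?_) (sq_norm_sub_le _ _)
    rw [← AddCircle.coe_sub]
    congr 3
    ring
  rw [← mul_sum] at h2
  linarith

lemma mul_sq_norm_digit_weight_le {g : ℕ} (hg : 1 ≤ g) (K : ℕ) (θ α : ℝ) :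
    ((K - 1 : ℕ) : ℝ) * ‖((((g : ℝ) - 1) * θ : ℝ) : UnitAddCircle)‖ ^ 2 ≤
      4 * g ^ 2 * ∑ t ∈ range K, ‖((θ + g ^ t * α : ℝ) : UnitAddCircle)‖ ^ 2 := by
  have hg1 : (1 : ℝ) ≤ g := by exact_mod_cast hg
  have h := sum_add_sum_succ_le K (fun t => ‖((θ + g ^ t * α : ℝ) : UnitAddCircle)‖ ^ 2)
    (fun t => by positivity)
  have h2 : ∑ t ∈ range (K - 1), ‖((((g : ℝ) - 1) * θ : ℝ) : UnitAddCircle)‖ ^ 2 ≤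
      ∑ t ∈ range (K - 1), 2 * g ^ 2 * (‖((θ + g ^ (t + 1) * α : ℝ) : UnitAddCircle)‖ ^ 2 +
        ‖((θ + g ^ t * α : ℝ) : UnitAddCircle)‖ ^ 2) := by
    refine sum_le_sum fun t _ => ?_
    have h3 : ((((g : ℝ) - 1) * θ : ℝ) : UnitAddCircle) =
        g • ((θ + g ^ t * α : ℝ) : UnitAddCircle) - ((θ + g ^ (t + 1) * α : ℝ) : UnitAddCircle) := by
      rw [← AddCircle.coe_nsmul, ← AddCircle.coe_sub]
      congr 1
      rw [nsmul_eq_mul]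
      ring
    rw [h3]
    refine (sq_norm_sub_le _ _).trans ?_
    have h4 : ‖g • ((θ + g ^ t * α : ℝ) : UnitAddCircle)‖ ≤
        g * ‖((θ + g ^ t * α : ℝ) : UnitAddCircle)‖ := norm_nsmul_le
    have h5 : ‖g • ((θ + g ^ t * α : ℝ) : UnitAddCircle)‖ ^ 2 ≤
        (g * ‖((θ + g ^ t * α : ℝ) : UnitAddCircle)‖) ^ 2 := by gcongr
    have h6 : ‖((θ + g ^ (t + 1) * α : ℝ) : UnitAddCircle)‖ ^ 2 ≤
        (g : ℝ) ^ 2 * ‖((θ + g ^ (t + 1) * α : ℝ) : UnitAddCircle)‖ ^ 2 :=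
      le_mul_of_one_le_left (by positivity) (one_le_pow₀ hg1)
    rw [mul_pow] at h5
    linarith
  rw [← mul_sum, sum_const, card_range, nsmul_eq_mul] at h2
  nlinarith [sq_nonneg (g : ℝ)]

/-! ### Ternary sums -/

/-- Triples of naturals below `N` with sum `M`. -/
def triples (N M : ℕ) : Finset (ℕ × ℕ × ℕ) :=
  (range N ×ˢ range N ×ˢ range N).filter fun p => p.1 + p.2.1 + p.2.2 = M

/-- The exponential sum `∑_{n < N} f(n) e(α n)`. -/
def expSum (f : ℕ → ℂ) (N : ℕ) (α : ℝ) : ℂ := ∑ n ∈ range N, f n * e (α * n)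

lemma sum_sq_norm_expSum_le (f : ℕ → ℂ) (hf : ∀ n, ‖f n‖ ≤ 1) {N Q : ℕ} (hQ : N ≤ Q)
    (hQ0 : 0 < Q) :
    ∑ a ∈ range Q, ‖expSum f N (a / Q)‖ ^ 2 ≤ Q * N := by
  have key : ((∑ a ∈ range Q, ‖expSum f N (a / Q)‖ ^ 2 : ℝ) : ℂ) =
      ((Q * ∑ n ∈ range N, ‖f n‖ ^ 2 : ℝ) : ℂ) := by
    have h1 : ∀ a : ℕ, ((‖expSum f N (a / Q)‖ ^ 2 : ℝ) : ℂ) =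
        ∑ n ∈ range N, ∑ m ∈ range N, f n * starRingEnd ℂ (f m) *
          e (a * (((n - m : ℤ) : ℝ) / Q)) := by
      intro a
      rw [Complex.ofReal_pow, ← Complex.mul_conj', expSum, map_sum, sum_mul_sum]
      refine sum_congr rfl fun n _ => sum_congr rfl fun m _ => ?_
      have : e (a * (((n - m : ℤ) : ℝ) / Q)) = e (a / Q * n) * e (-(a / Q * m)) := by
        rw [← e_add]; congr 1; push_cast; ring
      rw [this, e_neg, map_mul]
      ring
    rw [Complex.ofReal_sum]
    simp only [h1]
    rw [sum_comm, Complex.ofReal_mul, Complex.ofReal_natCast, Complex.ofReal_sum, mul_sum]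
    refine sum_congr rfl fun n hn => ?_
    rw [sum_comm]
    simp only [← mul_sum]
    have h2 : ∀ m ∈ range N, f n * starRingEnd ℂ (f m) *
        ∑ a ∈ range Q, e (a * (((n - m : ℤ) : ℝ) / Q)) =
        if m = n then (Q : ℂ) * (‖f n‖ : ℂ) ^ 2 else 0 := by
      intro m hm
      rw [sum_e_mul_div Q hQ0]
      rw [mem_range] at hn hm
      by_cases hmn : m = n
      · subst hmn
        rw [sub_self, if_pos (dvd_zero _), if_pos rfl, ← Complex.mul_conj']
        ring
      · rw [if_neg, if_neg hmn, mul_zero]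
        intro hdvd
        have := Int.eq_zero_of_abs_lt_dvd hdvd (by rw [abs_lt]; omega)
        omega
    rw [sum_congr rfl h2, sum_ite_eq' (range N) n, if_pos hn, Complex.ofReal_pow]
  rw [Complex.ofReal_inj] at key
  rw [key]
  gcongr
  calc ∑ n ∈ range N, ‖f n‖ ^ 2 ≤ ∑ n ∈ range N, (1 : ℝ) :=
        sum_le_sum fun n _ => pow_le_one₀ (norm_nonneg _) (hf n)
    _ = N := by simp

lemma mul_sum_triples_eq (N M Q : ℕ) (hQ : 3 * N + M < Q) (f₁ f₂ f₃ : ℕ → ℂ) :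
    (Q : ℂ) * ∑ p ∈ triples N M, f₁ p.1 * f₂ p.2.1 * f₃ p.2.2 =
      ∑ a ∈ range Q, expSum f₁ N (a / Q) * expSum f₂ N (a / Q) * expSum f₃ N (a / Q) *
        e (-(a / Q * M)) := by
  have h1 : ∀ a : ℕ, expSum f₁ N (a / Q) * expSum f₂ N (a / Q) * expSum f₃ N (a / Q) *
      e (-(a / Q * M)) = ∑ p ∈ range N ×ˢ range N ×ˢ range N,
        f₁ p.1 * f₂ p.2.1 * f₃ p.2.2 *
          e (a * (((p.1 + p.2.1 + p.2.2 - M : ℤ) : ℝ) / Q)) := by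
    intro a
    rw [sum_product]
    simp only [sum_product]
    rw [expSum, expSum, expSum, mul_assoc, mul_assoc, sum_mul]
    refine sum_congr rfl fun n₁ _ => ?_
    rw [← mul_assoc, mul_sum, sum_mul]
    refine sum_congr rfl fun n₂ _ => ?_
    rw [sum_mul, mul_sum]
    refine sum_congr rfl fun n₃ _ => ?_
    have : e (a * (((n₁ + n₂ + n₃ - M : ℤ) : ℝ) / Q)) =
        e (a / Q * n₁) * e (a / Q * n₂) * e (a / Q * n₃) * e (-(a / Q * M)) := by
      rw [← e_add, ← e_add, ← e_add]; congr 1; push_cast; ring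
    rw [this]
    ring
  simp only [h1]
  rw [sum_comm, triples, sum_filter, mul_sum]
  refine sum_congr rfl fun p hp => ?_
  rw [← mul_sum, sum_e_mul_div Q (by omega)]
  simp only [mem_product, mem_range] at hp
  by_cases h : p.1 + p.2.1 + p.2.2 = M
  · rw [if_pos h, if_pos, mul_comm]
    rw [← h]; push_cast; simp
  · rw [if_neg h, if_neg, mul_zero, mul_zero]
    intro hdvd
    have := Int.eq_zero_of_abs_lt_dvd hdvd (by rw [abs_lt]; omega)
    omega

lemma mul_le_mul_add_of_mul_le_sq {a b D : ℝ} (ha : 0 ≤ a) (hb : 0 ≤ b) (hD : 0 ≤ D)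
    (h : a * b ≤ D ^ 2) : a * b ≤ D * (a + b) := by
  by_cases h1 : a ≤ D
  · nlinarith
  · by_cases h2 : b ≤ D
    · nlinarith
    · nlinarith

/-- If at every frequency the product of the first transform with one of the other two is small,
then the ternary sum is small. -/
lemma norm_sum_triples_le (N M : ℕ) (f₁ f₂ f₃ : ℕ → ℂ) (h₁ : ∀ n, ‖f₁ n‖ ≤ 1)
    (h₂ : ∀ n, ‖f₂ n‖ ≤ 1) (h₃ : ∀ n, ‖f₃ n‖ ≤ 1) {D : ℝ} (hD : 0 ≤ D)
    (H : ∀ α : ℝ, ‖expSum f₁ N α‖ * ‖expSum f₂ N α‖ ≤ D ^ 2 ∨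
      ‖expSum f₁ N α‖ * ‖expSum f₃ N α‖ ≤ D ^ 2) :
    ‖∑ p ∈ triples N M, f₁ p.1 * f₂ p.2.1 * f₃ p.2.2‖ ≤ 3 * D * N := by
  set Q := 3 * N + M + 1 with hQ
  have hQ0 : (0 : ℝ) < Q := by rw [hQ]; positivity
  have hpt : ∀ α : ℝ, ‖expSum f₁ N α‖ * ‖expSum f₂ N α‖ * ‖expSum f₃ N α‖ ≤
      D * (‖expSum f₁ N α‖ ^ 2 + ‖expSum f₂ N α‖ ^ 2 + ‖expSum f₃ N α‖ ^ 2) := by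
    intro α
    have ha := norm_nonneg (expSum f₁ N α)
    have hb := norm_nonneg (expSum f₂ N α)
    have hc := norm_nonneg (expSum f₃ N α)
    rcases H α with h | h
    · have h4 := mul_le_mul_add_of_mul_le_sq ha hb hD h
      have h5 := mul_le_mul_of_nonneg_right h4 hc
      refine h5.trans ?_
      rw [mul_assoc]
      gcongr
      nlinarith [sq_nonneg (‖expSum f₁ N α‖ - ‖expSum f₃ N α‖), sq_nonneg (‖expSum f₂ N α‖ - ‖expSum f₃ N α‖)]
    · have h4 := mul_le_mul_add_of_mul_le_sq ha hc hD h
      have h5 := mul_le_mul_of_nonneg_right h4 hb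
      rw [mul_right_comm]
      refine h5.trans ?_
      rw [mul_assoc]
      gcongr
      nlinarith [sq_nonneg (‖expSum f₁ N α‖ - ‖expSum f₂ N α‖), sq_nonneg (‖expSum f₂ N α‖ - ‖expSum f₃ N α‖)]
  have hmain : (Q : ℝ) * ‖∑ p ∈ triples N M, f₁ p.1 * f₂ p.2.1 * f₃ p.2.2‖ ≤
      Q * (3 * D * N) := by
    have := congrArg norm (mul_sum_triples_eq N M Q (by omega) f₁ f₂ f₃)
    rw [norm_mul, Complex.norm_natCast] at this
    rw [this]
    refine (norm_sum_le _ _).trans ?_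
    calc ∑ a ∈ range Q, ‖expSum f₁ N (a / Q) * expSum f₂ N (a / Q) * expSum f₃ N (a / Q) *
          e (-(a / Q * M))‖
        ≤ ∑ a ∈ range Q, D * (‖expSum f₁ N (a / Q)‖ ^ 2 + ‖expSum f₂ N (a / Q)‖ ^ 2 +
            ‖expSum f₃ N (a / Q)‖ ^ 2) := by
          refine sum_le_sum fun a _ => ?_
          rw [norm_mul, norm_e, mul_one, norm_mul, norm_mul]
          exact hpt _
      _ = D * (∑ a ∈ range Q, ‖expSum f₁ N (a / Q)‖ ^ 2 +
            ∑ a ∈ range Q, ‖expSum f₂ N (a / Q)‖ ^ 2 +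
            ∑ a ∈ range Q, ‖expSum f₃ N (a / Q)‖ ^ 2) := by
          rw [← mul_sum, sum_add_distrib, sum_add_distrib]
      _ ≤ D * (Q * N + Q * N + Q * N) := by
          gcongr <;> exact sum_sq_norm_expSum_le _ (by assumption) (by omega) (by omega)
      _ = Q * (3 * D * N) := by ring
  exact le_of_mul_le_mul_left hmain hQ0

/-! ### Frequencies with small denominators prime to the base -/

lemma norm_nsmul_of_lt {g : ℕ} (hg : 0 < g) (x : ℝ)
    (hx : ‖(x : UnitAddCircle)‖ < 1 / (2 * g)) :
    ‖((g * x : ℝ) : UnitAddCircle)‖ = g * ‖(x : UnitAddCircle)‖ := by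
  have hg' : (0 : ℝ) < g := by exact_mod_cast hg
  rw [UnitAddCircle.norm_eq] at hx
  have h1 : ((g * x : ℝ) : UnitAddCircle) = ((g * (x - round x) : ℝ) : UnitAddCircle) := by
    have h2 : g * x = g * (x - round x) + ((g * round x : ℤ) : ℝ) := by push_cast; ring
    rw [h2, AddCircle.coe_add, (AddCircle.coe_eq_zero_iff (1 : ℝ) (x := ((g * round x : ℤ) : ℝ))).2
      ⟨g * round x, by simp⟩, add_zero]
  rw [lt_div_iff₀ (by positivity)] at hx
  rw [h1, UnitAddCircle.norm_eq (x := x), (AddCircle.norm_coe_eq_abs_iff 1 one_ne_zero).2,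
    abs_mul, abs_of_pos hg']
  rw [abs_mul, abs_of_pos hg', abs_one]
  linarith

lemma exists_le_norm_pow_mul {g q W : ℕ} (hg : 0 < g) (hq : 0 < q) (hqW : q ≤ g ^ W) (u : ℤ)
    (hu : ¬ (q : ℤ) ∣ u) :
    ∃ s ∈ range W, 1 / (2 * g : ℝ) ≤ ‖((g ^ s * (u / q) : ℝ) : UnitAddCircle)‖ := by
  by_contra! hcon
  have hq' : (0 : ℝ) < q := by exact_mod_cast hq
  have hstep : ∀ s ≤ W, ‖((g ^ s * (u / q) : ℝ) : UnitAddCircle)‖ =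
      g ^ s * ‖((u / q : ℝ) : UnitAddCircle)‖ := by
    intro s
    induction s with
    | zero => simp
    | succ s ih =>
      intro hs
      have h := norm_nsmul_of_lt hg _ (hcon s (mem_range.2 (by omega)))
      rw [← mul_assoc, ← pow_succ', ih (by omega)] at h
      rw [h, pow_succ']
      ring
  have h1 : 1 / (q : ℝ) ≤ ‖((u / q : ℝ) : UnitAddCircle)‖ := by
    rw [UnitAddCircle.norm_eq]
    set r := round ((u : ℝ) / q)
    have h2 : (u : ℝ) / q - r = ((u - q * r : ℤ) : ℝ) / q := by
      push_cast; field_simp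
    rw [h2, abs_div, abs_of_pos hq']
    gcongr
    have h3 : u - q * r ≠ 0 := fun h => hu ⟨r, by linarith⟩
    exact_mod_cast Int.one_le_abs h3
  have h2 := hstep W le_rfl
  have h3 := AddCircle.norm_le_half_period (1 : ℝ) one_ne_zero
    (x := ((g ^ W * (u / q) : ℝ) : UnitAddCircle))
  rw [h2, abs_one] at h3
  have h4 : (1 : ℝ) ≤ g ^ W * ‖((u / q : ℝ) : UnitAddCircle)‖ := by
    calc (1 : ℝ) = q * (1 / q) := by field_simp
      _ ≤ g ^ W * ‖((u / q : ℝ) : UnitAddCircle)‖ := by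
        gcongr
        exact_mod_cast hqW
  linarith

lemma le_sum_sq_norm_pow_mul {g q W : ℕ} (hg : 0 < g) (hq : 0 < q) (hqW : q ≤ g ^ W)
    (hcop : Nat.Coprime q g) (u : ℤ) (hu : ¬ (q : ℤ) ∣ u) (n : ℕ) :
    ((n / W : ℕ) : ℝ) * (1 / (2 * g)) ^ 2 ≤
      ∑ t ∈ range n, ‖((g ^ t * (u / q) : ℝ) : UnitAddCircle)‖ ^ 2 := by
  have hwin : ∀ i : ℕ, (1 / (2 * g) : ℝ) ^ 2 ≤
      ∑ d ∈ range W, ‖((g ^ (d + W * i) * (u / q) : ℝ) : UnitAddCircle)‖ ^ 2 := by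
    intro i
    have hu' : ¬ (q : ℤ) ∣ g ^ (W * i) * u := by
      intro h
      refine hu (IsCoprime.dvd_of_dvd_mul_left ?_ h)
      exact (Nat.isCoprime_iff_coprime.2 hcop).pow_right
    obtain ⟨s, hs, hle⟩ := exists_le_norm_pow_mul hg hq hqW _ hu'
    refine le_trans ?_ (single_le_sum (f := fun d =>
      ‖((g ^ (d + W * i) * (u / q) : ℝ) : UnitAddCircle)‖ ^ 2) (fun _ _ => by positivity) hs)
    have heq : ((g ^ (s + W * i) * (u / q) : ℝ)) = g ^ s * (((g ^ (W * i) * u : ℤ) : ℝ) / q) := by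
      push_cast; ring
    simp only [heq]
    gcongr
  calc ((n / W : ℕ) : ℝ) * (1 / (2 * g)) ^ 2
      = ∑ i ∈ range (n / W), (1 / (2 * g) : ℝ) ^ 2 := by simp
    _ ≤ ∑ i ∈ range (n / W), ∑ d ∈ range W,
          ‖((g ^ (d + W * i) * (u / q) : ℝ) : UnitAddCircle)‖ ^ 2 :=
        sum_le_sum fun i _ => hwin i
    _ = ∑ t ∈ range (W * (n / W)), ‖((g ^ t * (u / q) : ℝ) : UnitAddCircle)‖ ^ 2 := by
        rw [sum_range_mul, sum_comm]
    _ ≤ _ := by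
        refine sum_le_sum_of_subset_of_nonneg ?_ fun _ _ _ => by positivity
        exact range_subset_range.2 (Nat.mul_div_le n W)

/-! ### Detecting divisibility -/

/-- The indicator function of digit sum `k`. -/
def digitInd (g : ℕ) (k : ℤ) (n : ℕ) : ℂ := if (digitSum g n : ℤ) = k then 1 else 0

lemma norm_digitInd_le (g : ℕ) (k : ℤ) (n : ℕ) : ‖digitInd g k n‖ ≤ 1 := by
  unfold digitInd; split_ifs <;> simp

lemma digitInd_eq_integral (g : ℕ) (k : ℤ) (n : ℕ) :
    digitInd g k n = ∫ x in (-(1 / 2) : ℝ)..(1 / 2), e (x * ((digitSum g n : ℝ) - k)) := by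
  have h := integral_e_mul_int 1 one_pos ((digitSum g n : ℤ) - k)
  simp only [Nat.cast_one, one_mul, mul_one, sub_eq_zero] at h
  rw [digitInd, ← h]
  push_cast
  rfl

lemma rS_eq (g K : ℕ) (k1 k2 k3 : ℤ) (M : ℕ) :
    (rS g K k1 k2 k3 M : ℂ) = ∑ p ∈ triples (g ^ K) M,
      digitInd g k1 p.1 * digitInd g k2 p.2.1 * digitInd g k3 p.2.2 := by
  have : (Sset g K k1 ×ˢ Sset g K k2 ×ˢ Sset g K k3).filter (fun p => p.1 + p.2.1 + p.2.2 = M) =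
      (triples (g ^ K) M).filter fun p => ((digitSum g p.1 : ℤ) = k1 ∧
        (digitSum g p.2.1 : ℤ) = k2) ∧ (digitSum g p.2.2 : ℤ) = k3 := by
    ext p
    simp only [Sset, triples, mem_filter, mem_product]
    tauto
  rw [rS, this, card_filter]
  push_cast
  refine sum_congr rfl fun p _ => ?_
  simp only [digitInd, ite_and]
  split_ifs <;> simp

lemma rN_eq (g K : ℕ) (k1 k2 k3 : ℤ) (M : ℕ) :
    (rN g K k1 k2 k3 M : ℂ) = ∑ p ∈ triples (g ^ K) M,
      (digitInd g k1 p.1 * if k1 ∣ (p.1 : ℤ) then 1 else 0) *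
      (digitInd g k2 p.2.1 * if k2 ∣ (p.2.1 : ℤ) then 1 else 0) *
      (digitInd g k3 p.2.2 * if k3 ∣ (p.2.2 : ℤ) then 1 else 0) := by
  have : (Nset g K k1 ×ˢ Nset g K k2 ×ˢ Nset g K k3).filter (fun p => p.1 + p.2.1 + p.2.2 = M) =
      (triples (g ^ K) M).filter fun p => (((digitSum g p.1 : ℤ) = k1 ∧ k1 ∣ (p.1 : ℤ)) ∧
        ((digitSum g p.2.1 : ℤ) = k2 ∧ k2 ∣ (p.2.1 : ℤ))) ∧
        ((digitSum g p.2.2 : ℤ) = k3 ∧ k3 ∣ (p.2.2 : ℤ)) := by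
    ext p
    simp only [Nset, Sset, triples, mem_filter, mem_product]
    tauto
  rw [rN, this, card_filter]
  push_cast
  refine sum_congr rfl fun p _ => ?_
  simp only [digitInd, ite_and]
  split_ifs <;> simp

/-- The indicator of digit sum `k` twisted by the frequency `j / k`. -/
def twist (g k j n : ℕ) : ℂ := digitInd g k n * e (j * (((n : ℤ) : ℝ) / k))

lemma norm_twist_le (g k j n : ℕ) : ‖twist g k j n‖ ≤ 1 := by
  rw [twist, norm_mul, norm_e, mul_one]; exact norm_digitInd_le _ _ _

lemma norm_expSum_twist_le {g : ℕ} (hg : 2 ≤ g) (K k j : ℕ) (α : ℝ) :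
    ‖expSum (twist g k j) (g ^ K) α‖ ≤ (g : ℝ) ^ K * Real.exp (-(1 / g) *
      ∑ t ∈ range (K - 1), ‖((((g : ℝ) - 1) * g ^ t * (α + j / k) : ℝ) : UnitAddCircle)‖ ^ 2) := by
  have h1 : expSum (twist g k j) (g ^ K) α =
      ∫ x in (-(1 / 2) : ℝ)..(1 / 2), e (-(x * k)) * digitExpSum g K x (α + j / k) := by
    simp only [expSum, twist, digitInd_eq_integral, digitExpSum, mul_sum]
    rw [intervalIntegral.integral_finsetSum]
    · refine sum_congr rfl fun n _ => ?_
      rw [← intervalIntegral.integral_mul_const, ← intervalIntegral.integral_mul_const]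
      refine intervalIntegral.integral_congr fun x _ => ?_
      simp only [← e_add]
      congr 1
      push_cast
      ring
    · intro n _
      apply Continuous.intervalIntegrable
      fun_prop
  rw [h1]
  have h2 := intervalIntegral.norm_integral_le_of_norm_le_const (a := (-(1 / 2) : ℝ)) (b := 1 / 2)
    (f := fun x => e (-(x * k)) * digitExpSum g K x (α + j / k))
    (C := (g : ℝ) ^ K * Real.exp (-(1 / g) *
      ∑ t ∈ range (K - 1), ‖((((g : ℝ) - 1) * g ^ t * (α + j / k) : ℝ) : UnitAddCircle)‖ ^ 2)) ?_
  · refine h2.trans_eq ?_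
    norm_num
  · intro x _
    rw [norm_mul, norm_e, one_mul]
    refine (norm_digitExpSum_le hg K x _).trans ?_
    have h3 := sum_sq_norm_frequency_le g K x (α + j / k)
    gcongr ?_ * Real.exp ?_
    have hg0 : (0 : ℝ) < g := by positivity
    have h4 : (0 : ℝ) ≤ 1 / g := by positivity
    have h5 := mul_le_mul_of_nonneg_left h3 h4
    calc _ = -((1 / (g : ℝ)) * (4 * ∑ t ∈ range K, ‖((x + g ^ t * (α + j / k) : ℝ) : UnitAddCircle)‖ ^ 2)) := by
          ring
      _ ≤ _ := by linarith

lemma norm_expSum_twist_mul_le {g : ℕ} (hg : 2 ≤ g) (K W : ℕ) {k l : ℕ} (hk : 0 < k) (hl : 0 < l)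
    (hklW : k * l ≤ g ^ W) (hkg : Nat.Coprime k g) (hlg : Nat.Coprime l g) (i j : ℕ)
    (hij : ¬ ((k * l : ℕ) : ℤ) ∣ ((g : ℤ) - 1) * (i * l - j * k)) (α : ℝ) :
    ‖expSum (twist g k i) (g ^ K) α‖ * ‖expSum (twist g l j) (g ^ K) α‖ ≤
      ((g : ℝ) ^ K * Real.exp (-(((K - 1) / W : ℕ) : ℝ) / (16 * g ^ 3))) ^ 2 := by
  have hg0 : (0 : ℝ) < g := by positivity
  have hk0 : (k : ℝ) ≠ 0 := by positivity
  have hl0 : (l : ℝ) ≠ 0 := by positivity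
  set A := ∑ t ∈ range (K - 1), ‖((((g : ℝ) - 1) * g ^ t * (α + i / k) : ℝ) : UnitAddCircle)‖ ^ 2
    with hA
  set B := ∑ t ∈ range (K - 1), ‖((((g : ℝ) - 1) * g ^ t * (α + j / l) : ℝ) : UnitAddCircle)‖ ^ 2
    with hB
  have hAB : ((((K - 1) / W : ℕ) : ℝ) * (1 / (2 * g)) ^ 2) ≤ 2 * (A + B) := by
    refine (le_sum_sq_norm_pow_mul (by omega) (Nat.mul_pos hk hl) hklW (hkg.mul_left hlg) _ hij
      (K - 1)).trans ?_
    rw [hA, hB, ← sum_add_distrib, mul_sum]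
    refine sum_le_sum fun t _ => ?_
    refine le_trans (le_of_eq ?_) (sq_norm_sub_le _ _)
    rw [← AddCircle.coe_sub]
    congr 3
    push_cast
    field_simp
    ring
  refine (mul_le_mul (norm_expSum_twist_le hg K k i α) (norm_expSum_twist_le hg K l j α)
    (norm_nonneg _) (by positivity)).trans ?_
  rw [← hA, ← hB, mul_mul_mul_comm, ← Real.exp_add, mul_pow, ← Real.exp_nat_mul, ← pow_two]
  gcongr ?_ * Real.exp ?_
  have h1 : ((2 : ℕ) : ℝ) * (-(((K - 1) / W : ℕ) : ℝ) / (16 * g ^ 3)) =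
      -((1 / (2 * g)) * ((((K - 1) / W : ℕ) : ℝ) * (1 / (2 * g)) ^ 2)) := by
    field_simp; ring
  rw [h1]
  have h2 := mul_le_mul_of_nonneg_left hAB (by positivity : (0 : ℝ) ≤ 1 / (2 * g))
  have h3 : 1 / (2 * (g : ℝ)) * (2 * (A + B)) = 1 / g * (A + B) := by field_simp
  linarith

lemma card_filter_dvd_mul (a k : ℕ) (hk : 0 < k) :
    ((range k).filter fun j => k ∣ a * j).card = Nat.gcd a k := by
  obtain ⟨d, a', k', hd, hcop, rfl, rfl⟩ := Nat.exists_coprime' (m := a) (n := k)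
    (Nat.gcd_pos_of_pos_right a hk)
  have hk' : 0 < k' := Nat.pos_of_mul_pos_right hk
  rw [Nat.gcd_mul_right, hcop.gcd_eq_one, one_mul]
  have himg : (range (k' * d)).filter (fun j => k' * d ∣ a' * d * j) =
      (range d).image fun i => k' * i := by
    ext j
    simp only [mem_filter, mem_range, mem_image]
    constructor
    · rintro ⟨hj, hdvd⟩
      have h1 : k' ∣ a' * j := by
        rw [mul_right_comm] at hdvd
        exact Nat.dvd_of_mul_dvd_mul_right hd hdvd
      obtain ⟨i, rfl⟩ := hcop.symm.dvd_of_dvd_mul_left h1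
      exact ⟨i, lt_of_mul_lt_mul_left hj (Nat.zero_le _), rfl⟩
    · rintro ⟨i, hi, rfl⟩
      refine ⟨Nat.mul_lt_mul_of_pos_left hi hk', ⟨a' * i, by ring⟩⟩
  rw [himg, card_image_of_injective _ (fun x y h => Nat.eq_of_mul_eq_mul_left hk' h), card_range]

lemma twist_eq_digitInd {g : ℕ} (hg : 3 ≤ g) {k j : ℕ} (hk : 0 < k) (hj : k ∣ (g - 1) * j) (n : ℕ) :
    twist g k j n = digitInd g k n := by
  rw [twist, digitInd]
  split_ifs with h
  · have hmod := digitSum_modEq hg n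
    rw [h] at hmod
    obtain ⟨m, hm⟩ := hmod.symm.dvd
    obtain ⟨l, hl⟩ := hj
    have hl' : ((g : ℤ) - 1) * j = k * l := by
      rw [← Nat.cast_pred (by omega)]; exact_mod_cast hl
    have hk0 : (k : ℝ) ≠ 0 := by positivity
    have : (j : ℝ) * (((n : ℤ) : ℝ) / k) = ((j + l * m : ℤ) : ℝ) := by
      have h1 : (n : ℤ) * j = k * (j + l * m) := by linear_combination j * hm + m * hl'
      have h2 : (((n : ℤ) : ℝ)) * j = k * ((j + l * m : ℤ) : ℝ) := by exact_mod_cast h1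
      field_simp
      linarith
    rw [this, e_int, mul_one]
  · simp

lemma not_dvd_of_not_dvd_mul {a k l i j : ℤ} (hkl : IsCoprime k l) (h : ¬ k ∣ a * i) :
    ¬ k * l ∣ a * (i * l - j * k) := by
  intro hd
  refine h (hkl.dvd_of_dvd_mul_right (?_ : k ∣ a * i * l))
  have h1 : k ∣ a * (i * l - j * k) := (dvd_mul_right k l).trans hd
  have h2 : a * i * l = a * (i * l - j * k) + k * (a * j) := by ring
  rw [h2]
  exact dvd_add h1 (dvd_mul_right _ _)

lemma norm_sum_twist_le {g : ℕ} (hg : 3 ≤ g) (K M W : ℕ) {k₁ k₂ k₃ : ℕ} (h₁ : 0 < k₁) (h₂ : 0 < k₂)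
    (h₃ : 0 < k₃) (h₁₂ : Nat.Coprime k₁ k₂) (h₁₃ : Nat.Coprime k₁ k₃)
    (hg₁ : Nat.Coprime k₁ g) (hg₂ : Nat.Coprime k₂ g) (hg₃ : Nat.Coprime k₃ g)
    (hW₂ : k₁ * k₂ ≤ g ^ W) (hW₃ : k₁ * k₃ ≤ g ^ W) (j₁ j₂ j₃ : ℕ)
    (hj : ¬ (k₁ ∣ (g - 1) * j₁ ∧ k₂ ∣ (g - 1) * j₂ ∧ k₃ ∣ (g - 1) * j₃)) :
    ‖∑ p ∈ triples (g ^ K) M, twist g k₁ j₁ p.1 * twist g k₂ j₂ p.2.1 * twist g k₃ j₃ p.2.2‖ ≤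
      3 * ((g : ℝ) ^ K * Real.exp (-(((K - 1) / W : ℕ) : ℝ) / (16 * g ^ 3))) * (g ^ K : ℕ) := by
  refine norm_sum_triples_le _ _ _ _ _ (norm_twist_le _ _ _) (norm_twist_le _ _ _)
    (norm_twist_le _ _ _) (by positivity) fun α => ?_
  have hcast : ∀ k j : ℕ, k ∣ (g - 1) * j ↔ (k : ℤ) ∣ ((g : ℤ) - 1) * j := by
    intro k j
    rw [← Nat.cast_pred (by omega), ← Nat.cast_mul, Int.natCast_dvd_natCast]
  simp only [hcast] at hj
  have key : ∀ k j : ℕ, 0 < k → Nat.Coprime k₁ k → Nat.Coprime k g → k₁ * k ≤ g ^ W →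
      (¬ (k₁ : ℤ) ∣ ((g : ℤ) - 1) * j₁ ∨ ¬ (k : ℤ) ∣ ((g : ℤ) - 1) * j) →
      ‖expSum (twist g k₁ j₁) (g ^ K) α‖ * ‖expSum (twist g k j) (g ^ K) α‖ ≤
      ((g : ℝ) ^ K * Real.exp (-(((K - 1) / W : ℕ) : ℝ) / (16 * g ^ 3))) ^ 2 := by
    intro k j hk hcop hkg hkW hor
    refine norm_expSum_twist_mul_le (by omega) K W h₁ hk hkW hg₁ hkg j₁ j ?_ α
    have hcop' : IsCoprime (k₁ : ℤ) (k : ℤ) := Nat.isCoprime_iff_coprime.2 hcop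
    rw [Nat.cast_mul]
    rcases hor with h | h
    · exact not_dvd_of_not_dvd_mul hcop' h
    · have := not_dvd_of_not_dvd_mul (j := (j₁ : ℤ)) hcop'.symm h
      refine fun hd => this ?_
      rw [mul_comm (k : ℤ), ← dvd_neg, ← mul_neg, neg_sub]
      exact hd
  by_cases hc : (k₁ : ℤ) ∣ ((g : ℤ) - 1) * j₁ ∧ (k₂ : ℤ) ∣ ((g : ℤ) - 1) * j₂
  · refine Or.inr (key k₃ j₃ h₃ h₁₃ hg₃ hW₃ (Or.inr fun h => hj ⟨hc.1, hc.2, h⟩))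
  · exact Or.inl (key k₂ j₂ h₂ h₁₂ hg₂ hW₂ (not_and_or.1 hc))

lemma norm_rN_sub_le {g : ℕ} (hg : 3 ≤ g) (K M W : ℕ) {k₁ k₂ k₃ : ℕ} (h₁ : 0 < k₁) (h₂ : 0 < k₂)
    (h₃ : 0 < k₃) (h₁₂ : Nat.Coprime k₁ k₂) (h₁₃ : Nat.Coprime k₁ k₃)
    (hg₁ : Nat.Coprime k₁ g) (hg₂ : Nat.Coprime k₂ g) (hg₃ : Nat.Coprime k₃ g)
    (hW₂ : k₁ * k₂ ≤ g ^ W) (hW₃ : k₁ * k₃ ≤ g ^ W) :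
    |(rN g K k₁ k₂ k₃ M : ℝ) - (Nat.gcd (g - 1) k₁ * Nat.gcd (g - 1) k₂ * Nat.gcd (g - 1) k₃ : ℝ) /
        (k₁ * k₂ * k₃) * rS g K k₁ k₂ k₃ M| ≤
      3 * (g : ℝ) ^ (2 * K) * Real.exp (-(((K - 1) / W : ℕ) : ℝ) / (16 * g ^ 3)) := by
  set T : ℕ × ℕ × ℕ → ℂ := fun j => ∑ p ∈ triples (g ^ K) M,
    twist g k₁ j.1 p.1 * twist g k₂ j.2.1 p.2.1 * twist g k₃ j.2.2 p.2.2 with hT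
  set J := range k₁ ×ˢ range k₂ ×ˢ range k₃ with hJ
  set P : ℕ × ℕ × ℕ → Prop := fun j =>
    k₁ ∣ (g - 1) * j.1 ∧ k₂ ∣ (g - 1) * j.2.1 ∧ k₃ ∣ (g - 1) * j.2.2 with hP
  classical
  have hk₁ : (k₁ : ℂ) ≠ 0 := by exact_mod_cast h₁.ne'
  have hk₂ : (k₂ : ℂ) ≠ 0 := by exact_mod_cast h₂.ne'
  have hk₃ : (k₃ : ℂ) ≠ 0 := by exact_mod_cast h₃.ne'
  have hind : ∀ k : ℕ, 0 < k → ∀ n : ℕ,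
      (k : ℂ) * (digitInd g k n * if (k : ℤ) ∣ (n : ℤ) then 1 else 0) =
        ∑ j ∈ range k, twist g k j n := by
    intro k hk n
    simp only [twist, ← mul_sum]
    rw [sum_e_mul_div k hk]
    split_ifs <;> ring
  have hN : (k₁ * k₂ * k₃ : ℂ) * rN g K k₁ k₂ k₃ M = ∑ j ∈ J, T j := by
    rw [rN_eq, mul_sum, hJ, hT, sum_comm]
    refine sum_congr rfl fun p _ => ?_
    rw [sum_product]
    simp only [sum_product, ← mul_sum]
    simp only [mul_assoc, ← mul_sum, ← sum_mul]
    rw [← hind k₁ h₁, ← hind k₂ h₂, ← hind k₃ h₃]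
    ring
  have hS : ∑ j ∈ J.filter P, T j =
      (Nat.gcd (g - 1) k₁ * Nat.gcd (g - 1) k₂ * Nat.gcd (g - 1) k₃ : ℂ) * rS g K k₁ k₂ k₃ M := by
    have h1 : ∀ j ∈ J.filter P, T j = rS g K k₁ k₂ k₃ M := by
      intro j hj
      obtain ⟨ha, hb, hc⟩ := (mem_filter.1 hj).2
      rw [rS_eq, hT]
      refine sum_congr rfl fun p _ => ?_
      rw [twist_eq_digitInd hg h₁ ha, twist_eq_digitInd hg h₂ hb, twist_eq_digitInd hg h₃ hc]
    rw [sum_congr rfl h1, sum_const, nsmul_eq_mul]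
    congr 1
    have h2 : J.filter P = (range k₁).filter (fun j => k₁ ∣ (g - 1) * j) ×ˢ
        (range k₂).filter (fun j => k₂ ∣ (g - 1) * j) ×ˢ
        (range k₃).filter (fun j => k₃ ∣ (g - 1) * j) := by
      ext j
      simp only [hJ, hP, mem_filter, mem_product]
      tauto
    rw [h2, card_product, card_product, card_filter_dvd_mul _ _ h₁, card_filter_dvd_mul _ _ h₂,
      card_filter_dvd_mul _ _ h₃]
    push_cast
    ring
  set B := 3 * (g : ℝ) ^ (2 * K) * Real.exp (-(((K - 1) / W : ℕ) : ℝ) / (16 * g ^ 3)) with hB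
  have hrest : ‖∑ j ∈ J.filter (fun j => ¬ P j), T j‖ ≤ k₁ * k₂ * k₃ * B := by
    refine (norm_sum_le _ _).trans ?_
    have h1 : ∀ j ∈ J.filter (fun j => ¬ P j), ‖T j‖ ≤ B := by
      intro j hj
      refine (norm_sum_twist_le hg K M W h₁ h₂ h₃ h₁₂ h₁₃ hg₁ hg₂ hg₃ hW₂ hW₃ _ _ _
        (mem_filter.1 hj).2).trans_eq ?_
      rw [hB]; push_cast; ring
    refine (sum_le_card_nsmul _ _ _ h1).trans ?_
    rw [nsmul_eq_mul]
    gcongr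
    have h2 := card_filter_le J (fun j => ¬ P j)
    have h3 : J.card = k₁ * k₂ * k₃ := by
      rw [hJ, card_product, card_product, card_range, card_range, card_range, mul_assoc]
    rw [h3] at h2
    exact_mod_cast h2
  have hdiff : (((rN g K k₁ k₂ k₃ M : ℝ) - (Nat.gcd (g - 1) k₁ * Nat.gcd (g - 1) k₂ *
      Nat.gcd (g - 1) k₃ : ℝ) / (k₁ * k₂ * k₃) * rS g K k₁ k₂ k₃ M : ℝ) : ℂ) =
      (∑ j ∈ J.filter (fun j => ¬ P j), T j) / (k₁ * k₂ * k₃) := by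
    have h1 := sum_filter_add_sum_filter_not J P T
    rw [hS, ← hN] at h1
    push_cast
    field_simp
    linear_combination -h1
  rw [← Real.norm_eq_abs, ← Complex.norm_real, hdiff, norm_div]
  have h4 : ‖(k₁ * k₂ * k₃ : ℂ)‖ = k₁ * k₂ * k₃ := by simp
  rw [h4, div_le_iff₀ (by positivity)]
  linarith

/-! ### Triples of digits with a prescribed sum modulo the base -/

/-- All triples of naturals below `N`. -/
def cube (N : ℕ) : Finset (ℕ × ℕ × ℕ) := range N ×ˢ range N ×ˢ range N

lemma mem_cube {N : ℕ} {p : ℕ × ℕ × ℕ} : p ∈ cube N ↔ p.1 < N ∧ p.2.1 < N ∧ p.2.2 < N := by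
  simp [cube]

lemma sum_cube {α : Type*} [AddCommMonoid α] (N : ℕ) (F : ℕ × ℕ × ℕ → α) :
    ∑ p ∈ cube N, F p = ∑ a ∈ range N, ∑ b ∈ range N, ∑ c ∈ range N, F (a, b, c) := by
  rw [cube, sum_product]
  simp only [sum_product]

lemma sum_cube_mul {α : Type*} [AddCommMonoid α] (a b : ℕ) (F : ℕ × ℕ × ℕ → α) :
    ∑ p ∈ cube (a * b), F p = ∑ d ∈ cube a, ∑ m ∈ cube b,
      F (d.1 + a * m.1, d.2.1 + a * m.2.1, d.2.2 + a * m.2.2) := by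
  simp only [sum_cube, sum_range_mul]
  refine sum_congr rfl fun d₁ _ => ?_
  rw [sum_comm]
  refine sum_congr rfl fun d₂ _ => ?_
  rw [sum_comm]
  conv_rhs => rw [sum_comm]
  rw [sum_comm]
  refine sum_congr rfl fun m₁ _ => ?_
  rw [sum_comm]

lemma sum_ite_dvd_sub {N : ℕ} (hN : 0 < N) (a : ℤ) (z : ℂ) :
    ∑ d ∈ range N, (if (N : ℤ) ∣ d - a then z else 0) = z := by
  have hN' : (0 : ℤ) < N := by exact_mod_cast hN
  have h0 := Int.emod_nonneg a hN'.ne'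
  have h1 := Int.emod_lt_of_pos a hN'
  rw [sum_eq_single (a % N).toNat]
  · rw [if_pos]
    rw [Int.toNat_of_nonneg h0, Int.emod_def]
    exact ⟨-(a / N), by ring⟩
  · intro d hd hne
    rw [if_neg]
    intro hdvd
    apply hne
    have h2 : a % N = (d : ℤ) % N := (Int.emod_emod_of_dvd _ (dvd_refl _)).symm.trans (by
      rw [Int.emod_emod_of_dvd _ (dvd_refl _)]
      exact Int.ModEq.symm (Int.modEq_iff_dvd.2 (by
        rw [← dvd_neg, neg_sub]; exact hdvd)) )
    rw [h2, Int.emod_eq_of_lt (by positivity) (by exact_mod_cast mem_range.1 hd)]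
    simp
  · intro h
    exact absurd (mem_range.2 (by omega)) h

lemma sum_cube_mod_fst_snd {N : ℕ} (hN : 0 < N) (a : ℤ) (u v : ℕ → ℂ) :
    ∑ d ∈ cube N, (if (N : ℤ) ∣ d.1 + d.2.1 + d.2.2 - a then u d.1 * v d.2.1 else 0) =
      (∑ d ∈ range N, u d) * ∑ d ∈ range N, v d := by
  rw [sum_cube, sum_mul_sum]
  refine sum_congr rfl fun x _ => sum_congr rfl fun y _ => ?_
  rw [← sum_ite_dvd_sub hN (a - x - y) (u x * v y)]
  refine sum_congr rfl fun z _ => ?_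
  rw [show ((z : ℤ) - (a - x - y)) = x + y + z - a by ring]

lemma sum_cube_mod_fst_thd {N : ℕ} (hN : 0 < N) (a : ℤ) (u v : ℕ → ℂ) :
    ∑ d ∈ cube N, (if (N : ℤ) ∣ d.1 + d.2.1 + d.2.2 - a then u d.1 * v d.2.2 else 0) =
      (∑ d ∈ range N, u d) * ∑ d ∈ range N, v d := by
  rw [sum_cube, sum_mul_sum]
  refine sum_congr rfl fun x _ => ?_
  rw [sum_comm]
  refine sum_congr rfl fun z _ => ?_
  rw [← sum_ite_dvd_sub hN (a - x - z) (u x * v z)]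
  refine sum_congr rfl fun y _ => ?_
  rw [show ((y : ℤ) - (a - x - z)) = x + y + z - a by ring]

lemma sum_cube_mod_snd_thd {N : ℕ} (hN : 0 < N) (a : ℤ) (u v : ℕ → ℂ) :
    ∑ d ∈ cube N, (if (N : ℤ) ∣ d.1 + d.2.1 + d.2.2 - a then u d.2.1 * v d.2.2 else 0) =
      (∑ d ∈ range N, u d) * ∑ d ∈ range N, v d := by
  rw [sum_cube, sum_mul_sum, sum_comm]
  refine sum_congr rfl fun y _ => ?_
  rw [sum_comm]
  refine sum_congr rfl fun z _ => ?_
  rw [← sum_ite_dvd_sub hN (a - y - z) (u y * v z)]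
  refine sum_congr rfl fun x _ => ?_
  rw [show ((x : ℤ) - (a - y - z)) = x + y + z - a by ring]

lemma sum_cube_mod_const {N : ℕ} (hN : 0 < N) (a : ℤ) (r : ℝ) :
    ∑ d ∈ cube N, (if (N : ℤ) ∣ d.1 + d.2.1 + d.2.2 - a then r else 0) = N ^ 2 * r := by
  have h := sum_cube_mod_fst_snd hN a (fun _ => (r : ℂ)) (fun _ => 1)
  simp only [mul_one, sum_const, card_range, nsmul_eq_mul] at h
  have h2 : ((∑ d ∈ cube N, (if (N : ℤ) ∣ d.1 + d.2.1 + d.2.2 - a then r else 0) : ℝ) : ℂ) =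
      ((N ^ 2 * r : ℝ) : ℂ) := by
    push_cast
    rw [pow_two, mul_right_comm, ← h]
    refine sum_congr rfl fun d _ => ?_
    split_ifs <;> simp
  exact_mod_cast h2

/-- The digit `d` minus the mean digit. -/
def cent (g d : ℕ) : ℝ := d - ((g : ℝ) - 1) / 2

/-- The variance of a uniform base-`g` digit. -/
def digitVar (g : ℕ) : ℝ := ((g : ℝ) ^ 2 - 1) / 12

lemma sum_cent (g : ℕ) : ∑ d ∈ range g, (cent g d : ℂ) = 0 := by
  have h : ∀ c : ℝ, ∀ n : ℕ, ∑ d ∈ range n, ((d : ℝ) - c) = n * ((n - 1) / 2 - c) := by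
    intro c n
    induction n with
    | zero => simp
    | succ n ih => rw [sum_range_succ, ih]; push_cast; ring
  rw [← Complex.ofReal_sum]
  simp only [cent, h]
  simp

lemma sum_cent_sq (g : ℕ) : ∑ d ∈ range g, (cent g d : ℂ) ^ 2 = g * digitVar g := by
  have h : ∀ c : ℝ, ∀ n : ℕ, ∑ d ∈ range n, ((d : ℝ) - c) ^ 2 =
      n * ((n - 1) * (2 * n - 1) / 6 - c * (n - 1) + c ^ 2) := by
    intro c n
    induction n with
    | zero => simp
    | succ n ih => rw [sum_range_succ, ih]; push_cast; ring
  have h2 : ∑ d ∈ range g, cent g d ^ 2 = g * digitVar g := by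
    simp only [cent, h, digitVar]; ring
  exact_mod_cast congrArg ((↑) : ℝ → ℂ) h2

lemma abs_cent_le {g d : ℕ} (hd : d < g) : |cent g d| ≤ g / 2 := by
  have h : (d : ℝ) + 1 ≤ g := by exact_mod_cast hd
  have h0 : (0 : ℝ) ≤ d := by positivity
  rw [cent, abs_le]
  constructor <;> linarith

lemma norm_exp_I_sub_taylor_le (u : ℝ) :
    ‖Complex.exp (Complex.I * u) - (1 + Complex.I * u - (u : ℂ) ^ 2 / 2)‖ ≤ 4 * |u| ^ 3 := by
  have hI : (Complex.I * u) ^ 2 = -(u : ℂ) ^ 2 := by rw [mul_pow, Complex.I_sq]; ring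
  have hn : ‖Complex.I * (u : ℂ)‖ = |u| := by simp
  rcases le_total |u| 1 with h | h
  · have h1 := Complex.norm_exp_sub_sum_le_norm_mul_exp (Complex.I * u) 3
    have h2 : ∑ m ∈ range 3, (Complex.I * u) ^ m / (m.factorial : ℂ) =
        1 + Complex.I * u - (u : ℂ) ^ 2 / 2 := by
      simp only [sum_range_succ, range_zero, sum_empty, hI]
      simp [Nat.factorial]
      ring
    rw [h2, hn] at h1
    refine h1.trans ?_
    rw [mul_comm]
    gcongr
    calc Real.exp |u| ≤ Real.exp 1 := Real.exp_le_exp.2 h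
      _ ≤ 4 := by linarith [Real.exp_one_lt_d9]
  · have h1 : ‖Complex.exp (Complex.I * u)‖ = 1 := by
      rw [mul_comm, Complex.norm_exp_ofReal_mul_I]
    have h2 : ‖(u : ℂ) ^ 2 / 2‖ = |u| ^ 2 / 2 := by simp
    have h3 := norm_sub_le (Complex.exp (Complex.I * u)) (1 + Complex.I * u - (u : ℂ) ^ 2 / 2)
    have h4 := norm_sub_le (1 + Complex.I * u) ((u : ℂ) ^ 2 / 2)
    have h5 := norm_add_le 1 (Complex.I * (u : ℂ))
    rw [norm_one, hn] at h5
    have h6 : |u| ≤ |u| ^ 3 := le_self_pow₀ h (by norm_num)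
    have h7 : |u| ^ 2 ≤ |u| ^ 3 := pow_le_pow_right₀ h (by norm_num)
    linarith

lemma abs_exp_neg_sub_le {v : ℝ} (hv : 0 ≤ v) : |Real.exp (-v) - (1 - v)| ≤ v ^ 2 := by
  have h1 := Real.add_one_le_exp (-v)
  rw [abs_of_nonneg (by linarith)]
  have h2 := Real.add_one_le_exp v
  have h3 : Real.exp (-v) * Real.exp v = 1 := by rw [← Real.exp_add]; simp
  have h4 : Real.exp (-v) * (1 + v) ≤ 1 := by
    have := Real.exp_pos (-v)
    nlinarith
  have h5 : Real.exp (-v) ≤ 1 - v + v ^ 2 := by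
    by_contra! hlt
    have : (1 - v + v ^ 2) * (1 + v) < Real.exp (-v) * (1 + v) := by gcongr
    nlinarith [pow_nonneg hv 3]
  linarith

/-- The limiting characteristic function of one triple of digits. -/
def gaussFactor (g : ℕ) (x y z : ℝ) : ℝ :=
  Real.exp (-(2 * Real.pi ^ 2 * digitVar g * (x ^ 2 + y ^ 2 + z ^ 2)))

lemma digitVar_nonneg {g : ℕ} (hg : 1 ≤ g) : 0 ≤ digitVar g := by
  have : (1 : ℝ) ≤ g := by exact_mod_cast hg
  rw [digitVar]
  have : (1 : ℝ) ≤ (g : ℝ) ^ 2 := one_le_pow₀ this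
  linarith

lemma gaussFactor_le_one {g : ℕ} (hg : 1 ≤ g) (x y z : ℝ) : gaussFactor g x y z ≤ 1 := by
  rw [gaussFactor, Real.exp_le_one_iff]
  have := digitVar_nonneg hg
  have : 0 ≤ 2 * Real.pi ^ 2 * digitVar g * (x ^ 2 + y ^ 2 + z ^ 2) := by positivity
  linarith

lemma norm_sum_cube_digits_sub_le {g : ℕ} (hg : 2 ≤ g) (a : ℤ) (x y z : ℝ)
    (h2 : |x| + |y| + |z| ≤ 2) :
    ‖∑ d ∈ cube g, (if (g : ℤ) ∣ d.1 + d.2.1 + d.2.2 - a then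
        e (x * cent g d.1 + y * cent g d.2.1 + z * cent g d.2.2) else 0) -
      g ^ 2 * gaussFactor g x y z‖ ≤
      g ^ 2 * ((4 * (Real.pi * g) ^ 3 + 8 * (Real.pi ^ 2 * g ^ 2) ^ 2) *
        (|x| + |y| + |z|) ^ 3) := by
  have hg0 : (0 : ℝ) < g := by positivity
  set τ := |x| + |y| + |z| with hτ
  have hτ0 : 0 ≤ τ := by positivity
  set V := 2 * Real.pi ^ 2 * digitVar g * (x ^ 2 + y ^ 2 + z ^ 2) with hV
  have hvar := digitVar_nonneg (show 1 ≤ g by omega)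
  have hV0 : 0 ≤ V := by positivity
  set w : ℕ × ℕ × ℕ → ℝ := fun d => x * cent g d.1 + y * cent g d.2.1 + z * cent g d.2.2 with hw
  set T : ℕ × ℕ × ℕ → ℂ := fun d =>
    1 + Complex.I * ((2 * Real.pi * w d : ℝ) : ℂ) - ((2 * Real.pi * w d : ℝ) : ℂ) ^ 2 / 2 with hT
  have hmain : ∑ d ∈ cube g, (if (g : ℤ) ∣ d.1 + d.2.1 + d.2.2 - a then T d else 0) =
      (g : ℂ) ^ 2 * ((1 - V : ℝ) : ℂ) := by
    have hgN : 0 < g := by omega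
    have e00 := sum_cube_mod_fst_snd hgN a (fun _ => 1) (fun _ => 1)
    have e10 := sum_cube_mod_fst_snd hgN a (fun d => 2 * Real.pi * Complex.I * x * cent g d) (fun _ => 1)
    have e01 := sum_cube_mod_fst_snd hgN a (fun _ => 2 * Real.pi * Complex.I * y) (fun d => cent g d)
    have e03 := sum_cube_mod_fst_thd hgN a (fun _ => 2 * Real.pi * Complex.I * z) (fun d => cent g d)
    have e20 := sum_cube_mod_fst_snd hgN a (fun d => -2 * Real.pi ^ 2 * x ^ 2 * cent g d ^ 2) (fun _ => 1)
    have e02 := sum_cube_mod_fst_snd hgN a (fun _ => -2 * Real.pi ^ 2 * y ^ 2) (fun d => cent g d ^ 2)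
    have e002 := sum_cube_mod_fst_thd hgN a (fun _ => -2 * Real.pi ^ 2 * z ^ 2) (fun d => cent g d ^ 2)
    have e11 := sum_cube_mod_fst_snd hgN a (fun d => -4 * Real.pi ^ 2 * x * y * cent g d) (fun d => cent g d)
    have e13 := sum_cube_mod_fst_thd hgN a (fun d => -4 * Real.pi ^ 2 * x * z * cent g d) (fun d => cent g d)
    have e23 := sum_cube_mod_snd_thd hgN a (fun d => -4 * Real.pi ^ 2 * y * z * cent g d) (fun d => cent g d)
    simp only [← mul_sum, sum_cent, sum_cent_sq, sum_const, card_range, nsmul_eq_mul, mul_zero,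
      zero_mul, mul_one] at e00 e10 e01 e03 e20 e02 e002 e11 e13 e23
    have hsplit : ∀ d : ℕ × ℕ × ℕ, T d = 1 + 2 * Real.pi * Complex.I * x * cent g d.1 +
        2 * Real.pi * Complex.I * y * cent g d.2.1 + 2 * Real.pi * Complex.I * z * cent g d.2.2 +
        -2 * Real.pi ^ 2 * x ^ 2 * cent g d.1 ^ 2 + -2 * Real.pi ^ 2 * y ^ 2 * cent g d.2.1 ^ 2 +
        -2 * Real.pi ^ 2 * z ^ 2 * cent g d.2.2 ^ 2 +
        -4 * Real.pi ^ 2 * x * y * cent g d.1 * cent g d.2.1 +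
        -4 * Real.pi ^ 2 * x * z * cent g d.1 * cent g d.2.2 +
        -4 * Real.pi ^ 2 * y * z * cent g d.2.1 * cent g d.2.2 := by
      intro d
      simp only [hT, hw]
      push_cast
      ring
    have hadd : ∀ (d : ℕ × ℕ × ℕ) (A B : ℂ),
        (if (g : ℤ) ∣ d.1 + d.2.1 + d.2.2 - a then A + B else 0) =
        (if (g : ℤ) ∣ d.1 + d.2.1 + d.2.2 - a then A else 0) +
        (if (g : ℤ) ∣ d.1 + d.2.1 + d.2.2 - a then B else 0) := by
      intro d A B; split_ifs <;> simp
    simp only [hsplit, hadd, sum_add_distrib]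
    rw [e00, e10, e01, e03, e20, e02, e002, e11, e13, e23, hV]
    push_cast
    ring
  have hdiff : ‖∑ d ∈ cube g, (if (g : ℤ) ∣ d.1 + d.2.1 + d.2.2 - a then e (w d) else 0) -
      ∑ d ∈ cube g, (if (g : ℤ) ∣ d.1 + d.2.1 + d.2.2 - a then T d else 0)‖ ≤
      g ^ 2 * (4 * (Real.pi * g * τ) ^ 3) := by
    rw [← sum_sub_distrib, ← sum_cube_mod_const (by omega) a]
    refine norm_sum_le_of_le _ fun d hd => ?_
    split_ifs
    · refine (norm_exp_I_sub_taylor_le (2 * Real.pi * w d)).trans ?_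
      rw [mem_cube] at hd
      gcongr
      rw [abs_mul, abs_of_pos Real.two_pi_pos]
      have hw' : |w d| ≤ g / 2 * τ := by
        have hb : ∀ (q : ℝ) (m : ℕ), m < g → |q * cent g m| ≤ g / 2 * |q| := by
          intro q m hm
          rw [abs_mul, mul_comm]
          exact mul_le_mul_of_nonneg_right (abs_cent_le hm) (abs_nonneg _)
        calc |w d| ≤ |x * cent g d.1| + |y * cent g d.2.1| + |z * cent g d.2.2| := abs_add_three _ _ _
          _ ≤ g / 2 * |x| + g / 2 * |y| + g / 2 * |z| :=
            add_le_add (add_le_add (hb _ _ hd.1) (hb _ _ hd.2.1)) (hb _ _ hd.2.2)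
          _ = g / 2 * τ := by rw [hτ]; ring
      calc 2 * Real.pi * |w d| ≤ 2 * Real.pi * (g / 2 * τ) := by gcongr
        _ = Real.pi * g * τ := by ring
    · simp
  have hexp : ‖(g : ℂ) ^ 2 * ((1 - V : ℝ) : ℂ) - (g : ℂ) ^ 2 * gaussFactor g x y z‖ ≤
      g ^ 2 * (8 * (Real.pi ^ 2 * g ^ 2) ^ 2 * τ ^ 3) := by
    rw [← mul_sub, ← Complex.ofReal_sub, norm_mul, Complex.norm_real, norm_sub_rev, norm_pow,
      Complex.norm_natCast, Real.norm_eq_abs]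
    gcongr
    refine (abs_exp_neg_sub_le hV0).trans ?_
    have hsq : x ^ 2 + y ^ 2 + z ^ 2 ≤ τ ^ 2 := by
      rw [hτ, ← sq_abs x, ← sq_abs y, ← sq_abs z]
      nlinarith [mul_nonneg (abs_nonneg x) (abs_nonneg y), mul_nonneg (abs_nonneg x) (abs_nonneg z),
        mul_nonneg (abs_nonneg y) (abs_nonneg z)]
    have hvar2 : digitVar g ≤ g ^ 2 := by rw [digitVar]; nlinarith [sq_nonneg (g : ℝ)]
    have hV2 : V ≤ 2 * Real.pi ^ 2 * g ^ 2 * τ ^ 2 := by rw [hV]; gcongr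
    calc V ^ 2 ≤ (2 * Real.pi ^ 2 * g ^ 2 * τ ^ 2) ^ 2 := by gcongr
      _ = 4 * (Real.pi ^ 2 * g ^ 2) ^ 2 * τ ^ 3 * τ := by ring
      _ ≤ 4 * (Real.pi ^ 2 * g ^ 2) ^ 2 * τ ^ 3 * 2 := by gcongr
      _ = _ := by ring
  have htri := norm_sub_le_norm_sub_add_norm_sub
    (∑ d ∈ cube g, (if (g : ℤ) ∣ d.1 + d.2.1 + d.2.2 - a then e (w d) else 0))
    (∑ d ∈ cube g, (if (g : ℤ) ∣ d.1 + d.2.1 + d.2.2 - a then T d else 0))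
    ((g : ℂ) ^ 2 * gaussFactor g x y z)
  rw [hmain] at htri hdiff
  refine htri.trans ((add_le_add hdiff hexp).trans_eq ?_)
  ring

/-! ### Triples of low-order digit blocks -/

/-- The digit sum of a `t`-digit block, minus its mean. -/
def centSum (g t n : ℕ) : ℝ := digitSum g n - t * (((g : ℝ) - 1) / 2)

/-- The exponential sum over triples of `t`-digit blocks with sum `m` modulo `g ^ t`. -/
def blockSum (g t : ℕ) (m : ℤ) (x y z : ℝ) : ℂ :=
  ∑ r ∈ cube (g ^ t), if ((g ^ t : ℕ) : ℤ) ∣ r.1 + r.2.1 + r.2.2 - m then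
    e (x * centSum g t r.1 + y * centSum g t r.2.1 + z * centSum g t r.2.2) else 0

lemma centSum_succ {g d : ℕ} (hg : 1 < g) (hd : d < g) (t r : ℕ) :
    centSum g (t + 1) (d + g * r) = cent g d + centSum g t r := by
  rw [centSum, centSum, cent, digitSum_add_mul hg hd]
  push_cast
  ring

lemma blockSum_succ {g : ℕ} (hg : 1 < g) (t : ℕ) (m : ℤ) (x y z : ℝ) :
    blockSum g (t + 1) m x y z = ∑ d ∈ cube g, if (g : ℤ) ∣ d.1 + d.2.1 + d.2.2 - m then
      e (x * cent g d.1 + y * cent g d.2.1 + z * cent g d.2.2) *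
        blockSum g t ((m - (d.1 + d.2.1 + d.2.2)) / g) x y z else 0 := by
  have hg0 : (g : ℤ) ≠ 0 := by positivity
  rw [blockSum, pow_succ', sum_cube_mul]
  refine sum_congr rfl fun d hd => ?_
  rw [mem_cube] at hd
  split_ifs with h
  · rw [blockSum, mul_sum]
    obtain ⟨q, hq⟩ := h
    have hdiv : (m - (d.1 + d.2.1 + d.2.2)) / (g : ℤ) = -q := by
      rw [show m - (d.1 + d.2.1 + d.2.2 : ℤ) = g * (-q) by linarith]
      exact Int.mul_ediv_cancel_left _ hg0
    rw [hdiv]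
    refine sum_congr rfl fun r _ => ?_
    simp only [centSum_succ hg hd.1, centSum_succ hg hd.2.1, centSum_succ hg hd.2.2]
    have hiff : ((g * g ^ t : ℕ) : ℤ) ∣ ((d.1 + g * r.1 : ℕ) : ℤ) + (d.2.1 + g * r.2.1 : ℕ) +
        (d.2.2 + g * r.2.2 : ℕ) - m ↔ ((g ^ t : ℕ) : ℤ) ∣ r.1 + r.2.1 + r.2.2 - -q := by
      have : ((d.1 + g * r.1 : ℕ) : ℤ) + (d.2.1 + g * r.2.1 : ℕ) +
        (d.2.2 + g * r.2.2 : ℕ) - m = g * (r.1 + r.2.1 + r.2.2 - -q) := by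
        push_cast; linear_combination hq
      rw [this, Nat.cast_mul]
      exact mul_dvd_mul_iff_left hg0
    simp only [hiff]
    split_ifs
    · rw [← e_add]; congr 1; ring
    · simp
  · refine sum_eq_zero fun r _ => if_neg fun hdvd => h ?_
    have h1 : (g : ℤ) ∣ ((d.1 + g * r.1 : ℕ) : ℤ) + (d.2.1 + g * r.2.1 : ℕ) +
        (d.2.2 + g * r.2.2 : ℕ) - m := (Dvd.intro _ (by push_cast; rfl)).trans hdvd
    have h2 : (g : ℤ) ∣ g * (r.1 + r.2.1 + r.2.2 : ℤ) := dvd_mul_right _ _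
    have h3 := dvd_sub h1 h2
    push_cast at h3
    rwa [show (d.1 + g * r.1 + (d.2.1 + g * r.2.1) + (d.2.2 + g * r.2.2) - m -
      g * (r.1 + r.2.1 + r.2.2) : ℤ) = d.1 + d.2.1 + d.2.2 - m by ring] at h3

/-- The constant in the third-order error term for one triple of digits. -/
def cubicConst (g : ℕ) : ℝ := 4 * (Real.pi * g) ^ 3 + 8 * (Real.pi ^ 2 * g ^ 2) ^ 2

lemma cubicConst_pos {g : ℕ} (hg : 1 ≤ g) : 0 < cubicConst g := by
  have : (0 : ℝ) < g := by exact_mod_cast hg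
  rw [cubicConst]
  positivity

lemma norm_blockSum_sub_le {g : ℕ} (hg : 2 ≤ g) (t : ℕ) (m : ℤ) (x y z : ℝ)
    (h2 : |x| + |y| + |z| ≤ 2) :
    ‖blockSum g t m x y z - ((g ^ (2 * t) * gaussFactor g x y z ^ t : ℝ) : ℂ)‖ ≤
      t * (g ^ (2 * t) * (cubicConst g * (|x| + |y| + |z|) ^ 3)) := by
  set η := cubicConst g * (|x| + |y| + |z|) ^ 3 with hη
  set l := gaussFactor g x y z with hl
  have hl1 : l ≤ 1 := gaussFactor_le_one (by omega) x y z
  have hl0 : 0 ≤ l := (Real.exp_pos _).le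
  have hη0 : 0 ≤ η := mul_nonneg (cubicConst_pos (by omega)).le (by positivity)
  induction t generalizing m with
  | zero =>
    have h0 : digitSum g 0 = 0 := by simp [digitSum]
    simp [blockSum, sum_cube, centSum, h0, e_zero]
  | succ t ih =>
    have hone := norm_sum_cube_digits_sub_le hg m x y z h2
    rw [← cubicConst, ← hη, ← hl] at hone
    set A := ∑ d ∈ cube g, (if (g : ℤ) ∣ d.1 + d.2.1 + d.2.2 - m then
        e (x * cent g d.1 + y * cent g d.2.1 + z * cent g d.2.2) else 0) with hA
    have h3 : ‖blockSum g (t + 1) m x y z - A * ((g ^ (2 * t) * l ^ t : ℝ) : ℂ)‖ ≤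
        g ^ 2 * (t * (g ^ (2 * t) * η)) := by
      rw [blockSum_succ (by omega), hA, sum_mul, ← sum_sub_distrib,
        ← sum_cube_mod_const (by omega : 0 < g) m]
      refine norm_sum_le_of_le _ fun d _ => ?_
      split_ifs
      · rw [← mul_sub, norm_mul, norm_e, one_mul]
        exact ih _
      · simp
    have h4 : ‖A * ((g ^ (2 * t) * l ^ t : ℝ) : ℂ) -
        ((g ^ (2 * (t + 1)) * l ^ (t + 1) : ℝ) : ℂ)‖ ≤ g ^ 2 * η * g ^ (2 * t) := by
      have : A * ((g ^ (2 * t) * l ^ t : ℝ) : ℂ) - ((g ^ (2 * (t + 1)) * l ^ (t + 1) : ℝ) : ℂ) =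
          (A - g ^ 2 * l) * ((g ^ (2 * t) * l ^ t : ℝ) : ℂ) := by push_cast; ring
      rw [this, norm_mul, Complex.norm_real, Real.norm_of_nonneg (by positivity)]
      refine mul_le_mul hone ?_ (by positivity) (by positivity)
      exact mul_le_of_le_one_right (by positivity) (pow_le_one₀ hl0 hl1)
    have h5 := norm_sub_le_norm_sub_add_norm_sub (blockSum g (t + 1) m x y z)
      (A * ((g ^ (2 * t) * l ^ t : ℝ) : ℂ)) ((g ^ (2 * (t + 1)) * l ^ (t + 1) : ℝ) : ℂ)
    refine h5.trans ((add_le_add h3 h4).trans_eq ?_)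
    push_cast
    ring

/-! ### Counting triples with a prescribed sum -/

lemma sum_range_tsub (N c : ℕ) (h : c ≤ N) :
    ((∑ i ∈ range N, (c - i) : ℕ) : ℝ) = c * (c + 1) / 2 := by
  induction N generalizing c with
  | zero => obtain rfl : c = 0 := by omega
            simp
  | succ N ih =>
    rw [sum_range_succ']
    cases c with
    | zero => simp
    | succ c =>
      have := ih c (by omega)
      simp only [Nat.add_sub_add_right, tsub_zero]
      push_cast at this ⊢
      rw [this]
      ring

lemma abs_card_slice_sub_le {N a c : ℕ} (hc : c ≤ N) :
    |(∑ b ∈ range N, ∑ d ∈ range N, (if (a + b + d : ℤ) = c then (1 : ℝ) else 0)) -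
      ((c - a : ℕ) : ℝ)| ≤ 1 := by
  have h1 : ∑ b ∈ range N, ∑ d ∈ range N, (if (a + b + d : ℤ) = c then (1 : ℝ) else 0) =
      (((range N).filter fun b => a + b ≤ c ∧ c < N + (a + b)).card : ℝ) := by
    rw [← sum_boole]
    refine sum_congr rfl fun b _ => ?_
    split_ifs with h
    · rw [sum_eq_single (c - (a + b))]
      · rw [if_pos (by omega)]
      · intro d _ hd
        rw [if_neg (by omega)]
      · intro hd
        rw [mem_range] at hd
        omega
    · refine sum_eq_zero fun d hd => if_neg ?_
      rw [mem_range] at hd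
      omega
  have h2 : (Ico 1 (c - a)) ⊆ (range N).filter fun b => a + b ≤ c ∧ c < N + (a + b) := by
    intro b hb
    simp only [mem_Ico, mem_filter, mem_range] at hb ⊢
    omega
  have h3 : (range N).filter (fun b => a + b ≤ c ∧ c < N + (a + b)) ⊆ range (c + 1 - a) := by
    intro b hb
    simp only [mem_filter, mem_range] at hb ⊢
    omega
  have h2' := card_le_card h2
  have h3' := card_le_card h3
  rw [Nat.card_Ico] at h2'
  rw [card_range] at h3'
  rw [h1, abs_le]
  have h4 : ((c - a : ℕ) : ℝ) ≤
      (((range N).filter fun b => a + b ≤ c ∧ c < N + (a + b)).card : ℝ) + 1 := by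
    exact_mod_cast (by omega)
  have h5 : (((range N).filter fun b => a + b ≤ c ∧ c < N + (a + b)).card : ℝ) ≤
      ((c - a : ℕ) : ℝ) + 1 := by
    exact_mod_cast (by omega)
  constructor <;> linarith

lemma abs_card_solutions_sub_le {N : ℕ} {c : ℤ} {x : ℝ} (h0 : 0 ≤ x) (hx : x ≤ N)
    (h1 : x - 3 ≤ c) (h2 : c ≤ x) :
    |∑ p ∈ cube N, (if (p.1 + p.2.1 + p.2.2 : ℤ) = c then (1 : ℝ) else 0) - x ^ 2 / 2| ≤
      5 * (N : ℝ) := by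
  rcases lt_or_ge c 0 with hneg | hnn
  · have hz : ∑ p ∈ cube N, (if (p.1 + p.2.1 + p.2.2 : ℤ) = c then (1 : ℝ) else 0) = 0 :=
      sum_eq_zero fun p _ => if_neg (by omega)
    have hneg' : (c : ℝ) < 0 := by exact_mod_cast hneg
    rw [hz, zero_sub, abs_neg, abs_of_nonneg (by positivity)]
    nlinarith
  · lift c to ℕ using hnn
    rw [Int.cast_natCast] at h1 h2
    have hcN : c ≤ N := by exact_mod_cast h2.trans hx
    have h3 : |∑ p ∈ cube N, (if (p.1 + p.2.1 + p.2.2 : ℤ) = c then (1 : ℝ) else 0) -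
        c * (c + 1) / 2| ≤ (N : ℝ) := by
      rw [← sum_range_tsub N c hcN, sum_cube, Nat.cast_sum, ← sum_sub_distrib]
      refine (abs_sum_le_sum_abs _ _).trans ?_
      refine (sum_le_sum fun a _ => abs_card_slice_sub_le hcN).trans_eq ?_
      simp
    have hc0 : (0 : ℝ) ≤ c := by positivity
    rw [abs_le] at h3 ⊢
    constructor <;> nlinarith

/-! ### The exponential sum over triples with a prescribed sum -/

/-- The three-variable exponential sum over digit sums of triples with sum `M`. -/
def tripleSum (g K : ℕ) (k₁ k₂ k₃ : ℤ) (M : ℕ) (x y z : ℝ) : ℂ :=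
  ∑ p ∈ triples (g ^ K) M, e (x * ((digitSum g p.1 : ℝ) - k₁) + y * ((digitSum g p.2.1 : ℝ) - k₂) +
    z * ((digitSum g p.2.2 : ℝ) - k₃))

lemma norm_e_sub_e_le (u v : ℝ) : ‖e u - e v‖ ≤ 2 * Real.pi * |u - v| := by
  have h : e u - e v = e v * (e (u - v) - 1) := by
    rw [mul_sub, ← e_add, mul_one]; ring_nf
  rw [h, norm_mul, norm_e, one_mul]
  exact norm_e_sub_one_le _

lemma norm_inner_sub_le {g t L M : ℕ} (hg : 1 < g) (hM : M ≤ g ^ (t + L)) (k₁ k₂ k₃ : ℤ) {B : ℝ}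
    (h₁ : |(t : ℝ) * (((g : ℝ) - 1) / 2) - k₁| ≤ B) (h₂ : |(t : ℝ) * (((g : ℝ) - 1) / 2) - k₂| ≤ B)
    (h₃ : |(t : ℝ) * (((g : ℝ) - 1) / 2) - k₃| ≤ B) (x y z : ℝ) {r : ℕ × ℕ × ℕ}
    (hr : r ∈ cube (g ^ t)) :
    ‖(∑ m ∈ cube (g ^ L),
      if (r.1 + g ^ t * m.1) + (r.2.1 + g ^ t * m.2.1) + (r.2.2 + g ^ t * m.2.2) = M then
        e (x * ((digitSum g (r.1 + g ^ t * m.1) : ℝ) - k₁) +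
          y * ((digitSum g (r.2.1 + g ^ t * m.2.1) : ℝ) - k₂) +
          z * ((digitSum g (r.2.2 + g ^ t * m.2.2) : ℝ) - k₃)) else 0) -
      (((M : ℝ) / g ^ t) ^ 2 / 2 : ℝ) *
        (if ((g ^ t : ℕ) : ℤ) ∣ r.1 + r.2.1 + r.2.2 - M then
          e (x * centSum g t r.1 + y * centSum g t r.2.1 + z * centSum g t r.2.2) else 0)‖ ≤
      if ((g ^ t : ℕ) : ℤ) ∣ r.1 + r.2.1 + r.2.2 - M then
        (6 * g ^ (2 * L) * (2 * Real.pi * ((g * L + B) * (|x| + |y| + |z|))) + 5 * g ^ L : ℝ)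
      else 0 := by
  have hg1 : (1 : ℝ) ≤ g := by exact_mod_cast hg.le
  have hgt : (0 : ℝ) < (g : ℝ) ^ t := by positivity
  have hgtZ : (0 : ℤ) < (g : ℤ) ^ t := by positivity
  rw [mem_cube] at hr
  split_ifs with hdvd
  · obtain ⟨q, hq⟩ := hdvd
    set v := x * centSum g t r.1 + y * centSum g t r.2.1 + z * centSum g t r.2.2 with hv
    set X := (M : ℝ) / g ^ t with hX
    set R := 2 * Real.pi * ((g * L + B) * (|x| + |y| + |z|)) with hR
    have hiff : ∀ m : ℕ × ℕ × ℕ,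
        (r.1 + g ^ t * m.1) + (r.2.1 + g ^ t * m.2.1) + (r.2.2 + g ^ t * m.2.2) = M ↔
        (m.1 + m.2.1 + m.2.2 : ℤ) = -q := by
      intro m
      rw [← Int.natCast_inj]
      push_cast at hq ⊢
      rw [← mul_right_inj' hgtZ.ne' (b := (m.1 + m.2.1 + m.2.2 : ℤ))]
      constructor <;> intro h
      · linear_combination h - hq
      · linear_combination h + hq
    have hqR : ((r.1 : ℝ) + r.2.1 + r.2.2) - M = g ^ t * q := by exact_mod_cast hq
    have hXq : X = ((r.1 : ℝ) + r.2.1 + r.2.2) / g ^ t + (-q : ℤ) := by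
      rw [hX]; push_cast; field_simp; linarith
    have hr0 : 0 ≤ ((r.1 : ℝ) + r.2.1 + r.2.2) / g ^ t := by positivity
    have hr3 : ((r.1 : ℝ) + r.2.1 + r.2.2) / g ^ t ≤ 3 := by
      rw [div_le_iff₀ hgt]
      have a1 : (r.1 : ℝ) ≤ g ^ t := by exact_mod_cast hr.1.le
      have a2 : (r.2.1 : ℝ) ≤ g ^ t := by exact_mod_cast hr.2.1.le
      have a3 : (r.2.2 : ℝ) ≤ g ^ t := by exact_mod_cast hr.2.2.le
      linarith
    have hX0 : 0 ≤ X := by positivity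
    have hXL : X ≤ (g ^ L : ℕ) := by
      rw [hX, div_le_iff₀ hgt, ← Nat.cast_pow, ← Nat.cast_mul, ← pow_add, add_comm L]
      exact_mod_cast hM
    have hcount := abs_card_solutions_sub_le hX0 hXL (c := -q) (by linarith) (by linarith)
    set S := ∑ p ∈ cube (g ^ L), (if (p.1 + p.2.1 + p.2.2 : ℤ) = -q then (1 : ℝ) else 0) with hS
    have hSle : S ≤ 6 * g ^ (2 * L) := by
      have h1 := (abs_le.1 hcount).2
      have h2 : (1 : ℝ) ≤ g ^ L := one_le_pow₀ hg1
      push_cast at h1 hXL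
      rw [mul_comm 2 L, pow_mul]
      nlinarith
    have hB0 : 0 ≤ B := (abs_nonneg _).trans h₁
    have hR0 : 0 ≤ R := by positivity
    have hterm : ∀ m ∈ cube (g ^ L),
        ‖e (x * ((digitSum g (r.1 + g ^ t * m.1) : ℝ) - k₁) +
          y * ((digitSum g (r.2.1 + g ^ t * m.2.1) : ℝ) - k₂) +
          z * ((digitSum g (r.2.2 + g ^ t * m.2.2) : ℝ) - k₃)) - e v‖ ≤ R := by
      intro m hm
      rw [mem_cube] at hm
      refine (norm_e_sub_e_le _ _).trans ?_
      rw [hR]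
      refine mul_le_mul_of_nonneg_left ?_ Real.two_pi_pos.le
      have hone : ∀ (a : ℕ) (k : ℤ) (w : ℝ), a < g ^ L →
          |(t : ℝ) * (((g : ℝ) - 1) / 2) - k| ≤ B →
          |w * ((digitSum g a : ℝ) + ((t : ℝ) * (((g : ℝ) - 1) / 2) - k))| ≤ (g * L + B) * |w| := by
        intro a k w ha hk
        rw [abs_mul, mul_comm]
        refine mul_le_mul_of_nonneg_right ((abs_add_le _ _).trans (add_le_add ?_ hk)) (abs_nonneg _)
        rw [abs_of_nonneg (by positivity)]
        exact_mod_cast digitSum_le hg L ha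
      rw [digitSum_add_pow_mul hg t hr.1, digitSum_add_pow_mul hg t hr.2.1,
        digitSum_add_pow_mul hg t hr.2.2, hv]
      simp only [centSum]
      calc _ = |x * ((digitSum g m.1 : ℝ) + ((t : ℝ) * (((g : ℝ) - 1) / 2) - k₁)) +
            y * ((digitSum g m.2.1 : ℝ) + ((t : ℝ) * (((g : ℝ) - 1) / 2) - k₂)) +
            z * ((digitSum g m.2.2 : ℝ) + ((t : ℝ) * (((g : ℝ) - 1) / 2) - k₃))| := by
              congr 1; push_cast; ring
        _ ≤ _ := abs_add_three _ _ _
        _ ≤ (g * L + B) * |x| + (g * L + B) * |y| + (g * L + B) * |z| :=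
          add_le_add (add_le_add (hone _ _ _ hm.1 h₁) (hone _ _ _ hm.2.1 h₂)) (hone _ _ _ hm.2.2 h₃)
        _ = _ := by ring
    have hA : ‖(∑ m ∈ cube (g ^ L),
        if (r.1 + g ^ t * m.1) + (r.2.1 + g ^ t * m.2.1) + (r.2.2 + g ^ t * m.2.2) = M then
        e (x * ((digitSum g (r.1 + g ^ t * m.1) : ℝ) - k₁) +
          y * ((digitSum g (r.2.1 + g ^ t * m.2.1) : ℝ) - k₂) +
          z * ((digitSum g (r.2.2 + g ^ t * m.2.2) : ℝ) - k₃)) else 0) - (S : ℂ) * e v‖ ≤ S * R := by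
      rw [hS, Complex.ofReal_sum, sum_mul, sum_mul, ← sum_sub_distrib]
      refine norm_sum_le_of_le _ fun m hm => ?_
      simp only [hiff]
      split_ifs
      · simpa using hterm m hm
      · simp
    have hB : ‖(S : ℂ) * e v - ((X ^ 2 / 2 : ℝ) : ℂ) * e v‖ ≤ 5 * g ^ L := by
      rw [← sub_mul, ← Complex.ofReal_sub, norm_mul, norm_e, mul_one, Complex.norm_real]
      exact_mod_cast hcount
    refine (norm_sub_le_norm_sub_add_norm_sub _ ((S : ℂ) * e v) _).trans (add_le_add ?_ hB)
    exact hA.trans (mul_le_mul_of_nonneg_right hSle hR0)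
  · rw [mul_zero, sub_zero, norm_le_zero_iff]
    refine sum_eq_zero fun m _ => if_neg fun h => hdvd ?_
    refine ⟨-(m.1 + m.2.1 + m.2.2), ?_⟩
    rw [← h]
    push_cast
    ring

lemma norm_tripleSum_sub_le {g t L M : ℕ} (hg : 2 ≤ g) (hM : M ≤ g ^ (t + L)) (k₁ k₂ k₃ : ℤ)
    {B : ℝ} (h₁ : |(t : ℝ) * (((g : ℝ) - 1) / 2) - k₁| ≤ B)
    (h₂ : |(t : ℝ) * (((g : ℝ) - 1) / 2) - k₂| ≤ B)
    (h₃ : |(t : ℝ) * (((g : ℝ) - 1) / 2) - k₃| ≤ B) {x y z : ℝ} (hxyz : |x| + |y| + |z| ≤ 2) :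
    ‖tripleSum g (t + L) k₁ k₂ k₃ M x y z -
      (((M : ℝ) ^ 2 / 2 * gaussFactor g x y z ^ (t + L) : ℝ) : ℂ)‖ ≤
      g ^ (2 * (t + L)) * (12 * Real.pi * ((g * L + B) * (|x| + |y| + |z|)) + 5 / g ^ L +
        t * (cubicConst g * (|x| + |y| + |z|) ^ 3) +
        L * (2 * Real.pi ^ 2 * digitVar g * (|x| + |y| + |z|) ^ 2)) := by
  have hg1 : (1 : ℝ) ≤ g := by exact_mod_cast (by omega)
  have hgt : (0 : ℝ) < (g : ℝ) ^ t := by positivity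
  have hgL : (0 : ℝ) < (g : ℝ) ^ L := by positivity
  set τ := |x| + |y| + |z| with hτ
  set l := gaussFactor g x y z with hl
  have hl1 : l ≤ 1 := gaussFactor_le_one (by omega) x y z
  have hl0 : 0 ≤ l := (Real.exp_pos _).le
  set X := (M : ℝ) / g ^ t with hX
  have hX0 : 0 ≤ X := by positivity
  have hMX : (M : ℝ) = g ^ t * X := by rw [hX]; field_simp
  have hXL : X ≤ g ^ L := by
    rw [hX, div_le_iff₀ hgt, ← pow_add, add_comm L]
    exact_mod_cast hM
  have hη0 : 0 ≤ cubicConst g * τ ^ 3 := mul_nonneg (cubicConst_pos (by omega)).le (by positivity)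
  have hA : ‖tripleSum g (t + L) k₁ k₂ k₃ M x y z - ((X ^ 2 / 2 : ℝ) : ℂ) * blockSum g t M x y z‖ ≤
      (g ^ t) ^ 2 * (6 * g ^ (2 * L) * (2 * Real.pi * ((g * L + B) * τ)) + 5 * g ^ L : ℝ) := by
    have hconst := sum_cube_mod_const (N := g ^ t) (by positivity) M
      (6 * g ^ (2 * L) * (2 * Real.pi * ((g * L + B) * τ)) + 5 * g ^ L : ℝ)
    rw [Nat.cast_pow (α := ℝ)] at hconst
    rw [← hconst, tripleSum, triples, sum_filter, ← cube, pow_add, sum_cube_mul, blockSum, mul_sum,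
      ← sum_sub_distrib]
    refine norm_sum_le_of_le _ fun r hr => ?_
    exact norm_inner_sub_le (by omega) hM k₁ k₂ k₃ h₁ h₂ h₃ x y z hr
  have hB : ‖((X ^ 2 / 2 : ℝ) : ℂ) * blockSum g t M x y z -
      (((M : ℝ) ^ 2 / 2 * l ^ t : ℝ) : ℂ)‖ ≤
      (g ^ L) ^ 2 * (t * (g ^ (2 * t) * (cubicConst g * τ ^ 3))) := by
    have h1 := norm_blockSum_sub_le hg t M x y z hxyz
    have h2 : (((M : ℝ) ^ 2 / 2 * l ^ t : ℝ) : ℂ) =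
        ((X ^ 2 / 2 : ℝ) : ℂ) * ((g ^ (2 * t) * l ^ t : ℝ) : ℂ) := by
      rw [← Complex.ofReal_mul, hMX]; congr 1; ring
    rw [h2, ← mul_sub, norm_mul, Complex.norm_real, Real.norm_of_nonneg (by positivity)]
    refine mul_le_mul ?_ h1 (norm_nonneg _) (by positivity)
    have : X ^ 2 ≤ (g ^ L) ^ 2 := by gcongr
    nlinarith [sq_nonneg X]
  have hC : ‖(((M : ℝ) ^ 2 / 2 * l ^ t : ℝ) : ℂ) - (((M : ℝ) ^ 2 / 2 * l ^ (t + L) : ℝ) : ℂ)‖ ≤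
      (g ^ t * g ^ L) ^ 2 * (L * (2 * Real.pi ^ 2 * digitVar g * τ ^ 2)) := by
    have hM2 : (M : ℝ) ^ 2 / 2 ≤ (g ^ t * g ^ L) ^ 2 := by
      have : (M : ℝ) ^ 2 ≤ (g ^ t * g ^ L) ^ 2 := by rw [hMX]; gcongr
      nlinarith [sq_nonneg (M : ℝ)]
    have hvar := digitVar_nonneg (show 1 ≤ g by omega)
    have hLl : 1 - l ^ L ≤ L * (2 * Real.pi ^ 2 * digitVar g * τ ^ 2) := by
      have hsq : x ^ 2 + y ^ 2 + z ^ 2 ≤ τ ^ 2 := by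
        rw [hτ, ← sq_abs x, ← sq_abs y, ← sq_abs z]
        nlinarith [mul_nonneg (abs_nonneg x) (abs_nonneg y),
          mul_nonneg (abs_nonneg x) (abs_nonneg z), mul_nonneg (abs_nonneg y) (abs_nonneg z)]
      rw [hl, gaussFactor, ← Real.exp_nat_mul]
      have h3 := Real.add_one_le_exp
        (L * -(2 * Real.pi ^ 2 * digitVar g * (x ^ 2 + y ^ 2 + z ^ 2)))
      have h4 : L * (2 * Real.pi ^ 2 * digitVar g * (x ^ 2 + y ^ 2 + z ^ 2)) ≤
        L * (2 * Real.pi ^ 2 * digitVar g * τ ^ 2) := by gcongr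
      linarith
    rw [← Complex.ofReal_sub, Complex.norm_real, ← mul_sub, norm_mul,
      Real.norm_of_nonneg (by positivity), show l ^ t - l ^ (t + L) = l ^ t * (1 - l ^ L) by ring]
    have h5 : 0 ≤ 1 - l ^ L := sub_nonneg.2 (pow_le_one₀ hl0 hl1)
    rw [Real.norm_of_nonneg (by positivity)]
    refine mul_le_mul hM2 ?_ (by positivity) (by positivity)
    refine (mul_le_of_le_one_left h5 (pow_le_one₀ hl0 hl1)).trans hLl
  have htri := (norm_sub_le_norm_sub_add_norm_sub _ _ _).trans (add_le_add
    ((norm_sub_le_norm_sub_add_norm_sub _ _ _).trans (add_le_add hA hB)) hC)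
  refine htri.trans_eq ?_
  field_simp
  ring

/-! ### Large frequencies -/

lemma norm_expSum_digitSum (g K : ℕ) (k : ℤ) (θ α : ℝ) :
    ‖expSum (fun n => e (θ * ((digitSum g n : ℝ) - k))) (g ^ K) α‖ = ‖digitExpSum g K θ α‖ := by
  have : expSum (fun n => e (θ * ((digitSum g n : ℝ) - k))) (g ^ K) α =
      e (-(θ * k)) * digitExpSum g K θ α := by
    rw [expSum, digitExpSum, mul_sum]
    refine sum_congr rfl fun n _ => ?_
    rw [← e_add, ← e_add]
    ring_nf
  rw [this, norm_mul, norm_e, one_mul]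

lemma div_three_le_norm_unitAddCircle {x : ℝ} (hx : |x| ≤ 3 / 4) :
    |x| / 3 ≤ ‖(x : UnitAddCircle)‖ := by
  rcases le_or_gt (|x|) (1 / 2) with h | h
  · rw [(AddCircle.norm_coe_eq_abs_iff 1 one_ne_zero).2 (by simpa using h)]
    linarith [abs_nonneg x]
  · rw [UnitAddCircle.norm_eq]
    rcases eq_or_ne (round x) 0 with h0 | h0
    · rw [h0]; simp; linarith
    · have h1 : (1 : ℝ) ≤ |(round x : ℝ)| := by exact_mod_cast Int.one_le_abs h0
      have h2 := abs_sub_abs_le_abs_sub (round x : ℝ) x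
      rw [abs_sub_comm] at h2
      linarith

lemma norm_tripleSum_le {g K : ℕ} (hg : 3 ≤ g) (k₁ k₂ k₃ : ℤ) (M : ℕ) {x y z δ : ℝ}
    (hδ : 0 ≤ δ) (hx : |x| ≤ 1 / (2 * ((g : ℝ) - 1))) (hy : |y| ≤ 1 / 2) (hz : |z| ≤ 1 / 2)
    (h : δ ≤ |x| ∨ δ ≤ |y| ∨ δ ≤ |z|) :
    ‖tripleSum g K k₁ k₂ k₃ M x y z‖ ≤
      3 * g ^ (2 * K) * Real.exp (-(((K - 1 : ℕ) : ℝ) * δ ^ 2 / (4 * g ^ 3))) := by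
  have hg3 : (3 : ℝ) ≤ g := by exact_mod_cast hg
  have hK : ((K - 1 : ℕ) : ℝ) ≤ K := by exact_mod_cast Nat.sub_le K 1
  set D : ℝ := g ^ K * Real.exp (-(((K - 1 : ℕ) : ℝ) * δ ^ 2 / (4 * g ^ 3))) with hD
  set f : ℤ → ℝ → ℕ → ℂ := fun k θ n => e (θ * ((digitSum g n : ℝ) - k)) with hf
  set S : ℝ → ℝ → ℝ := fun θ α => ∑ t ∈ range K, ‖((θ + g ^ t * α : ℝ) : UnitAddCircle)‖ ^ 2 with hS
  have hS0 : ∀ θ α, 0 ≤ S θ α := fun θ α => sum_nonneg fun _ _ => by positivity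
  have hx4 : |x| ≤ 1 / 4 := hx.trans (one_div_le_one_div_of_le (by norm_num) (by linarith))
  have hT : tripleSum g K k₁ k₂ k₃ M x y z =
      ∑ p ∈ triples (g ^ K) M, f k₁ x p.1 * f k₂ y p.2.1 * f k₃ z p.2.2 := by
    refine sum_congr rfl fun p _ => ?_
    simp only [hf]
    rw [← e_add, ← e_add]
  have hpair : ∀ (k k' : ℤ) (θ θ' α : ℝ),
      ((K - 1 : ℕ) : ℝ) * δ ^ 2 / (8 * g ^ 2) ≤ S θ α + S θ' α →
      ‖expSum (f k θ) (g ^ K) α‖ * ‖expSum (f k' θ') (g ^ K) α‖ ≤ D ^ 2 := by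
    intro k k' θ θ' α hSS
    rw [norm_expSum_digitSum, norm_expSum_digitSum]
    have h1 := norm_digitExpSum_le (show 2 ≤ g by omega) K θ α
    have h2 := norm_digitExpSum_le (show 2 ≤ g by omega) K θ' α
    refine (mul_le_mul h1 h2 (norm_nonneg _) (by positivity)).trans ?_
    have h3 : D ^ 2 = (g : ℝ) ^ K * g ^ K *
        Real.exp (-(((K - 1 : ℕ) : ℝ) * δ ^ 2 / (2 * g ^ 3))) := by
      rw [hD, mul_pow, ← Real.exp_nat_mul, pow_two]
      congr 2
      push_cast
      field_simp
      norm_num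
      ring
    rw [h3, mul_mul_mul_comm, ← Real.exp_add]
    gcongr
    have h4 : ((K - 1 : ℕ) : ℝ) * δ ^ 2 / (2 * g ^ 3) =
        4 / g * (((K - 1 : ℕ) : ℝ) * δ ^ 2 / (8 * g ^ 2)) := by
      field_simp
      ring
    rw [h4]
    have h5 : 4 / (g : ℝ) * (((K - 1 : ℕ) : ℝ) * δ ^ 2 / (8 * g ^ 2)) ≤
        4 / g * (S θ α + S θ' α) := by gcongr
    simp only [hS] at h5
    linarith
  have hdiff : ∀ w α : ℝ, |x| < δ / 2 → δ ≤ |w| → |w| ≤ 1 / 2 →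
      ((K - 1 : ℕ) : ℝ) * δ ^ 2 / (8 * g ^ 2) ≤ S x α + S w α := by
    intro w α hxδ hw hw2
    have h1 : δ / 2 ≤ |x - w| := by
      have := abs_sub_abs_le_abs_sub w x
      rw [abs_sub_comm] at this
      linarith
    have h2 : |x - w| ≤ 3 / 4 := by linarith [abs_sub x w]
    have h3 : δ / 6 ≤ ‖((x - w : ℝ) : UnitAddCircle)‖ := by
      linarith [div_three_le_norm_unitAddCircle h2]
    have h4 : K * ‖((x - w : ℝ) : UnitAddCircle)‖ ^ 2 ≤ 2 * (S x α + S w α) := by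
      simp only [hS]
      rw [← sum_add_distrib, mul_sum, ← nsmul_eq_mul]
      nth_rw 1 [← card_range K]
      rw [← sum_const]
      refine sum_le_sum fun t _ => ?_
      have := sq_norm_sub_le ((x + g ^ t * α : ℝ) : UnitAddCircle) ((w + g ^ t * α : ℝ) : UnitAddCircle)
      rw [← AddCircle.coe_sub] at this
      rwa [show x + g ^ t * α - (w + g ^ t * α) = x - w by ring] at this
    have h5 : (δ / 6) ^ 2 ≤ ‖((x - w : ℝ) : UnitAddCircle)‖ ^ 2 := by gcongr
    have h6 : ((K - 1 : ℕ) : ℝ) * δ ^ 2 / (8 * g ^ 2) ≤ ((K - 1 : ℕ) : ℝ) * δ ^ 2 / 72 := by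
      gcongr; nlinarith
    have h7 : ((K - 1 : ℕ) : ℝ) * (δ / 6) ^ 2 ≤ K * ‖((x - w : ℝ) : UnitAddCircle)‖ ^ 2 := by
      gcongr
    nlinarith
  have hbig : ∀ α, δ / 2 ≤ |x| → ((K - 1 : ℕ) : ℝ) * δ ^ 2 / (8 * g ^ 2) ≤ S x α := by
    intro α hxδ
    have h1 := mul_sq_norm_digit_weight_le (show 1 ≤ g by omega) K x α
    have h2 : δ ≤ ‖((((g : ℝ) - 1) * x : ℝ) : UnitAddCircle)‖ := by
      have h3 : |((g : ℝ) - 1) * x| = ((g : ℝ) - 1) * |x| := by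
        rw [abs_mul, abs_of_nonneg (by linarith)]
      rw [(AddCircle.norm_coe_eq_abs_iff 1 one_ne_zero).2, h3]
      · nlinarith
      · rw [h3, abs_one]
        rw [le_div_iff₀ (by linarith)] at hx
        linarith
    have h4 : ((K - 1 : ℕ) : ℝ) * δ ^ 2 ≤ 4 * g ^ 2 * S x α := by
      refine le_trans ?_ h1
      gcongr
    rw [div_le_iff₀ (by positivity)]
    nlinarith [mul_nonneg (sq_nonneg (g : ℝ)) (hS0 x α)]
  rw [hT]
  have key : ∀ α, ‖expSum (f k₁ x) (g ^ K) α‖ * ‖expSum (f k₂ y) (g ^ K) α‖ ≤ D ^ 2 ∨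
      ‖expSum (f k₁ x) (g ^ K) α‖ * ‖expSum (f k₃ z) (g ^ K) α‖ ≤ D ^ 2 := by
    intro α
    rcases le_or_gt (δ / 2) |x| with hxδ | hxδ
    · exact .inl (hpair _ _ _ _ _ (by linarith [hbig α hxδ, hS0 y α]))
    · rcases h with h | h | h
      · linarith
      · exact .inl (hpair _ _ _ _ _ (hdiff y α hxδ h hy))
      · exact .inr (hpair _ _ _ _ _ (hdiff z α hxδ h hz))
  refine (norm_sum_triples_le (g ^ K) M _ _ _ (fun n => (norm_e _).le) (fun n => (norm_e _).le)
    (fun n => (norm_e _).le) (by positivity) key).trans_eq ?_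
  rw [hD]
  push_cast
  ring

/-! ### Integrating over the frequencies -/

/-- Lebesgue measure on the symmetric interval of half-length `h`. -/
def symmMeasure (h : ℝ) : Measure ℝ := volume.restrict (Set.Ioc (-h) h)

instance (h : ℝ) : IsFiniteMeasure (symmMeasure h) := by
  rw [symmMeasure]; infer_instance

/-- The frequency box: one third variable is shortened by a factor `g - 1`. -/
def freqMeasure (g : ℕ) : Measure (ℝ × ℝ × ℝ) :=
  (symmMeasure (1 / (2 * ((g : ℝ) - 1)))).prod ((symmMeasure (1 / 2)).prod (symmMeasure (1 / 2)))

instance (g : ℕ) : IsFiniteMeasure (freqMeasure g) := by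
  rw [freqMeasure]; infer_instance

lemma integral_symmMeasure_e {w : ℕ} (hw : 0 < w) (m : ℤ) :
    (w : ℂ) * ∫ x, e (x * ((w : ℝ) * m)) ∂symmMeasure (1 / (2 * w)) = if m = 0 then 1 else 0 := by
  rw [← integral_e_mul_int w hw m, symmMeasure, intervalIntegral.integral_of_le]
  have : 0 < 1 / (2 * (w : ℝ)) := by positivity
  linarith

lemma integral_freqMeasure_mul {𝕜 : Type*} [RCLike 𝕜] (g : ℕ) (u v w : ℝ → 𝕜) :
    ∫ p, u p.1 * (v p.2.1 * w p.2.2) ∂freqMeasure g =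
      (∫ x, u x ∂symmMeasure (1 / (2 * ((g : ℝ) - 1)))) *
        ((∫ x, v x ∂symmMeasure (1 / 2)) * ∫ x, w x ∂symmMeasure (1 / 2)) := by
  rw [freqMeasure, ← integral_prod_mul v w]
  exact integral_prod_mul u fun p : ℝ × ℝ => v p.1 * w p.2

lemma integrable_e_freqMeasure (g : ℕ) (a b c : ℝ) :
    Integrable (fun p : ℝ × ℝ × ℝ => e (p.1 * a + p.2.1 * b + p.2.2 * c)) (freqMeasure g) := by
  refine Integrable.of_bound (C := 1) (Continuous.aestronglyMeasurable (by fun_prop)) ?_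
  exact .of_forall fun p => (norm_e _).le

lemma integrable_tripleSum (g K : ℕ) (k₁ k₂ k₃ : ℤ) (M : ℕ) :
    Integrable (fun p : ℝ × ℝ × ℝ => tripleSum g K k₁ k₂ k₃ M p.1 p.2.1 p.2.2)
      (freqMeasure g) :=
  integrable_finsetSum _ fun _ _ => integrable_e_freqMeasure _ _ _ _

lemma rS_eq_integral {g : ℕ} (hg : 3 ≤ g) (K M : ℕ) {k₁ k₂ k₃ : ℤ}
    (hk : k₁ + k₂ + k₃ ≡ M [ZMOD ((g : ℤ) - 1)]) :
    (rS g K k₁ k₂ k₃ M : ℂ) =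
      ((g : ℝ) - 1 : ℝ) * ∫ p, tripleSum g K k₁ k₂ k₃ M p.1 p.2.1 p.2.2 ∂freqMeasure g := by
  have hg3 : (3 : ℝ) ≤ g := by exact_mod_cast hg
  rw [rS_eq]
  simp only [tripleSum]
  rw [integral_finsetSum _ fun _ _ => integrable_e_freqMeasure _ _ _ _, mul_sum]
  refine sum_congr rfl fun n hn => ?_
  have hsum : n.1 + n.2.1 + n.2.2 = M := (mem_filter.1 hn).2
  have hhalf : ∀ k m : ℤ, ∫ x, e (x * ((m : ℝ) - k)) ∂symmMeasure (1 / 2) =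
      if m - k = 0 then 1 else 0 := by
    intro k m
    have := integral_symmMeasure_e one_pos (m - k)
    simpa using this
  have hsplit : ∀ p : ℝ × ℝ × ℝ, e (p.1 * ((digitSum g n.1 : ℝ) - k₁) +
      p.2.1 * ((digitSum g n.2.1 : ℝ) - k₂) + p.2.2 * ((digitSum g n.2.2 : ℝ) - k₃)) =
      e (p.1 * ((digitSum g n.1 : ℝ) - k₁)) * (e (p.2.1 * (((digitSum g n.2.1 : ℤ) : ℝ) - k₂)) *
        e (p.2.2 * (((digitSum g n.2.2 : ℤ) : ℝ) - k₃))) := by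
    intro p
    rw [← e_add, ← e_add, add_assoc, Int.cast_natCast, Int.cast_natCast]
  simp only [hsplit]
  rw [integral_freqMeasure_mul g (fun x => e (x * ((digitSum g n.1 : ℝ) - k₁)))
    (fun x => e (x * (((digitSum g n.2.1 : ℤ) : ℝ) - k₂)))
    (fun x => e (x * (((digitSum g n.2.2 : ℤ) : ℝ) - k₃))), hhalf, hhalf]
  simp only [digitInd]
  by_cases h2 : (digitSum g n.2.1 : ℤ) = k₂
  · by_cases h3 : (digitSum g n.2.2 : ℤ) = k₃
    · have hdvd : ((g : ℤ) - 1) ∣ (digitSum g n.1 : ℤ) - k₁ := by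
        have m1 := digitSum_modEq hg n.1
        have m2 := digitSum_modEq hg n.2.1
        have m3 := digitSum_modEq hg n.2.2
        have h4 : (digitSum g n.1 : ℤ) + k₂ + k₃ ≡ k₁ + k₂ + k₃ [ZMOD ((g : ℤ) - 1)] := by
          refine Int.ModEq.trans ?_ hk.symm
          rw [← hsum, ← h2, ← h3]
          push_cast
          exact ((m1.add m2).add m3).symm
        have h5 := h4.symm.dvd
        rwa [show (digitSum g n.1 : ℤ) + k₂ + k₃ - (k₁ + k₂ + k₃) = digitSum g n.1 - k₁ by ring]
          at h5
      obtain ⟨m, hm⟩ := hdvd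
      have h6 := integral_symmMeasure_e (show 0 < g - 1 by omega) m
      have hcast : ((g - 1 : ℕ) : ℝ) = (g : ℝ) - 1 := by push_cast [show 1 ≤ g by omega]; rfl
      rw [← Complex.ofReal_natCast, hcast] at h6
      have hmR : (digitSum g n.1 : ℝ) - k₁ = ((g : ℝ) - 1) * m := by exact_mod_cast hm
      rw [← hmR] at h6
      have hiff : (digitSum g n.1 : ℤ) = k₁ ↔ m = 0 := by
        rw [← sub_eq_zero, hm, mul_eq_zero]
        constructor
        · rintro (h | h) <;> omega
        · exact .inr
      simp only [h2, h3, sub_self, if_true, mul_one, h6, hiff]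
    · simp [h3, sub_eq_zero]
  · simp [h2, sub_eq_zero]

/-- The truncated Gaussian integral. -/
def gaussInt (a h : ℝ) : ℝ := ∫ x, Real.exp (-a * x ^ 2) ∂symmMeasure h

lemma gaussInt_nonneg (a h : ℝ) : 0 ≤ gaussInt a h :=
  integral_nonneg fun _ => (Real.exp_pos _).le

lemma gaussInt_le {a : ℝ} (ha : 0 < a) (h : ℝ) : gaussInt a h ≤ √(Real.pi / a) := by
  rw [← integral_gaussian]
  exact setIntegral_le_integral (integrable_exp_neg_mul_sq ha) (.of_forall fun _ => (Real.exp_pos _).le)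

lemma sub_gaussInt_le {a h : ℝ} (ha : 2 * Real.pi ≤ a) (hh : 0 ≤ h) :
    √(Real.pi / a) - gaussInt a h ≤ Real.exp (-(a * h ^ 2 / 2)) := by
  have ha0 : 0 < a := Real.two_pi_pos.trans_le ha
  rw [← integral_gaussian, gaussInt, symmMeasure,
    ← integral_add_compl (s := Set.Ioc (-h) h) measurableSet_Ioc (integrable_exp_neg_mul_sq ha0),
    add_sub_cancel_left]
  have h1 : ∫ x in (Set.Ioc (-h) h)ᶜ, Real.exp (-a * x ^ 2) ≤
      ∫ x in (Set.Ioc (-h) h)ᶜ, Real.exp (-(a * h ^ 2 / 2)) * Real.exp (-(a / 2) * x ^ 2) := by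
    refine setIntegral_mono_on (integrable_exp_neg_mul_sq ha0).integrableOn
      ((integrable_exp_neg_mul_sq (half_pos ha0)).const_mul _).integrableOn
      measurableSet_Ioc.compl fun x hx => ?_
    rw [← Real.exp_add, Real.exp_le_exp]
    have hx2 : h ^ 2 ≤ x ^ 2 := by
      rw [Set.mem_compl_iff, Set.mem_Ioc, not_and_or, not_lt, not_le] at hx
      rcases hx with hx | hx <;> nlinarith
    nlinarith
  have h2 : ∫ x in (Set.Ioc (-h) h)ᶜ, Real.exp (-(a * h ^ 2 / 2)) * Real.exp (-(a / 2) * x ^ 2) ≤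
      ∫ x, Real.exp (-(a * h ^ 2 / 2)) * Real.exp (-(a / 2) * x ^ 2) :=
    setIntegral_le_integral ((integrable_exp_neg_mul_sq (half_pos ha0)).const_mul _)
      (.of_forall fun _ => (mul_pos (Real.exp_pos _) (Real.exp_pos _)).le)
  refine h1.trans (h2.trans ?_)
  rw [integral_const_mul, integral_gaussian]
  refine mul_le_of_le_one_right (Real.exp_pos _).le ?_
  rw [Real.sqrt_le_one, div_le_one (half_pos ha0)]
  linarith

/-- The Gaussian rate attached to base-`g` digits. -/
def gaussRate (g : ℕ) : ℝ := 2 * Real.pi ^ 2 * digitVar g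

lemma gaussFactor_pow (g K : ℕ) (x y z : ℝ) :
    gaussFactor g x y z ^ K = Real.exp (-(gaussRate g * K) * x ^ 2) *
      (Real.exp (-(gaussRate g * K) * y ^ 2) * Real.exp (-(gaussRate g * K) * z ^ 2)) := by
  rw [gaussFactor, ← Real.exp_nat_mul, ← Real.exp_add, ← Real.exp_add, gaussRate]
  ring_nf

lemma two_pi_le_gaussRate {g : ℕ} (hg : 3 ≤ g) : 2 * Real.pi ≤ gaussRate g := by
  have hg3 : (3 : ℝ) ≤ g := by exact_mod_cast hg
  have h1 : 2 / 3 ≤ digitVar g := by rw [digitVar]; nlinarith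
  have h2 := Real.pi_gt_three
  rw [gaussRate]
  nlinarith [mul_pos Real.pi_pos Real.pi_pos]

lemma integral_indicator_symmMeasure {δ : ℝ} (h : ℝ) :
    ∫ x, (Set.Icc (-δ) δ).indicator 1 x ∂symmMeasure h =
      (volume.restrict (Set.Ioc (-h) h)).real (Set.Icc (-δ) δ) :=
  integral_indicator_one measurableSet_Icc

lemma integral_indicator_symmMeasure_le {δ : ℝ} (hδ : 0 ≤ δ) (h : ℝ) :
    ∫ x, (Set.Icc (-δ) δ).indicator (1 : ℝ → ℝ) x ∂symmMeasure h ≤ 2 * δ := by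
  rw [integral_indicator_symmMeasure, measureReal_restrict_apply measurableSet_Icc]
  refine (measureReal_mono Set.inter_subset_left measure_Icc_lt_top.ne).trans_eq ?_
  rw [Real.volume_real_Icc_of_le (by linarith)]
  ring

lemma ae_freqMeasure (g : ℕ) : ∀ᵐ p ∂freqMeasure g,
    |p.1| ≤ 1 / (2 * ((g : ℝ) - 1)) ∧ |p.2.1| ≤ 1 / 2 ∧ |p.2.2| ≤ 1 / 2 := by
  have h : ∀ c : ℝ, ∀ᵐ x ∂symmMeasure c, |x| ≤ c := by
    intro c
    rw [symmMeasure]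
    refine (ae_restrict_mem measurableSet_Ioc).mono fun x hx => ?_
    exact abs_le.2 ⟨hx.1.le, hx.2⟩
  have h1 := (Measure.quasiMeasurePreserving_fst (μ := symmMeasure (1 / (2 * ((g : ℝ) - 1))))
    (ν := (symmMeasure (1 / 2)).prod (symmMeasure (1 / 2)))).ae (h _)
  have h2 := (Measure.quasiMeasurePreserving_snd (μ := symmMeasure (1 / (2 * ((g : ℝ) - 1))))
    (ν := (symmMeasure (1 / 2)).prod (symmMeasure (1 / 2)))).ae
      ((Measure.quasiMeasurePreserving_fst (μ := symmMeasure (1 / 2))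
        (ν := symmMeasure (1 / 2))).ae (h _))
  have h3 := (Measure.quasiMeasurePreserving_snd (μ := symmMeasure (1 / (2 * ((g : ℝ) - 1))))
    (ν := (symmMeasure (1 / 2)).prod (symmMeasure (1 / 2)))).ae
      ((Measure.quasiMeasurePreserving_snd (μ := symmMeasure (1 / 2))
        (ν := symmMeasure (1 / 2))).ae (h _))
  rw [freqMeasure]
  filter_upwards [h1, h2, h3] with p a b c
  exact ⟨a, b, c⟩

lemma freqMeasure_univ_le {g : ℕ} (hg : 3 ≤ g) : (freqMeasure g).real Set.univ ≤ 1 := by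
  have hg3 : (3 : ℝ) ≤ g := by exact_mod_cast hg
  have h := integral_freqMeasure_mul g (fun _ => (1 : ℝ)) (fun _ => (1 : ℝ)) (fun _ => (1 : ℝ))
  have h2 : ∀ c : ℝ, 0 ≤ c → c ≤ 1 / 2 → (symmMeasure c).real Set.univ ≤ 1 := by
    intro c hc0 hc
    rw [symmMeasure, measureReal_restrict_apply_univ, Real.volume_real_Ioc_of_le (by linarith)]
    linarith
  simp only [mul_one, integral_const, smul_eq_mul] at h
  rw [h]
  have h3 : 1 / (2 * ((g : ℝ) - 1)) ≤ 1 / 2 := one_div_le_one_div_of_le (by norm_num) (by linarith)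
  have h4 := h2 _ (one_div_nonneg.2 (by linarith)) h3
  have h5 := h2 (1 / 2) (by norm_num) le_rfl
  exact mul_le_one₀ h4 (by positivity) (mul_le_one₀ h5 (by positivity) h5)

lemma norm_integral_sub_integral_le {g : ℕ} (hg : 3 ≤ g) {T G : ℝ × ℝ × ℝ → ℂ} {δ E F : ℝ}
    (hδ : 0 ≤ δ) (hE : 0 ≤ E) (hF : 0 ≤ F) (hT : Integrable T (freqMeasure g))
    (hG : Integrable G (freqMeasure g))
    (h : ∀ᵐ p ∂freqMeasure g, ‖T p - G p‖ ≤ E * ((Set.Icc (-δ) δ).indicator 1 p.1 *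
      ((Set.Icc (-δ) δ).indicator 1 p.2.1 * (Set.Icc (-δ) δ).indicator 1 p.2.2)) + F) :
    ‖∫ p, T p ∂freqMeasure g - ∫ p, G p ∂freqMeasure g‖ ≤ 8 * δ ^ 3 * E + F := by
  set I : ℝ → ℝ := (Set.Icc (-δ) δ).indicator 1 with hI
  have hI0 : ∀ x, 0 ≤ I x := fun x => Set.indicator_nonneg (fun _ _ => zero_le_one) x
  have hI1 : ∀ x, I x ≤ 1 := fun x => Set.indicator_le_self' (fun _ _ => zero_le_one) x
  have hIm : Measurable I := measurable_one.indicator measurableSet_Icc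
  have hint : Integrable (fun p : ℝ × ℝ × ℝ => I p.1 * (I p.2.1 * I p.2.2)) (freqMeasure g) := by
    refine Integrable.of_bound (C := 1) (Measurable.aestronglyMeasurable (by fun_prop)) ?_
    refine .of_forall fun p => ?_
    rw [Real.norm_of_nonneg (mul_nonneg (hI0 _) (mul_nonneg (hI0 _) (hI0 _)))]
    exact mul_le_one₀ (hI1 _) (mul_nonneg (hI0 _) (hI0 _)) (mul_le_one₀ (hI1 _) (hI0 _) (hI1 _))
  rw [← integral_sub hT hG]
  refine (norm_integral_le_of_norm_le ((hint.const_mul E).add (integrable_const F)) h).trans ?_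
  simp only [Pi.add_apply]
  rw [integral_add (hint.const_mul E) (integrable_const F), integral_const_mul,
    integral_freqMeasure_mul g I I I, integral_const, smul_eq_mul]
  have h1 : ∀ c, ∫ x, I x ∂symmMeasure c ≤ 2 * δ := integral_indicator_symmMeasure_le hδ
  have h0 : ∀ c, 0 ≤ ∫ x, I x ∂symmMeasure c := fun c => integral_nonneg hI0
  have h2 : (∫ x, I x ∂symmMeasure (1 / (2 * ((g : ℝ) - 1)))) *
      ((∫ x, I x ∂symmMeasure (1 / 2)) * ∫ x, I x ∂symmMeasure (1 / 2)) ≤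
      2 * δ * (2 * δ * (2 * δ)) := by
    have := h0 (1 / 2)
    have := h0 (1 / (2 * ((g : ℝ) - 1)))
    gcongr <;> exact h1 _
  have h3 := mul_le_mul_of_nonneg_left h2 hE
  have h4 := mul_le_mul_of_nonneg_right (freqMeasure_univ_le hg) hF
  linarith

/-- The error bound on the cube of frequencies of size at most `δ`. -/
def smallError (g K L : ℕ) (B δ : ℝ) : ℝ :=
  12 * Real.pi * ((g * L + B) * (3 * δ)) + 5 / g ^ L + K * (cubicConst g * (3 * δ) ^ 3) +
    L * (gaussRate g * (3 * δ) ^ 2)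

lemma norm_integral_tripleSum_sub_le {g K L M : ℕ} (hg : 3 ≤ g) (hL : L ≤ K) (hM : M ≤ g ^ K)
    (k₁ k₂ k₃ : ℤ) {B δ : ℝ} (hδ : 0 ≤ δ)
    (h₁ : |((K - L : ℕ) : ℝ) * (((g : ℝ) - 1) / 2) - k₁| ≤ B)
    (h₂ : |((K - L : ℕ) : ℝ) * (((g : ℝ) - 1) / 2) - k₂| ≤ B)
    (h₃ : |((K - L : ℕ) : ℝ) * (((g : ℝ) - 1) / 2) - k₃| ≤ B) :
    ‖∫ p, tripleSum g K k₁ k₂ k₃ M p.1 p.2.1 p.2.2 ∂freqMeasure g -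
      (((M : ℝ) ^ 2 / 2 * (gaussInt (gaussRate g * K) (1 / (2 * ((g : ℝ) - 1))) *
        (gaussInt (gaussRate g * K) (1 / 2) * gaussInt (gaussRate g * K) (1 / 2))) : ℝ) : ℂ)‖ ≤
      8 * δ ^ 3 * (g ^ (2 * K) * smallError g K L B δ) +
        4 * g ^ (2 * K) * Real.exp (-(((K - 1 : ℕ) : ℝ) * δ ^ 2 / (4 * g ^ 3))) := by
  have hg3 : (3 : ℝ) ≤ g := by exact_mod_cast hg
  have hB0 : 0 ≤ B := (abs_nonneg _).trans h₁
  have hrate := two_pi_le_gaussRate hg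
  have hrate0 : 0 < gaussRate g := Real.two_pi_pos.trans_le hrate
  have hcub := cubicConst_pos (show 1 ≤ g by omega)
  have hM2 : (M : ℝ) ^ 2 ≤ g ^ (2 * K) := by
    rw [mul_comm, pow_mul]
    gcongr
    exact_mod_cast hM
  have hE : 0 ≤ (g : ℝ) ^ (2 * K) * smallError g K L B δ := by
    rw [smallError]; positivity
  have hG : ∫ p : ℝ × ℝ × ℝ, (M : ℝ) ^ 2 / 2 * gaussFactor g p.1 p.2.1 p.2.2 ^ K ∂freqMeasure g =
      (M : ℝ) ^ 2 / 2 * (gaussInt (gaussRate g * K) (1 / (2 * ((g : ℝ) - 1))) *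
        (gaussInt (gaussRate g * K) (1 / 2) * gaussInt (gaussRate g * K) (1 / 2))) := by
    rw [integral_const_mul]
    simp only [gaussFactor_pow]
    congr 1
    exact integral_freqMeasure_mul g (fun x => Real.exp (-(gaussRate g * K) * x ^ 2))
      (fun x => Real.exp (-(gaussRate g * K) * x ^ 2))
      (fun x => Real.exp (-(gaussRate g * K) * x ^ 2))
  have hGint : Integrable (fun p : ℝ × ℝ × ℝ =>
      (((M : ℝ) ^ 2 / 2 * gaussFactor g p.1 p.2.1 p.2.2 ^ K : ℝ) : ℂ)) (freqMeasure g) := by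
    refine Integrable.of_bound (C := (M : ℝ) ^ 2 / 2)
      (Continuous.aestronglyMeasurable (by unfold gaussFactor; fun_prop)) ?_
    refine .of_forall fun p => ?_
    have hl0 : 0 ≤ gaussFactor g p.1 p.2.1 p.2.2 := (Real.exp_pos _).le
    rw [Complex.norm_real, Real.norm_of_nonneg (by positivity)]
    exact mul_le_of_le_one_right (by positivity)
      (pow_le_one₀ hl0 (gaussFactor_le_one (by omega) _ _ _))
  rw [← hG, ← integral_complex_ofReal]
  refine norm_integral_sub_integral_le hg hδ hE (by positivity)
    (integrable_tripleSum g K k₁ k₂ k₃ M) hGint ?_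
  filter_upwards [ae_freqMeasure g] with p hp
  obtain ⟨hx, hy, hz⟩ := hp
  by_cases hsmall : |p.1| ≤ δ ∧ |p.2.1| ≤ δ ∧ |p.2.2| ≤ δ
  · obtain ⟨sx, sy, sz⟩ := hsmall
    have hx4 : |p.1| ≤ 1 / 4 := hx.trans (one_div_le_one_div_of_le (by norm_num) (by linarith))
    have key := norm_tripleSum_sub_le (t := K - L) (L := L) (M := M) (by omega : 2 ≤ g)
      (by rwa [Nat.sub_add_cancel hL]) k₁ k₂ k₃ h₁ h₂ h₃
      (x := p.1) (y := p.2.1) (z := p.2.2) (by linarith)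
    rw [Nat.sub_add_cancel hL] at key
    rw [Set.indicator_of_mem (Set.mem_Icc.2 (abs_le.1 sx)), Set.indicator_of_mem (Set.mem_Icc.2 (abs_le.1 sy)),
      Set.indicator_of_mem (Set.mem_Icc.2 (abs_le.1 sz))]
    simp only [Pi.one_apply, mul_one]
    have hnn : 0 ≤ 4 * (g : ℝ) ^ (2 * K) *
      Real.exp (-(((K - 1 : ℕ) : ℝ) * δ ^ 2 / (4 * g ^ 3))) := by positivity
    refine (key.trans ?_).trans (le_add_of_nonneg_right hnn)
    have hτ : |p.1| + |p.2.1| + |p.2.2| ≤ 3 * δ := by linarith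
    have hKL : ((K - L : ℕ) : ℝ) ≤ K := by exact_mod_cast Nat.sub_le K L
    rw [smallError, ← gaussRate]
    gcongr
  · have hbig : δ ≤ |p.1| ∨ δ ≤ |p.2.1| ∨ δ ≤ |p.2.2| := by
      by_contra! hc
      exact hsmall ⟨hc.1.le, hc.2.1.le, hc.2.2.le⟩
    have key := norm_tripleSum_le (K := K) hg k₁ k₂ k₃ M hδ hx hy hz hbig
    have hind : ∀ x, 0 ≤ (Set.Icc (-δ) δ).indicator (1 : ℝ → ℝ) x :=
      fun x => Set.indicator_nonneg (fun _ _ => zero_le_one) x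
    have hnn := mul_nonneg hE (mul_nonneg (hind p.1) (mul_nonneg (hind p.2.1) (hind p.2.2)))
    refine le_trans ?_ (le_add_of_nonneg_left hnn)
    have hgauss : ‖(((M : ℝ) ^ 2 / 2 * gaussFactor g p.1 p.2.1 p.2.2 ^ K : ℝ) : ℂ)‖ ≤
        g ^ (2 * K) * Real.exp (-(((K - 1 : ℕ) : ℝ) * δ ^ 2 / (4 * g ^ 3))) := by
      have hl0 : 0 ≤ gaussFactor g p.1 p.2.1 p.2.2 := (Real.exp_pos _).le
      rw [Complex.norm_real, Real.norm_of_nonneg (by positivity)]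
      have hM2' : (M : ℝ) ^ 2 / 2 ≤ g ^ (2 * K) := by linarith [sq_nonneg (M : ℝ)]
      refine mul_le_mul hM2' ?_ (by positivity) (by positivity)
      rw [gaussFactor_pow, ← Real.exp_add, ← Real.exp_add, Real.exp_le_exp]
      have hδ2 : δ ^ 2 ≤ p.1 ^ 2 + (p.2.1 ^ 2 + p.2.2 ^ 2) := by
        have q1 := sq_nonneg p.1
        have q2 := sq_nonneg p.2.1
        have q3 := sq_nonneg p.2.2
        rcases hbig with h | h | h
        · have := pow_le_pow_left₀ hδ h 2
          rw [sq_abs] at this; linarith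
        · have := pow_le_pow_left₀ hδ h 2
          rw [sq_abs] at this; linarith
        · have := pow_le_pow_left₀ hδ h 2
          rw [sq_abs] at this; linarith
      have hK1 : ((K - 1 : ℕ) : ℝ) ≤ K := by exact_mod_cast Nat.sub_le K 1
      have h4 : ((K - 1 : ℕ) : ℝ) * δ ^ 2 / (4 * g ^ 3) ≤ ((K - 1 : ℕ) : ℝ) * δ ^ 2 / 1 := by
        gcongr
        have : (1 : ℝ) ≤ (g : ℝ) ^ 3 := one_le_pow₀ (by linarith)
        linarith
      have h5 : ((K - 1 : ℕ) : ℝ) * δ ^ 2 / 1 ≤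
          gaussRate g * K * (p.1 ^ 2 + (p.2.1 ^ 2 + p.2.2 ^ 2)) := by
        rw [div_one]
        refine mul_le_mul ?_ hδ2 (by positivity) (by positivity)
        refine hK1.trans (le_mul_of_one_le_left (by positivity) ?_)
        linarith [Real.pi_gt_three]
      linarith
    refine (norm_sub_le _ _).trans ((add_le_add key hgauss).trans_eq ?_)
    ring

lemma exp_neg_le_div_pow {y : ℝ} (hy : 0 < y) (n : ℕ) : Real.exp (-y) ≤ n.factorial / y ^ n := by
  have h := Real.pow_div_factorial_le_exp y hy.le n
  rw [Real.exp_neg, inv_le_comm₀ (Real.exp_pos _) (by positivity), inv_div]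
  exact h

lemma abs_prod_gaussInt_sub_le {a h : ℝ} (ha : 2 * Real.pi ≤ a) (hh : 0 ≤ h) (hh2 : h ≤ 1 / 2) :
    |gaussInt a h * (gaussInt a (1 / 2) * gaussInt a (1 / 2)) - √(Real.pi / a) ^ 3| ≤
      3 * Real.exp (-(a * h ^ 2 / 2)) := by
  have ha0 : 0 < a := Real.two_pi_pos.trans_le ha
  set s := √(Real.pi / a)
  have hs1 : s ≤ 1 := by
    rw [Real.sqrt_le_one, div_le_one ha0]
    linarith [Real.pi_pos]
  set ε := Real.exp (-(a * h ^ 2 / 2))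
  have hε : 0 < ε := Real.exp_pos _
  have e1 := sub_gaussInt_le ha hh
  have e2 : s - gaussInt a (1 / 2) ≤ ε := by
    refine (sub_gaussInt_le ha (by norm_num)).trans (Real.exp_le_exp.2 ?_)
    gcongr
  have u1 := gaussInt_le ha0 h
  have u2 := gaussInt_le ha0 (1 / 2)
  have l1 := gaussInt_nonneg a h
  have l2 := gaussInt_nonneg a (1 / 2)
  set p := gaussInt a h
  set q := gaussInt a (1 / 2)
  have hpq : p * (q * q) ≤ s ^ 3 := by
    calc p * (q * q) ≤ s * (s * s) := by gcongr
      _ = s ^ 3 := by ring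
  rw [abs_sub_comm, abs_of_nonneg (by linarith)]
  have hs0 : 0 ≤ s := Real.sqrt_nonneg _
  have hid : s ^ 3 - p * (q * q) = (s - p) * s ^ 2 + (s - q) * (p * s) + (s - q) * (p * q) := by ring
  have b1 : (s - p) * s ^ 2 ≤ ε * 1 :=
    mul_le_mul e1 (pow_le_one₀ hs0 hs1) (by positivity) hε.le
  have b2 : (s - q) * (p * s) ≤ ε * 1 :=
    mul_le_mul e2 (mul_le_one₀ (u1.trans hs1) hs0 hs1) (by positivity) hε.le
  have b3 : (s - q) * (p * q) ≤ ε * 1 :=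
    mul_le_mul e2 (mul_le_one₀ (u1.trans hs1) l2 (u2.trans hs1)) (by positivity) hε.le
  linarith

lemma smallError_le {g L : ℕ} (hg : 3 ≤ g) {K : ℕ} {A x : ℝ} (hA : 0 ≤ A) (hx : 1 ≤ x)
    (hK : (K : ℝ) = x ^ 32) (hL : x ≤ L) (hL2 : (L : ℝ) ≤ 2 * x) :
    smallError g K L (A + g * L) (x ^ 15)⁻¹ ≤
      (36 * Real.pi * (4 * g + A) + 5 * (13).factorial + 27 * cubicConst g + 18 * gaussRate g) /
        x ^ 13 := by
  have hx0 : 0 < x := by linarith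
  have hg3 : (3 : ℝ) ≤ g := by exact_mod_cast hg
  have hcub := cubicConst_pos (show 1 ≤ g by omega)
  have hrate : 0 < gaussRate g := Real.two_pi_pos.trans_le (two_pi_le_gaussRate hg)
  have t1 : 12 * Real.pi * ((g * L + (A + g * L)) * (3 * (x ^ 15)⁻¹)) ≤
      36 * Real.pi * (4 * g + A) / x ^ 13 := by
    have h1 : g * L + (A + g * L) ≤ (4 * g + A) * x := by nlinarith
    have h2 : x * x ^ 13 ≤ x ^ 15 := by
      rw [← pow_succ']
      exact pow_le_pow_right₀ hx (by norm_num)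
    calc 12 * Real.pi * ((g * L + (A + g * L)) * (3 * (x ^ 15)⁻¹))
        ≤ 12 * Real.pi * ((4 * g + A) * x * (3 * (x ^ 15)⁻¹)) := by gcongr
      _ = 36 * Real.pi * (4 * g + A) * (x / x ^ 15) := by ring
      _ ≤ 36 * Real.pi * (4 * g + A) * (1 / x ^ 13) := by
        refine mul_le_mul_of_nonneg_left ?_ (by positivity)
        rw [div_le_div_iff₀ (by positivity) (by positivity), one_mul]
        exact h2
      _ = _ := by ring
  have t2 : 5 / (g : ℝ) ^ L ≤ 5 * (13).factorial / x ^ 13 := by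
    have h1 : x ^ 13 / (13).factorial ≤ (g : ℝ) ^ L := by
      refine (Real.pow_div_factorial_le_exp x hx0.le 13).trans ?_
      refine (Real.exp_le_exp.2 hL).trans ?_
      rw [← mul_one (L : ℝ), Real.exp_nat_mul]
      gcongr
      linarith [Real.exp_one_lt_d9]
    have h2 : (0 : ℝ) < x ^ 13 / (13).factorial := by positivity
    calc 5 / (g : ℝ) ^ L ≤ 5 / (x ^ 13 / (13).factorial) := by gcongr
      _ = _ := by rw [div_div_eq_mul_div]
  have t3 : K * (cubicConst g * (3 * (x ^ 15)⁻¹) ^ 3) = 27 * cubicConst g / x ^ 13 := by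
    rw [hK]
    field_simp
    norm_num
  have t4 : L * (gaussRate g * (3 * (x ^ 15)⁻¹) ^ 2) ≤ 18 * gaussRate g / x ^ 13 := by
    have h2 : x * x ^ 13 ≤ x ^ 30 := by
      rw [← pow_succ']
      exact pow_le_pow_right₀ hx (by norm_num)
    calc L * (gaussRate g * (3 * (x ^ 15)⁻¹) ^ 2)
        ≤ 2 * x * (gaussRate g * (3 * (x ^ 15)⁻¹) ^ 2) := by gcongr
      _ = 18 * gaussRate g * (x / x ^ 30) := by
        rw [mul_pow, inv_pow, ← pow_mul]; ring
      _ ≤ 18 * gaussRate g * (1 / x ^ 13) := by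
        refine mul_le_mul_of_nonneg_left ?_ (by positivity)
        rw [div_le_div_iff₀ (by positivity) (by positivity), one_mul]
        exact h2
      _ = _ := by ring
  rw [smallError, t3]
  refine (add_le_add (add_le_add (add_le_add t1 t2) le_rfl) t4).trans_eq ?_
  ring

lemma exists_abs_rS_sub_le {g : ℕ} (hg : 3 ≤ g) {A : ℝ} (hA : 0 ≤ A) :
    ∃ C : ℝ, 0 < C ∧ ∀ (K M : ℕ) (k₁ k₂ k₃ : ℤ) (x : ℝ), 2 ≤ K → M ≤ g ^ K → 1 ≤ x →
      (K : ℝ) = x ^ 32 → k₁ + k₂ + k₃ ≡ M [ZMOD ((g : ℤ) - 1)] →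
      |(k₁ : ℝ) - muK g K| ≤ A → |(k₂ : ℝ) - muK g K| ≤ A → |(k₃ : ℝ) - muK g K| ≤ A →
      |(rS g K k₁ k₂ k₃ M : ℝ) -
        ((g : ℝ) - 1) * ((M : ℝ) ^ 2 / 2 * √(Real.pi / (gaussRate g * K)) ^ 3)| ≤
        C * g ^ (2 * K) / x ^ 56 := by
  have hg3 : (3 : ℝ) ≤ g := by exact_mod_cast hg
  have hcub := cubicConst_pos (show 1 ≤ g by omega)
  have hrate := two_pi_le_gaussRate hg
  have hrate0 : 0 < gaussRate g := Real.two_pi_pos.trans_le hrate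
  have hpi := Real.pi_gt_three
  set C₁ := 36 * Real.pi * (4 * g + A) + 5 * (13).factorial + 27 * cubicConst g +
    18 * gaussRate g with hC₁
  have hC₁0 : 0 < C₁ := by positivity
  set C₂ : ℝ := (28).factorial * (8 * g ^ 3) ^ 28 with hC₂
  have hC₂0 : 0 < C₂ := by positivity
  refine ⟨((g : ℝ) - 1) * (8 * C₁ + 6 * C₂), mul_pos (by linarith) (by positivity), ?_⟩
  intro K M k₁ k₂ k₃ x hK2 hM hx hK hmod h₁ h₂ h₃
  have hx0 : 0 < x := by linarith
  have hKR : (2 : ℝ) ≤ K := by exact_mod_cast hK2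
  set L := ⌈x⌉₊ with hL
  have hxL : x ≤ L := Nat.le_ceil x
  have hL2 : (L : ℝ) ≤ 2 * x := by linarith [Nat.ceil_lt_add_one hx0.le]
  have hLK : L ≤ K := by
    rw [hL, Nat.ceil_le, hK]
    exact le_self_pow₀ hx (by norm_num)
  have hB : ∀ k : ℤ, |(k : ℝ) - muK g K| ≤ A →
      |((K - L : ℕ) : ℝ) * (((g : ℝ) - 1) / 2) - k| ≤ A + g * L := by
    intro k hk
    rw [Nat.cast_sub hLK]
    have hL0 : (0 : ℝ) ≤ L := by positivity
    rw [muK, abs_le] at hk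
    rw [abs_le]
    constructor <;> nlinarith
  have key := norm_integral_tripleSum_sub_le hg hLK hM k₁ k₂ k₃ (δ := (x ^ 15)⁻¹) (by positivity)
    (hB k₁ h₁) (hB k₂ h₂) (hB k₃ h₃)
  set a := gaussRate g * K with ha
  have ha2 : 2 * Real.pi ≤ a := by rw [ha]; nlinarith
  have ha0 : 0 < a := Real.two_pi_pos.trans_le ha2
  set h : ℝ := 1 / (2 * ((g : ℝ) - 1)) with hh
  have hh0 : 0 ≤ h := one_div_nonneg.2 (by linarith)
  have hh2 : h ≤ 1 / 2 := one_div_le_one_div_of_le (by norm_num) (by linarith)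
  have hgauss := abs_prod_gaussInt_sub_le ha2 hh0 hh2
  set P := gaussInt a h * (gaussInt a (1 / 2) * gaussInt a (1 / 2)) with hP
  set s := √(Real.pi / a) with hs
  have hexp : Real.exp (-(x ^ 2 / (8 * g ^ 3))) ≤ C₂ / x ^ 56 := by
    refine (exp_neg_le_div_pow (by positivity) 28).trans_eq ?_
    rw [hC₂, div_pow, ← pow_mul, div_div_eq_mul_div]
  have hexp1 : Real.exp (-(((K - 1 : ℕ) : ℝ) * (x ^ 15)⁻¹ ^ 2 / (4 * g ^ 3))) ≤ C₂ / x ^ 56 := by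
    refine le_trans (Real.exp_le_exp.2 (neg_le_neg ?_)) hexp
    have h1 : x ^ 32 / 2 ≤ ((K - 1 : ℕ) : ℝ) := by
      rw [Nat.cast_sub (by omega), ← hK]; push_cast; linarith
    calc x ^ 2 / (8 * g ^ 3) = x ^ 32 / 2 * (x ^ 15)⁻¹ ^ 2 / (4 * g ^ 3) := by field_simp; norm_num
      _ ≤ _ := by gcongr
  have hexp2 : Real.exp (-(a * h ^ 2 / 2)) ≤ C₂ / x ^ 56 := by
    refine le_trans (Real.exp_le_exp.2 (neg_le_neg ?_)) hexp
    have h1 : x ^ 2 ≤ a := by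
      rw [ha, hK]
      have : x ^ 2 ≤ x ^ 32 := pow_le_pow_right₀ hx (by norm_num)
      nlinarith [pow_pos hx0 32]
    have h2 : 1 / (2 * (g : ℝ)) ≤ h := one_div_le_one_div_of_le (by linarith) (by linarith)
    calc x ^ 2 / (8 * g ^ 3) ≤ x ^ 2 / (8 * g ^ 2) := by
          gcongr
          · linarith
          · norm_num
      _ = x ^ 2 * (1 / (2 * (g : ℝ))) ^ 2 / 2 := by field_simp; norm_num
      _ ≤ _ := by gcongr
  have hsm := smallError_le hg (K := K) hA hx hK hxL hL2
  have hG : (0 : ℝ) < g ^ (2 * K) := by positivity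
  have hsm2 : 8 * (x ^ 15)⁻¹ ^ 3 * (g ^ (2 * K) * smallError g K L (A + g * L) (x ^ 15)⁻¹) ≤
      g ^ (2 * K) * (8 * C₁ / x ^ 56) := by
    calc 8 * (x ^ 15)⁻¹ ^ 3 * (g ^ (2 * K) * smallError g K L (A + g * L) (x ^ 15)⁻¹)
        ≤ 8 * (x ^ 15)⁻¹ ^ 3 * (g ^ (2 * K) * (C₁ / x ^ 13)) := by gcongr
      _ = g ^ (2 * K) * (8 * C₁ / x ^ 58) := by field_simp
      _ ≤ _ := by
        gcongr
        norm_num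
  have hM2 : (M : ℝ) ^ 2 / 2 ≤ g ^ (2 * K) / 2 := by
    rw [mul_comm 2 K, pow_mul]
    gcongr
    exact_mod_cast hM
  have hmain : ‖∫ p, tripleSum g K k₁ k₂ k₃ M p.1 p.2.1 p.2.2 ∂freqMeasure g -
      (((M : ℝ) ^ 2 / 2 * s ^ 3 : ℝ) : ℂ)‖ ≤ g ^ (2 * K) * ((8 * C₁ + 6 * C₂) / x ^ 56) := by
    have h1 : ‖(((M : ℝ) ^ 2 / 2 * P : ℝ) : ℂ) - (((M : ℝ) ^ 2 / 2 * s ^ 3 : ℝ) : ℂ)‖ ≤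
        g ^ (2 * K) / 2 * (3 * (C₂ / x ^ 56)) := by
      rw [← Complex.ofReal_sub, Complex.norm_real, ← mul_sub, norm_mul,
        Real.norm_of_nonneg (by positivity)]
      refine mul_le_mul hM2 (hgauss.trans ?_) (norm_nonneg _) (by positivity)
      gcongr
    refine (norm_sub_le_norm_sub_add_norm_sub _ _ _).trans ((add_le_add key h1).trans ?_)
    have h2 := mul_le_mul_of_nonneg_left hexp1 (show 0 ≤ 4 * (g : ℝ) ^ (2 * K) by positivity)
    have h3 : 0 ≤ g ^ (2 * K) * (C₂ / x ^ 56) := by positivity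
    rw [add_div, mul_add]
    have h4 : g ^ (2 * K) * (6 * C₂ / x ^ 56) = 6 * (g ^ (2 * K) * (C₂ / x ^ 56)) := by ring
    linarith
  have hfin : ((((rS g K k₁ k₂ k₃ M : ℝ) - ((g : ℝ) - 1) * ((M : ℝ) ^ 2 / 2 * s ^ 3) : ℝ)) : ℂ) =
      ((g : ℝ) - 1 : ℝ) * (∫ p, tripleSum g K k₁ k₂ k₃ M p.1 p.2.1 p.2.2 ∂freqMeasure g -
        (((M : ℝ) ^ 2 / 2 * s ^ 3 : ℝ) : ℂ)) := by
    rw [mul_sub, ← rS_eq_integral hg K M hmod]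
    push_cast
    ring
  rw [← Real.norm_eq_abs, ← Complex.norm_real, hfin, norm_mul, Complex.norm_real,
    Real.norm_of_nonneg (by linarith)]
  refine (mul_le_mul_of_nonneg_left hmain (by linarith)).trans_eq ?_
  ring

lemma exists_abs_rN_sub_le {g : ℕ} (hg : 3 ≤ g) :
    ∃ C : ℝ, 0 < C ∧ ∀ (K M k₁ k₂ k₃ : ℕ), 14400 * g ^ 4 ≤ K → 0 < k₁ → 0 < k₂ → 0 < k₃ →
      k₁ ≤ g * K → k₂ ≤ g * K → k₃ ≤ g * K → k₁.Coprime k₂ → k₁.Coprime k₃ →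
      k₁.Coprime g → k₂.Coprime g → k₃.Coprime g →
      |(rN g K k₁ k₂ k₃ M : ℝ) -
        (Nat.gcd (g - 1) k₁ * Nat.gcd (g - 1) k₂ * Nat.gcd (g - 1) k₃ : ℝ) / (k₁ * k₂ * k₃) *
          rS g K k₁ k₂ k₃ M| ≤ C * g ^ (2 * K) / (K : ℝ) ^ 5 := by
  have hg3 : (3 : ℝ) ≤ g := by exact_mod_cast hg
  refine ⟨3 * ((10).factorial * (64 * g ^ 3) ^ 10), by positivity, ?_⟩
  intro K M k₁ k₂ k₃ hK p₁ p₂ p₃ b₁ b₂ b₃ h₁₂ h₁₃ g₁ g₂ g₃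
  set y := √(K : ℝ) with hy
  have hyK : y ^ 2 = K := Real.sq_sqrt (by positivity)
  have hyg : 120 * (g : ℝ) ^ 2 ≤ y := by
    refine Real.le_sqrt_of_sq_le ?_
    have : ((14400 * g ^ 4 : ℕ) : ℝ) ≤ K := by exact_mod_cast hK
    push_cast at this
    linarith [show (120 * (g : ℝ) ^ 2) ^ 2 = 14400 * g ^ 4 by ring]
  have hy8 : 8 ≤ y := by nlinarith
  have hy0 : 0 < y := by linarith
  set W := ⌈y⌉₊
  have hyW : y ≤ W := Nat.le_ceil y
  have hW2 : (W : ℝ) ≤ 2 * y := by linarith [Nat.ceil_lt_add_one hy0.le]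
  have hW0 : (0 : ℝ) < W := hy0.trans_le hyW
  have hpow : (g * K) * (g * K) ≤ g ^ W := by
    have h1 : y ^ 5 / (5).factorial ≤ (g : ℝ) ^ W := by
      refine (Real.pow_div_factorial_le_exp y hy0.le 5).trans ?_
      refine (Real.exp_le_exp.2 hyW).trans ?_
      rw [← mul_one (W : ℝ), Real.exp_nat_mul]
      gcongr
      linarith [Real.exp_one_lt_d9]
    have h2 : ((g * K) * (g * K) : ℝ) ≤ y ^ 5 / (5).factorial := by
      rw [← hyK, le_div_iff₀ (by positivity)]
      norm_num [Nat.factorial]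
      calc (g * y ^ 2 * (g * y ^ 2) * 120 : ℝ) = 120 * g ^ 2 * y ^ 4 := by ring
        _ ≤ y * y ^ 4 := by gcongr
        _ = y ^ 5 := by ring
    exact_mod_cast h2.trans h1
  have key := norm_rN_sub_le hg K M W p₁ p₂ p₃ h₁₂ h₁₃ g₁ g₂ g₃
    ((Nat.mul_le_mul b₁ b₂).trans hpow) ((Nat.mul_le_mul b₁ b₃).trans hpow)
  refine key.trans ?_
  have hquot : y / 4 ≤ (((K - 1) / W : ℕ) : ℝ) := by
    have h1 := Nat.lt_div_mul_add (a := K - 1) (b := W) (by exact_mod_cast hW0)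
    have h2 : ((K - 1 : ℕ) : ℝ) < (((K - 1) / W : ℕ) : ℝ) * W + W := by exact_mod_cast h1
    rw [Nat.cast_sub (by have : 0 < g ^ 4 := by positivity
                         omega), ← hyK] at h2
    push_cast at h2
    set q : ℝ := (((K - 1) / W : ℕ) : ℝ)
    have hq : 0 ≤ q := by positivity
    nlinarith
  have hexp : Real.exp (-(((K - 1) / W : ℕ) : ℝ) / (16 * g ^ 3)) ≤
      (10).factorial * (64 * g ^ 3) ^ 10 / (K : ℝ) ^ 5 := by
    rw [neg_div]
    refine (Real.exp_le_exp.2 (neg_le_neg (a := y / (64 * g ^ 3)) ?_)).trans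
      ((exp_neg_le_div_pow (by positivity) 10).trans_eq ?_)
    · calc y / (64 * g ^ 3) = y / 4 / (16 * g ^ 3) := by field_simp; norm_num
        _ ≤ _ := by gcongr
    · rw [div_pow, div_div_eq_mul_div, ← hyK, ← pow_mul]
  refine (mul_le_mul_of_nonneg_left hexp
    (show 0 ≤ 3 * (g : ℝ) ^ (2 * K) by positivity)).trans_eq ?_
  ring

lemma abs_inv_prod_sub_inv_cube_le {k₁ k₂ k₃ u K g A : ℝ} (hK : 0 < K)
    (l₁ : K / 2 ≤ k₁) (l₂ : K / 2 ≤ k₂) (l₃ : K / 2 ≤ k₃) (lu : K / 2 ≤ u)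
    (b₁ : k₁ ≤ g * K) (b₂ : k₂ ≤ g * K) (bu : u ≤ g * K)
    (h₁ : |k₁ - u| ≤ A) (h₂ : |k₂ - u| ≤ A) (h₃ : |k₃ - u| ≤ A) :
    |1 / (k₁ * k₂ * k₃) - 1 / u ^ 3| ≤ 192 * A * g ^ 2 / K ^ 4 := by
  have p₁ : 0 < k₁ := by linarith
  have p₂ : 0 < k₂ := by linarith
  have p₃ : 0 < k₃ := by linarith
  have pu : 0 < u := by linarith
  have pg : 0 < g := by
    by_contra! h
    nlinarith
  have hA : 0 ≤ A := (abs_nonneg _).trans h₁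
  have hid : 1 / (k₁ * k₂ * k₃) - 1 / u ^ 3 =
      -((k₁ - u) * u ^ 2 + (k₂ - u) * (k₁ * u) + (k₃ - u) * (k₁ * k₂)) /
        (k₁ * k₂ * k₃ * u ^ 3) := by
    field_simp
    ring
  have hden : (K / 2) * (K / 2) * (K / 2) * (K / 2) ^ 3 ≤ k₁ * k₂ * k₃ * u ^ 3 := by gcongr
  have hnum : |(k₁ - u) * u ^ 2 + (k₂ - u) * (k₁ * u) + (k₃ - u) * (k₁ * k₂)| ≤
      3 * A * (g * K) ^ 2 := by
    have e₁ : |(k₁ - u) * u ^ 2| ≤ A * (g * K) ^ 2 := by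
      rw [abs_mul, abs_of_pos (by positivity : 0 < u ^ 2)]
      gcongr
    have e₂ : |(k₂ - u) * (k₁ * u)| ≤ A * ((g * K) * (g * K)) := by
      rw [abs_mul, abs_of_pos (by positivity : 0 < k₁ * u)]
      gcongr
    have e₃ : |(k₃ - u) * (k₁ * k₂)| ≤ A * ((g * K) * (g * K)) := by
      rw [abs_mul, abs_of_pos (by positivity : 0 < k₁ * k₂)]
      gcongr
    refine (abs_add_three _ _ _).trans ?_
    linarith
  rw [hid, abs_div, abs_neg, abs_of_pos (by positivity : 0 < k₁ * k₂ * k₃ * u ^ 3)]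
  calc _ ≤ 3 * A * (g * K) ^ 2 / ((K / 2) * (K / 2) * (K / 2) * (K / 2) ^ 3) := by gcongr
    _ = _ := by
      field_simp
      ring

lemma abs_mul_inv_prod_sub_le {k₁ k₂ k₃ u K g A D D₀ R m e m₀ : ℝ} (hK : 0 < K)
    (l₁ : K / 2 ≤ k₁) (l₂ : K / 2 ≤ k₂) (l₃ : K / 2 ≤ k₃) (lu : K / 2 ≤ u)
    (b₁ : k₁ ≤ g * K) (b₂ : k₂ ≤ g * K) (bu : u ≤ g * K)
    (h₁ : |k₁ - u| ≤ A) (h₂ : |k₂ - u| ≤ A) (h₃ : |k₃ - u| ≤ A)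
    (hD : 0 ≤ D) (hD₀ : D ≤ D₀) (hR : |R - m| ≤ e) (hm : 0 ≤ m) (hm₀ : m ≤ m₀) :
    |D / (k₁ * k₂ * k₃) * R - D / u ^ 3 * m| ≤
      D₀ * (8 / K ^ 3 * e + m₀ * (192 * A * g ^ 2 / K ^ 4)) := by
  have p₁ : 0 < k₁ := by linarith
  have p₂ : 0 < k₂ := by linarith
  have p₃ : 0 < k₃ := by linarith
  have hinv := abs_inv_prod_sub_inv_cube_le hK l₁ l₂ l₃ lu b₁ b₂ bu h₁ h₂ h₃
  have hid : D / (k₁ * k₂ * k₃) * R - D / u ^ 3 * m =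
      D * (1 / (k₁ * k₂ * k₃) * (R - m) + m * (1 / (k₁ * k₂ * k₃) - 1 / u ^ 3)) := by ring
  have hden : 1 / (k₁ * k₂ * k₃) ≤ 8 / K ^ 3 := by
    calc 1 / (k₁ * k₂ * k₃) ≤ 1 / ((K / 2) * (K / 2) * (K / 2)) := by gcongr
      _ = _ := by field_simp; norm_num
  rw [hid, abs_mul, abs_of_nonneg hD]
  have := hm.trans hm₀
  refine mul_le_mul hD₀ ((abs_add_le _ _).trans ?_) (abs_nonneg _) (hD.trans hD₀)
  rw [abs_mul, abs_mul, abs_of_nonneg hm,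
    abs_of_pos (by positivity : 0 < 1 / (k₁ * k₂ * k₃))]
  gcongr

lemma sqrt_pi_div_gaussRate_mul (g : ℕ) {K x : ℝ} (hx : 0 < x) (hK : K = x ^ 32) :
    √(Real.pi / (gaussRate g * K)) = 1 / (√(2 * Real.pi * digitVar g) * x ^ 16) := by
  have h1 : Real.pi / (gaussRate g * K) = 1 / (2 * Real.pi * digitVar g * (x ^ 16) ^ 2) := by
    rw [gaussRate, hK, ← pow_mul]
    rcases eq_or_ne (digitVar g) 0 with h | h
    · simp [h]
    · have := Real.pi_ne_zero
      field_simp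
  rw [h1, Real.sqrt_div zero_le_one, Real.sqrt_one, Real.sqrt_mul' _ (by positivity),
    Real.sqrt_sq (by positivity)]

lemma exists_abs_rN_sub_main_le {g : ℕ} (hg : 3 ≤ g) {A : ℝ} (hA : 0 ≤ A) :
    ∃ C : ℝ, 0 < C ∧ ∀ (K M k₁ k₂ k₃ : ℕ) (x : ℝ), 14400 * g ^ 4 ≤ K → M ≤ g ^ K → 0 < x →
      (K : ℝ) = x ^ 32 → (k₁ + k₂ + k₃ : ℤ) ≡ M [ZMOD ((g : ℤ) - 1)] →
      (K : ℝ) / 2 ≤ k₁ → (K : ℝ) / 2 ≤ k₂ → (K : ℝ) / 2 ≤ k₃ →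
      k₁ ≤ g * K → k₂ ≤ g * K → k₃ ≤ g * K → k₁.Coprime k₂ → k₁.Coprime k₃ →
      k₁.Coprime g → k₂.Coprime g → k₃.Coprime g →
      |(k₁ : ℝ) - muK g K| ≤ A → |(k₂ : ℝ) - muK g K| ≤ A → |(k₃ : ℝ) - muK g K| ≤ A →
      |(rN g K k₁ k₂ k₃ M : ℝ) -
        (Nat.gcd (g - 1) k₁ * Nat.gcd (g - 1) k₂ * Nat.gcd (g - 1) k₃ : ℝ) *
          (4 / ((g : ℝ) - 1) ^ 2) * M ^ 2 / (√(2 * Real.pi * digitVar g) ^ 3 * x ^ 144)| ≤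
        C * g ^ (2 * K) / x ^ 152 := by
  obtain ⟨C₁, hC₁, H₁⟩ := exists_abs_rN_sub_le hg
  obtain ⟨C₂, hC₂, H₂⟩ := exists_abs_rS_sub_le hg hA
  have hg3 : (3 : ℝ) ≤ g := by exact_mod_cast hg
  refine ⟨C₁ + g ^ 3 * (8 * C₂ + 192 * A * g ^ 3), by positivity, ?_⟩
  intro K M k₁ k₂ k₃ x hK hM hx0 hKx hmod l₁ l₂ l₃ b₁ b₂ b₃ h₁₂ h₁₃ g₁ g₂ g₃ d₁ d₂ d₃
  have hK2 : 2 ≤ K := by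
    have : 0 < g ^ 4 := by positivity
    omega
  have hKR : (2 : ℝ) ≤ K := by exact_mod_cast hK2
  have hx : 1 ≤ x := by
    by_contra! h
    have := pow_le_one₀ (n := 32) hx0.le h.le
    linarith
  have pos : ∀ k : ℕ, (K : ℝ) / 2 ≤ k → 0 < k := fun k hk => by
    have : (0 : ℝ) < k := by linarith
    exact_mod_cast this
  have E₁ := H₁ K M k₁ k₂ k₃ hK (pos _ l₁) (pos _ l₂) (pos _ l₃) b₁ b₂ b₃ h₁₂ h₁₃ g₁ g₂ g₃
  have E₂ := H₂ K M k₁ k₂ k₃ x hK2 hM hx hKx hmod (by exact_mod_cast d₁) (by exact_mod_cast d₂)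
    (by exact_mod_cast d₃)
  set D : ℝ := (Nat.gcd (g - 1) k₁ * Nat.gcd (g - 1) k₂ * Nat.gcd (g - 1) k₃ : ℝ) with hD
  set m : ℝ := ((g : ℝ) - 1) * ((M : ℝ) ^ 2 / 2 * √(Real.pi / (gaussRate g * K)) ^ 3) with hm
  have hσ : 1 ≤ 2 * Real.pi * digitVar g := by
    have : 2 * Real.pi ≤ Real.pi * (2 * Real.pi * digitVar g) := by
      linarith [two_pi_le_gaussRate hg,
        show gaussRate g = Real.pi * (2 * Real.pi * digitVar g) by rw [gaussRate]; ring]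
    nlinarith [Real.pi_pos]
  have hσ1 : 1 ≤ √(2 * Real.pi * digitVar g) := by rwa [Real.one_le_sqrt]
  set τ := √(2 * Real.pi * digitVar g)
  have hs : √(Real.pi / (gaussRate g * K)) = 1 / (τ * x ^ 16) := sqrt_pi_div_gaussRate_mul g hx0 hKx
  have hgcd : ∀ k : ℕ, Nat.gcd (g - 1) k ≤ g := fun k =>
    (Nat.gcd_le_left k (by omega : 0 < g - 1)).trans (by omega)
  have hDg : D ≤ (g : ℝ) ^ 3 := by
    calc D ≤ (g : ℝ) * g * g := by rw [hD]; gcongr <;> exact hgcd _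
      _ = _ := by ring
  have hM2 : (M : ℝ) ^ 2 ≤ g ^ (2 * K) := by
    rw [mul_comm 2 K, pow_mul]
    gcongr
    exact_mod_cast hM
  have hm0 : 0 ≤ m := mul_nonneg (by linarith) (by positivity)
  have hmle : m ≤ g * (g ^ (2 * K) / x ^ 48) := by
    rw [hm, hs, one_div, inv_pow, mul_pow, ← pow_mul]
    refine mul_le_mul (by linarith) ?_ (by positivity) (by positivity)
    rw [div_eq_mul_inv]
    refine mul_le_mul ((half_le_self (by positivity)).trans hM2) ?_ (by positivity) (by positivity)
    gcongr
    exact le_mul_of_one_le_left (by positivity) (one_le_pow₀ hσ1)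
  have hu1 : (K : ℝ) / 2 ≤ muK g K := by rw [muK]; nlinarith
  have hu2 : muK g K ≤ g * K := by rw [muK]; nlinarith
  have E₃ := abs_mul_inv_prod_sub_le (K := K) (g := g) (by linarith) l₁ l₂ l₃ hu1
    (by exact_mod_cast b₁) (by exact_mod_cast b₂) hu2 d₁ d₂ d₃ (by positivity) hDg E₂ hm0 hmle
  have hmain : D / muK g K ^ 3 * m = D * (4 / ((g : ℝ) - 1) ^ 2) * M ^ 2 / (τ ^ 3 * x ^ 144) := by
    have : (g : ℝ) - 1 ≠ 0 := by linarith
    have hτ : τ ≠ 0 := by linarith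
    rw [hm, hs, muK, hKx]
    field_simp
    ring
  rw [← hmain]
  refine (abs_sub_le _ _ _).trans ((add_le_add E₁ E₃).trans ?_)
  rw [hKx]
  have hp : ∀ n : ℕ, 152 ≤ n → 1 / x ^ n ≤ 1 / x ^ 152 := fun n hn =>
    one_div_le_one_div_of_le (by positivity) (pow_le_pow_right₀ hx hn)
  calc C₁ * g ^ (2 * K) / (x ^ 32) ^ 5 + g ^ 3 * (8 / (x ^ 32) ^ 3 * (C₂ * g ^ (2 * K) / x ^ 56) +
        g * (g ^ (2 * K) / x ^ 48) * (192 * A * g ^ 2 / (x ^ 32) ^ 4))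
      = g ^ (2 * K) * (C₁ * (1 / x ^ 160) + g ^ 3 * (8 * C₂ * (1 / x ^ 152) +
          192 * A * g ^ 3 * (1 / x ^ 176))) := by
        field_simp
    _ ≤ g ^ (2 * K) * (C₁ * (1 / x ^ 152) + g ^ 3 * (8 * C₂ * (1 / x ^ 152) +
          192 * A * g ^ 3 * (1 / x ^ 152))) := by
        gcongr _ * (_ * ?_ + _ * (_ + _ * ?_))
        · exact hp _ (by norm_num)
        · exact hp _ (by norm_num)
    _ = _ := by ring

lemma int_gcd_sub_one_natCast {g : ℕ} (hg : 1 ≤ g) (k : ℕ) :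
    Int.gcd ((g : ℤ) - 1) k = Nat.gcd (g - 1) k := by
  rw [← Int.gcd_natCast_natCast, Nat.cast_sub hg, Nat.cast_one]

end NivenSum

theorem statement2 (g : ℕ) (hg : 3 ≤ g) :
    ∃ c : ℝ, 0 < c ∧ ∃ K0 : ℕ, ∀ K : ℕ, K0 ≤ K →
      ∀ M : ℕ, g ^ (K - 1) < M → M ≤ g ^ K →
      ∀ k1 k2 k3 : ℤ,
        |(k1 : ℝ) - muK g K| ≤ Cg g →
        |(k2 : ℝ) - muK g K| ≤ Cg g →
        |(k3 : ℝ) - muK g K| ≤ Cg g →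
        k1 + k2 + k3 ≡ (M : ℤ) [ZMOD ((g : ℤ) - 1)] →
        Int.gcd k1 k2 = 1 → Int.gcd k1 k3 = 1 → Int.gcd k2 k3 = 1 →
        Int.gcd k1 (g : ℤ) = 1 → Int.gcd k2 (g : ℤ) = 1 → Int.gcd k3 (g : ℤ) = 1 →
        |(rN g K k1 k2 k3 M : ℝ) -
            ((g : ℝ) - 1) ^ 2 * cgk g k1 k2 k3 / (4 * (k1 : ℝ) * (k2 : ℝ) * (k3 : ℝ)) *
              (rS g K k1 k2 k3 M : ℝ)| ≤
            c * (M : ℝ) ^ 2 * (K : ℝ) ^ (-(29 : ℝ) / 6) ∧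
        |(rN g K k1 k2 k3 M : ℝ) -
            cgk g k1 k2 k3 * (M : ℝ) ^ 2 /
              ((2 * Real.pi * (((g : ℝ) ^ 2 - 1) / 12)) ^ ((3 : ℝ) / 2) *
                (K : ℝ) ^ ((9 : ℝ) / 2))| ≤
          c * (M : ℝ) ^ 2 * Real.log K ^ 4 * (K : ℝ) ^ (-(19 : ℝ) / 4) := by
  obtain ⟨C₁, hC₁, H₁⟩ := NivenSum.exists_abs_rN_sub_le hg
  obtain ⟨C₂, hC₂, H₂⟩ := NivenSum.exists_abs_rN_sub_main_le hg (A := Cg g) (by positivity)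
  have hg3 : (3 : ℝ) ≤ g := by exact_mod_cast hg
  have hg1 : (g : ℝ) - 1 ≠ 0 := by linarith
  refine ⟨(C₁ + C₂) * g ^ 2, by positivity, 14400 * g ^ 4 + 2 * Cg g, ?_⟩
  intro K hK0 M hM1 hM k1 k2 k3 d₁ d₂ d₃ hmod h₁₂ h₁₃ _ g₁ g₂ g₃
  have hK : 14400 * g ^ 4 ≤ K := by omega
  have hKC : 2 * (Cg g : ℝ) ≤ K := by exact_mod_cast (by omega : 2 * Cg g ≤ K)
  have hK3 : 3 ≤ K := by
    have : 0 < g ^ 4 := by positivity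
    omega
  have hK3R : (3 : ℝ) ≤ K := by exact_mod_cast hK3
  have hK0R : (0 : ℝ) < K := by linarith
  have lower : ∀ k : ℤ, |(k : ℝ) - muK g K| ≤ Cg g → (K : ℝ) / 2 ≤ k := fun k hk => by
    rw [abs_le, muK] at hk
    nlinarith
  have upper : ∀ k : ℤ, |(k : ℝ) - muK g K| ≤ Cg g → (k : ℝ) ≤ g * K := fun k hk => by
    rw [abs_le, muK] at hk
    nlinarith
  have pos : ∀ k : ℤ, |(k : ℝ) - muK g K| ≤ Cg g → 0 < k := fun k hk => by
    have : (0 : ℝ) < k := by linarith [lower k hk]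
    exact_mod_cast this
  have p₁ := pos k1 d₁
  have p₂ := pos k2 d₂
  have p₃ := pos k3 d₃
  have l₁ := lower k1 d₁
  have l₂ := lower k2 d₂
  have l₃ := lower k3 d₃
  have u₁ := upper k1 d₁
  have u₂ := upper k2 d₂
  have u₃ := upper k3 d₃
  lift k1 to ℕ using p₁.le
  lift k2 to ℕ using p₂.le
  lift k3 to ℕ using p₃.le
  rw [Int.gcd_natCast_natCast] at h₁₂ h₁₃ g₁ g₂ g₃
  rw [Int.cast_natCast] at l₁ l₂ l₃ u₁ u₂ u₃ d₁ d₂ d₃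
  norm_cast at p₁ p₂ p₃ u₁ u₂ u₃
  have E₁ := H₁ K M k1 k2 k3 hK p₁ p₂ p₃ u₁ u₂ u₃ h₁₂ h₁₃ g₁ g₂ g₃
  have hxpow : ∀ n : ℕ, ((K : ℝ) ^ ((1 : ℝ) / 32)) ^ n = (K : ℝ) ^ ((n : ℝ) / 32) := fun n => by
    rw [← Real.rpow_natCast, ← Real.rpow_mul hK0R.le, one_div_mul_eq_div]
  have hx32 : (K : ℝ) = ((K : ℝ) ^ ((1 : ℝ) / 32)) ^ 32 := by
    rw [hxpow]
    norm_num
  have E₂ := H₂ K M k1 k2 k3 _ hK hM (by positivity) hx32 hmod l₁ l₂ l₃ u₁ u₂ u₃ h₁₂ h₁₃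
    g₁ g₂ g₃ d₁ d₂ d₃
  rw [hxpow, hxpow] at E₂
  have hG : (g : ℝ) ^ (2 * K) ≤ g ^ 2 * M ^ 2 := by
    have h1 : (g : ℝ) ^ K ≤ g * M := by
      calc (g : ℝ) ^ K = g * g ^ (K - 1) := by rw [← pow_succ', Nat.sub_add_cancel (by omega)]
        _ ≤ g * M := by gcongr; exact_mod_cast hM1.le
    rw [mul_comm 2 K, pow_mul, ← mul_pow]
    gcongr
  simp only [Int.cast_natCast, cgk, NivenSum.int_gcd_sub_one_natCast (show 1 ≤ g by omega)]
  constructor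
  · have hcoef : ∀ a b d k₁ k₂ k₃ : ℝ,
        ((g : ℝ) - 1) ^ 2 * (4 / ((g : ℝ) - 1) ^ 2 * a * b * d) / (4 * k₁ * k₂ * k₃) =
          a * b * d / (k₁ * k₂ * k₃) := fun a b d k₁ k₂ k₃ => by
      rw [show ((g : ℝ) - 1) ^ 2 * (4 / ((g : ℝ) - 1) ^ 2 * a * b * d) = 4 * (a * b * d) by
        field_simp, mul_assoc 4, mul_assoc 4, mul_div_mul_left _ _ four_ne_zero]
    rw [hcoef]
    refine E₁.trans ?_
    have hpow : 1 / (K : ℝ) ^ 5 ≤ (K : ℝ) ^ (-(29 : ℝ) / 6) := by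
      rw [one_div, ← Real.rpow_natCast, ← Real.rpow_neg hK0R.le]
      exact Real.rpow_le_rpow_of_exponent_le (by linarith) (by norm_num)
    calc C₁ * g ^ (2 * K) / (K : ℝ) ^ 5 = C₁ * g ^ (2 * K) * (1 / (K : ℝ) ^ 5) := by ring
      _ ≤ (C₁ + C₂) * (g ^ 2 * M ^ 2) * (K : ℝ) ^ (-(29 : ℝ) / 6) := by
        gcongr
        linarith
      _ = _ := by ring
  · have hσ : (2 * Real.pi * (((g : ℝ) ^ 2 - 1) / 12)) ^ ((3 : ℝ) / 2) =
        √(2 * Real.pi * NivenSum.digitVar g) ^ 3 := by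
      have : (0 : ℝ) ≤ 2 * Real.pi * (((g : ℝ) ^ 2 - 1) / 12) :=
        mul_nonneg Real.two_pi_pos.le (by nlinarith)
      rw [NivenSum.digitVar, Real.sqrt_eq_rpow, ← Real.rpow_natCast _ 3, ← Real.rpow_mul this]
      norm_num
    have hlog : 1 ≤ Real.log K ^ 4 := by
      refine one_le_pow₀ ((Real.le_log_iff_exp_le hK0R).2 ?_)
      linarith [Real.exp_one_lt_d9]
    have h9 : (K : ℝ) ^ (((144 : ℕ) : ℝ) / 32) = (K : ℝ) ^ ((9 : ℝ) / 2) := by norm_num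
    have h19 : 1 / (K : ℝ) ^ (((152 : ℕ) : ℝ) / 32) = (K : ℝ) ^ (-(19 : ℝ) / 4) := by
      rw [one_div, ← Real.rpow_neg hK0R.le]
      norm_num
    rw [h9, ← hσ] at E₂
    refine le_trans (le_of_eq ?_) (E₂.trans ?_)
    · congr 3
      ring
    · calc C₂ * g ^ (2 * K) / (K : ℝ) ^ (((152 : ℕ) : ℝ) / 32)
          = C₂ * g ^ (2 * K) * 1 * (1 / (K : ℝ) ^ (((152 : ℕ) : ℝ) / 32)) := by ring
        _ ≤ (C₁ + C₂) * (g ^ 2 * M ^ 2) * Real.log K ^ 4 * (K : ℝ) ^ (-(19 : ℝ) / 4) := by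
          rw [h19]
          gcongr
          linarith
        _ = _ := by ring
end
end

section
/- Let g ≥ 3. There exist constants c = c(g) > 0 and K_0 = K_0(g) such that for all integers K ≥ K_0 and all integers k with |k − μ_K| ≤ C_g, one has | |S_g(k)| − g^K/√(2πσ²K) | ≤ c · g^K K^{−3/2}. -/
set_option autoImplicit false

noncomputable section

section

open Real Finset MeasureTheory

theorem sum_range_mul_eq_sum_sum {M : Type*} [AddCommMonoid M] (f : ℕ → M) (m g : ℕ) :
    ∑ n ∈ range (m * g), f n = ∑ q ∈ range m, ∑ j ∈ range g, f (j + g * q) := by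
  induction m with
  | zero => simp
  | succ m ih =>
    rw [Nat.succ_mul, sum_range_add, ih, sum_range_succ]
    congr 1
    exact sum_congr rfl fun j _ => by rw [Nat.mul_comm m g, Nat.add_comm]

theorem digitSum_add_mul {g : ℕ} (hg : 1 < g) {j : ℕ} (hj : j < g) (q : ℕ) :
    digitSum g (j + g * q) = j + digitSum g q := by
  rcases Nat.eq_zero_or_pos (j + q) with h | h
  · obtain ⟨rfl, rfl⟩ : j = 0 ∧ q = 0 := by omega
    simp [digitSum]
  · rw [digitSum, Nat.digits_add g hg j q hj (by omega), List.sum_cons, digitSum]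

theorem sum_pow_digitSum {R : Type*} [CommSemiring R] {g : ℕ} (hg : 1 < g) (z : R) (K : ℕ) :
    ∑ n ∈ range (g ^ K), z ^ digitSum g n = (∑ j ∈ range g, z ^ j) ^ K := by
  induction K with
  | zero => simp [digitSum]
  | succ K ih =>
    rw [pow_succ, sum_range_mul_eq_sum_sum, pow_succ, ← ih, sum_mul_sum]
    refine sum_congr rfl fun q _ => sum_congr rfl fun j hj => ?_
    rw [digitSum_add_mul hg (mem_range.1 hj), pow_add, mul_comm]

/-- The characteristic function of a centred uniformly random base-`g` digit. -/
def digitCharFun (g : ℕ) (t : ℝ) : ℝ :=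
  (∑ j ∈ range g, cos (((j : ℝ) - ((g : ℝ) - 1) / 2) * t)) / g

theorem continuous_digitCharFun (g : ℕ) : Continuous (digitCharFun g) := by
  unfold digitCharFun
  fun_prop

theorem sum_sin_centred_eq_zero (g : ℕ) (t : ℝ) :
    ∑ j ∈ range g, sin (((j : ℝ) - ((g : ℝ) - 1) / 2) * t) = 0 := by
  have h := sum_range_reflect (fun j : ℕ => sin (((j : ℝ) - ((g : ℝ) - 1) / 2) * t)) g
  have h2 : ∀ j ∈ range g, sin ((((g - 1 - j : ℕ) : ℝ) - ((g : ℝ) - 1) / 2) * t) =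
      -sin (((j : ℝ) - ((g : ℝ) - 1) / 2) * t) := by
    intro j hj
    have hj' := mem_range.1 hj
    rw [Nat.sub_sub, Nat.cast_sub (by omega), ← sin_neg]
    congr 1
    push_cast
    ring
  rw [sum_congr rfl h2, sum_neg_distrib] at h
  linarith

theorem sum_exp_pow_eq {g : ℕ} (hg : 0 < g) (t : ℝ) :
    ∑ j ∈ range g, Complex.exp (t * Complex.I) ^ j =
      Complex.exp (((((g : ℝ) - 1) / 2 * t : ℝ) : ℂ) * Complex.I) *
        ((g * digitCharFun g t : ℝ) : ℂ) := by
  have hg' : (g : ℝ) ≠ 0 := by positivity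
  have hsum : ((g * digitCharFun g t : ℝ) : ℂ) =
      ∑ j ∈ range g, Complex.exp (((((j : ℝ) - ((g : ℝ) - 1) / 2) * t : ℝ) : ℂ) * Complex.I) := by
    simp only [Complex.exp_mul_I, sum_add_distrib, ← sum_mul, ← Complex.ofReal_cos,
      ← Complex.ofReal_sin, ← Complex.ofReal_sum, sum_sin_centred_eq_zero]
    rw [digitCharFun, mul_div_cancel₀ _ hg']
    simp
  rw [hsum, mul_sum]
  refine sum_congr rfl fun j _ => ?_
  rw [← Complex.exp_nat_mul, ← Complex.exp_add]
  congr 1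
  push_cast
  ring

theorem sum_cos_digitSum_sub {g : ℕ} (hg : 1 < g) (K : ℕ) (k : ℤ) (t : ℝ) :
    ∑ n ∈ range (g ^ K), cos ((((digitSum g n : ℤ) - k : ℤ) : ℝ) * t) =
      (g : ℝ) ^ K * (digitCharFun g t ^ K * cos (((k : ℝ) - muK g K) * t)) := by
  have h := congrArg (fun z => (Complex.exp (((-k * t : ℝ) : ℂ) * Complex.I) * z).re)
    (sum_pow_digitSum hg (Complex.exp (t * Complex.I)) K)
  simp only [sum_exp_pow_eq (by omega : 0 < g), mul_pow, mul_sum, Complex.re_sum] at h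
  convert h using 1
  · refine sum_congr rfl fun n _ => ?_
    rw [← Complex.exp_nat_mul, ← Complex.exp_add, ← Complex.exp_ofReal_mul_I_re]
    congr 2
    push_cast
    ring
  · rw [← mul_assoc (Complex.exp _), ← Complex.exp_nat_mul, ← Complex.exp_add,
      ← Complex.ofReal_pow, Complex.re_mul_ofReal]
    have he : ((-k * t : ℝ) : ℂ) * Complex.I +
        K * (((((g : ℝ) - 1) / 2 * t : ℝ) : ℂ) * Complex.I) =
        ((-(((k : ℝ) - muK g K) * t) : ℝ) : ℂ) * Complex.I := by
      simp only [muK]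
      push_cast
      ring
    rw [he, Complex.exp_ofReal_mul_I_re, cos_neg, mul_pow]
    ring

theorem intervalIntegral_cos_int_mul (m : ℤ) :
    ∫ t in (-π)..π, cos ((m : ℝ) * t) = if m = 0 then 2 * π else 0 := by
  split_ifs with h
  · subst h
    simp
    ring
  · have hm : (m : ℝ) ≠ 0 := by exact_mod_cast h
    rw [intervalIntegral.integral_comp_mul_left (fun x => cos x) hm, integral_cos, mul_neg,
      sin_neg, sin_int_mul_pi]
    simp

theorem card_Sset_eq_integral {g : ℕ} (hg : 1 < g) (K : ℕ) (k : ℤ) :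
    2 * π * ((Sset g K k).card : ℝ) =
      (g : ℝ) ^ K * ∫ t in (-π)..π, digitCharFun g t ^ K * cos (((k : ℝ) - muK g K) * t) := by
  rw [← intervalIntegral.integral_const_mul]
  simp only [← sum_cos_digitSum_sub hg]
  rw [intervalIntegral.integral_finsetSum
    fun n _ => Continuous.intervalIntegrable (by fun_prop) _ _]
  simp only [intervalIntegral_cos_int_mul, sub_eq_zero]
  rw [← sum_filter, sum_const, nsmul_eq_mul, mul_comm, Sset]

theorem abs_cos_add_cos_add_le (a : ℝ) {t : ℝ} (ht : |t| ≤ π) :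
    |cos a + cos (a + t)| ≤ 2 - t ^ 2 / π ^ 2 := by
  have h1 : cos a + cos (a + t) = 2 * cos (a + t / 2) * cos (t / 2) := by
    have := cos_add_cos (a + t) a
    rw [add_comm, this]
    congr 2 <;> congr 1 <;> ring
  have ht2 : |t / 2| ≤ π / 2 := by
    rw [abs_div, abs_two]
    linarith
  have h0 : 0 ≤ cos (t / 2) := cos_nonneg_of_mem_Icc (abs_le.1 ht2)
  have hq := cos_le_one_sub_mul_cos_sq (x := t / 2) (by linarith [pi_pos])
  rw [h1, abs_mul, abs_mul, abs_two, abs_of_nonneg h0]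
  have := mul_le_of_le_one_left h0 (abs_cos_le_one (a + t / 2))
  have e : 2 / π ^ 2 * (t / 2) ^ 2 = (t ^ 2 / π ^ 2) / 2 := by ring
  rw [e] at hq
  linarith

theorem abs_digitCharFun_le {g : ℕ} (hg : 2 ≤ g) {t : ℝ} (ht : |t| ≤ π) :
    |digitCharFun g t| ≤ exp (-(1 / (g * π ^ 2)) * t ^ 2) := by
  obtain ⟨m, rfl⟩ := Nat.exists_eq_add_of_le' hg
  have hs : |∑ j ∈ range (m + 2), cos (((j : ℝ) - (((m + 2 : ℕ) : ℝ) - 1) / 2) * t)| ≤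
      m + (2 - t ^ 2 / π ^ 2) := by
    rw [sum_range_succ, sum_range_succ, add_assoc]
    refine (abs_add_le _ _).trans (add_le_add ?_ ?_)
    · refine (abs_sum_le_sum_abs _ _).trans ((sum_le_sum fun j _ => abs_cos_le_one _).trans ?_)
      simp
    · rw [Nat.cast_succ m, show ((m : ℝ) + 1 - (((m + 2 : ℕ) : ℝ) - 1) / 2) * t =
        ((m : ℝ) - (((m + 2 : ℕ) : ℝ) - 1) / 2) * t + t by ring]
      exact abs_cos_add_cos_add_le _ ht
  have hg' : (0 : ℝ) < ((m + 2 : ℕ) : ℝ) := by positivity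
  rw [digitCharFun, abs_div, Nat.abs_cast, div_le_iff₀ hg']
  refine hs.trans ?_
  have := add_one_le_exp (-(1 / (((m + 2 : ℕ) : ℝ) * π ^ 2)) * t ^ 2)
  refine le_trans (le_of_eq ?_) (mul_le_mul_of_nonneg_right this hg'.le)
  field_simp
  push_cast
  ring

theorem abs_cos_sub_one_add_sq_div_two_le (x : ℝ) : |cos x - (1 - x ^ 2 / 2)| ≤ x ^ 4 := by
  rcases le_total |x| 1 with h | h
  · refine (cos_bound h).trans ?_
    rw [Even.pow_abs (by decide)]
    nlinarith [sq_nonneg (x ^ 2)]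
  · have h1 := one_sub_sq_div_two_le_cos (x := x)
    have h2 := cos_le_one x
    have h3 : 1 ≤ x ^ 2 := by rw [← sq_abs]; nlinarith
    rw [abs_le]
    constructor <;> nlinarith

theorem abs_exp_neg_sub_le {u : ℝ} (hu : 0 ≤ u) : |exp (-u) - (1 - u)| ≤ u ^ 2 := by
  rcases le_total u 1 with h | h
  · have := abs_exp_sub_one_sub_id_le (x := -u) (by rwa [abs_neg, abs_of_nonneg hu])
    rw [neg_sq] at this
    convert this using 2
    ring
  · have h1 := add_one_le_exp (-u)
    have h2 : exp (-u) ≤ 1 := exp_le_one_iff.2 (by linarith)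
    rw [abs_le]
    constructor <;> nlinarith

theorem sum_sq_centred (g : ℕ) :
    ∑ j ∈ range g, ((j : ℝ) - ((g : ℝ) - 1) / 2) ^ 2 = g * (((g : ℝ) ^ 2 - 1) / 12) := by
  have key : ∀ (c : ℝ) (n : ℕ), ∑ j ∈ range n, ((j : ℝ) - c) ^ 2 =
      (n - 1) * n * (2 * n - 1) / 6 - c * (n * (n - 1)) + n * c ^ 2 := by
    intro c n
    induction n with
    | zero => simp
    | succ n ih =>
      rw [sum_range_succ, ih]
      push_cast
      ring
  rw [key]
  ring

theorem abs_digitCharFun_sub_gaussian_le {g : ℕ} (hg : 1 ≤ g) (t : ℝ) :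
    |digitCharFun g t - exp (-((((g : ℝ) ^ 2 - 1) / 12) / 2 * t ^ 2))| ≤
      2 * (g : ℝ) ^ 4 * t ^ 4 := by
  have hg1 : (1 : ℝ) ≤ g := by exact_mod_cast hg
  have hg0 : (0 : ℝ) < g := by linarith
  set v : ℝ := ((g : ℝ) ^ 2 - 1) / 12 with hv
  have hv0 : 0 ≤ v := by rw [hv]; nlinarith
  have h1 : |digitCharFun g t - (1 - v / 2 * t ^ 2)| ≤ (g : ℝ) ^ 4 * t ^ 4 := by
    have e : digitCharFun g t - (1 - v / 2 * t ^ 2) =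
        (∑ j ∈ range g, (cos (((j : ℝ) - ((g : ℝ) - 1) / 2) * t) -
          (1 - (((j : ℝ) - ((g : ℝ) - 1) / 2) * t) ^ 2 / 2))) / g := by
      simp only [sum_sub_distrib, mul_pow, ← sum_div, ← sum_mul, sum_sq_centred, ← hv]
      rw [digitCharFun, sum_const, card_range, nsmul_eq_mul]
      generalize ∑ j ∈ range g, cos (((j : ℝ) - ((g : ℝ) - 1) / 2) * t) = A
      field_simp
    rw [e, abs_div, Nat.abs_cast, div_le_iff₀ hg0]
    refine (abs_sum_le_sum_abs _ _).trans ?_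
    have hb : ∀ j ∈ range g, |cos (((j : ℝ) - ((g : ℝ) - 1) / 2) * t) -
          (1 - (((j : ℝ) - ((g : ℝ) - 1) / 2) * t) ^ 2 / 2)| ≤ (g : ℝ) ^ 4 * t ^ 4 := by
      intro j hj
      refine (abs_cos_sub_one_add_sq_div_two_le _).trans ?_
      rw [mul_pow]
      refine mul_le_mul_of_nonneg_right ?_ (by positivity)
      have hj' : (j : ℝ) ≤ g := by exact_mod_cast (mem_range.1 hj).le
      have hj0 : (0 : ℝ) ≤ j := by positivity
      exact (Even.pow_abs (n := 4) (by decide) _).symm.trans_le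
        (pow_le_pow_left₀ (abs_nonneg _) (abs_le.2 ⟨by linarith, by linarith⟩) 4)
    refine (sum_le_sum hb).trans ?_
    simp [mul_comm]
  have h2 := abs_exp_neg_sub_le (u := v / 2 * t ^ 2) (by positivity)
  have h3 : (v / 2 * t ^ 2) ^ 2 ≤ (g : ℝ) ^ 4 * t ^ 4 := by
    have : (v / 2) ^ 2 ≤ ((g : ℝ) ^ 2) ^ 2 :=
      pow_le_pow_left₀ (by positivity) (by rw [hv]; nlinarith) 2
    calc (v / 2 * t ^ 2) ^ 2 = (v / 2) ^ 2 * t ^ 4 := by ring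
      _ ≤ ((g : ℝ) ^ 2) ^ 2 * t ^ 4 := by gcongr
      _ = _ := by ring
  rw [abs_le] at h1 h2 ⊢
  constructor <;> linarith [h1.1, h1.2, h2.1, h2.2]

theorem quartic_mul_exp_neg_le {b P Q : ℝ} (hb : 0 < b) (hP : 0 ≤ P) (hQ : 0 ≤ Q) (t : ℝ) :
    (P * t ^ 4 + Q * t ^ 2) * exp (-b * t ^ 2) ≤
      (8 * P / b ^ 2 + 2 * Q / b) * exp (-(b / 2) * t ^ 2) := by
  set u : ℝ := b / 2 * t ^ 2 with hu
  have hu0 : 0 ≤ u := by positivity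
  have hexp := quadratic_le_exp_of_nonneg hu0
  have h4 : t ^ 4 ≤ 8 / b ^ 2 * exp u := by
    have e : t ^ 4 = 8 / b ^ 2 * (u ^ 2 / 2) := by
      rw [hu]
      field_simp
      ring
    rw [e]
    gcongr
    linarith
  have h2 : t ^ 2 ≤ 2 / b * exp u := by
    have e : t ^ 2 = 2 / b * u := by
      rw [hu]
      field_simp
    rw [e]
    gcongr
    nlinarith [sq_nonneg u]
  have hs : exp (-b * t ^ 2) = exp (-u) * exp (-u) := by
    rw [← exp_add, hu]
    ring_nf
  have hs' : exp (-(b / 2) * t ^ 2) = exp (-u) := by rw [hu, neg_mul]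
  have hone : exp u * exp (-u) = 1 := by rw [← exp_add, add_neg_cancel, exp_zero]
  rw [hs, hs']
  calc (P * t ^ 4 + Q * t ^ 2) * (exp (-u) * exp (-u))
      ≤ (P * (8 / b ^ 2 * exp u) + Q * (2 / b * exp u)) * (exp (-u) * exp (-u)) := by gcongr
    _ = (8 * P / b ^ 2 + 2 * Q / b) * exp (-u) * (exp u * exp (-u)) := by ring
    _ = _ := by rw [hone, mul_one]

theorem one_div_mul_pi_sq_le {g : ℕ} (hg : 2 ≤ g) :
    1 / ((g : ℝ) * π ^ 2) ≤ (((g : ℝ) ^ 2 - 1) / 12) / 2 := by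
  have hg' : (2 : ℝ) ≤ g := by exact_mod_cast hg
  have hpi : (9 : ℝ) ≤ π ^ 2 := by nlinarith [pi_gt_three]
  have h18 : (18 : ℝ) ≤ g * π ^ 2 := by nlinarith
  calc 1 / ((g : ℝ) * π ^ 2) ≤ 1 / 18 := one_div_le_one_div_of_le (by norm_num) h18
    _ ≤ _ := by nlinarith

theorem abs_indicator_sub_gaussian_le {g : ℕ} (hg : 2 ≤ g) {K : ℕ} (hK : 2 ≤ K) {y Y : ℝ}
    (hy : |y| ≤ Y) (t : ℝ) :
    |(Set.Ioc (-π) π).indicator (fun t => digitCharFun g t ^ K * cos (y * t)) t -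
        exp (-(K * ((((g : ℝ) ^ 2 - 1) / 12) / 2)) * t ^ 2)| ≤
      (K * (2 * (g : ℝ) ^ 4) * t ^ 4 + (Y ^ 2 / 2 + 1) * t ^ 2) *
        exp (-(1 / (g * π ^ 2) / 2 * K) * t ^ 2) := by
  have hav := one_div_mul_pi_sq_le hg
  set a : ℝ := 1 / (g * π ^ 2) with ha
  set w : ℝ := (((g : ℝ) ^ 2 - 1) / 12) / 2 with hw
  have ha0 : 0 < a := by positivity
  have hK' : (2 : ℝ) ≤ K := by exact_mod_cast hK
  have ht2 : 0 ≤ t ^ 2 := sq_nonneg t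
  have hY : y ^ 2 ≤ Y ^ 2 := sq_le_sq' (by linarith [neg_abs_le y]) ((le_abs_self y).trans hy)
  have hpow : ∀ n : ℕ, (K : ℝ) / 2 ≤ n →
      exp (-a * t ^ 2) ^ n ≤ exp (-(a / 2 * K) * t ^ 2) := by
    intro n hn
    rw [← exp_nat_mul, exp_le_exp]
    have := mul_le_mul_of_nonneg_right hn (mul_nonneg ha0.le ht2)
    linarith
  have hgauss : exp (-(K * w) * t ^ 2) = exp (-(w * t ^ 2)) ^ K := by
    rw [← exp_nat_mul]
    ring_nf
  have hwa : exp (-(w * t ^ 2)) ≤ exp (-a * t ^ 2) := by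
    rw [exp_le_exp]
    have := mul_le_mul_of_nonneg_right hav ht2
    linarith
  rw [hgauss]
  by_cases ht : t ∈ Set.Ioc (-π) π
  · rw [Set.indicator_of_mem ht]
    have hphi := abs_digitCharFun_le hg (abs_le.2 ⟨ht.1.le, ht.2⟩)
    rw [← ha] at hphi
    have hcos : |cos (y * t) - 1| ≤ (Y ^ 2 / 2) * t ^ 2 := by
      have h1 := one_sub_sq_div_two_le_cos (x := y * t)
      have h2 := cos_le_one (y * t)
      have h3 := mul_le_mul_of_nonneg_right hY ht2
      rw [abs_le]
      constructor <;> nlinarith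
    have h1 : |digitCharFun g t ^ K * (cos (y * t) - 1)| ≤
        (Y ^ 2 / 2) * t ^ 2 * exp (-(a / 2 * K) * t ^ 2) := by
      rw [abs_mul, abs_pow, mul_comm]
      refine mul_le_mul hcos ?_ (by positivity) (by positivity)
      exact (pow_le_pow_left₀ (abs_nonneg _) hphi K).trans (hpow K (by linarith))
    have h2 : |digitCharFun g t ^ K - exp (-(w * t ^ 2)) ^ K| ≤
        K * (2 * (g : ℝ) ^ 4) * t ^ 4 * exp (-(a / 2 * K) * t ^ 2) := by
      refine (abs_pow_sub_pow_le _ _ _).trans ?_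
      have hd := abs_digitCharFun_sub_gaussian_le (g := g) (by omega) t
      have hm : max |digitCharFun g t| |exp (-(w * t ^ 2))| ^ (K - 1) ≤
          exp (-(a / 2 * K) * t ^ 2) := by
        refine (pow_le_pow_left₀ (by positivity) (max_le hphi ?_) _).trans (hpow (K - 1) ?_)
        · rwa [abs_of_pos (exp_pos _)]
        · rw [Nat.cast_sub (by omega)]
          push_cast
          linarith
      calc _ ≤ 2 * (g : ℝ) ^ 4 * t ^ 4 * K * exp (-(a / 2 * K) * t ^ 2) := by gcongr
        _ = _ := by ring
    calc |digitCharFun g t ^ K * cos (y * t) - exp (-(w * t ^ 2)) ^ K|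
        = |digitCharFun g t ^ K * (cos (y * t) - 1) +
            (digitCharFun g t ^ K - exp (-(w * t ^ 2)) ^ K)| := by ring_nf
      _ ≤ _ := abs_add_le _ _
      _ ≤ (Y ^ 2 / 2) * t ^ 2 * exp (-(a / 2 * K) * t ^ 2) +
          K * (2 * (g : ℝ) ^ 4) * t ^ 4 * exp (-(a / 2 * K) * t ^ 2) := add_le_add h1 h2
      _ = (K * (2 * (g : ℝ) ^ 4) * t ^ 4 + Y ^ 2 / 2 * t ^ 2) *
          exp (-(a / 2 * K) * t ^ 2) := by ring
      _ ≤ _ := by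
        gcongr
        linarith
  · rw [Set.indicator_of_notMem ht, zero_sub, abs_neg, abs_of_pos (by positivity)]
    have ht1 : 1 ≤ t ^ 2 := by
      by_contra! h
      rw [sq_lt_one_iff_abs_lt_one, abs_lt] at h
      exact ht ⟨by linarith [pi_gt_three], by linarith [pi_gt_three]⟩
    have h1 : exp (-(w * t ^ 2)) ^ K ≤ exp (-(a / 2 * K) * t ^ 2) :=
      (pow_le_pow_left₀ (exp_pos _).le hwa K).trans (hpow K (by linarith))
    refine h1.trans (le_mul_of_one_le_left (exp_pos _).le ?_)
    have : 0 ≤ K * (2 * (g : ℝ) ^ 4) * t ^ 4 := by positivity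
    nlinarith [sq_nonneg Y]

theorem abs_integral_sub_gaussian_le {g : ℕ} (hg : 2 ≤ g) {K : ℕ} (hK : 2 ≤ K) {y Y : ℝ}
    (hy : |y| ≤ Y) :
    |(∫ t in (-π)..π, digitCharFun g t ^ K * cos (y * t)) -
        √(π / (K * ((((g : ℝ) ^ 2 - 1) / 12) / 2)))| ≤
      (8 * (K * (2 * (g : ℝ) ^ 4)) / (1 / (g * π ^ 2) / 2 * K) ^ 2 +
        2 * (Y ^ 2 / 2 + 1) / (1 / (g * π ^ 2) / 2 * K)) *
        √(π / (1 / (g * π ^ 2) / 2 * K / 2)) := by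
  have hg' : (2 : ℝ) ≤ g := by exact_mod_cast hg
  have hw : 0 < (K : ℝ) * ((((g : ℝ) ^ 2 - 1) / 12) / 2) := by
    have : 0 < (g : ℝ) ^ 2 - 1 := by nlinarith
    positivity
  have hb : 0 < 1 / ((g : ℝ) * π ^ 2) / 2 * K := by positivity
  have hint : Integrable
      ((Set.Ioc (-π) π).indicator fun t => digitCharFun g t ^ K * cos (y * t)) := by
    rw [integrable_indicator_iff measurableSet_Ioc]
    refine Continuous.integrableOn_Ioc ?_
    have := continuous_digitCharFun g
    fun_prop
  rw [intervalIntegral.integral_of_le (by linarith [pi_pos]),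
    ← integral_indicator measurableSet_Ioc, ← integral_gaussian,
    ← integral_sub hint (integrable_exp_neg_mul_sq hw), ← integral_gaussian,
    ← integral_const_mul, ← norm_eq_abs]
  refine norm_integral_le_of_norm_le
    ((integrable_exp_neg_mul_sq (half_pos hb)).const_mul _) (ae_of_all _ fun t => ?_)
  exact (abs_indicator_sub_gaussian_le hg hK hy t).trans
    (quartic_mul_exp_neg_le hb (by positivity) (by positivity) t)

theorem inv_mul_inv_sqrt_eq_rpow {x : ℝ} (hx : 0 < x) :
    x⁻¹ * (√x)⁻¹ = x ^ (-(3 : ℝ) / 2) := by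
  rw [sqrt_eq_rpow, ← rpow_neg_one, ← rpow_neg hx.le, ← rpow_add hx]
  norm_num

theorem exists_abs_card_Sset_sub_le {g : ℕ} (hg : 2 ≤ g) (Y : ℝ) :
    ∃ c : ℝ, 0 < c ∧ ∀ K : ℕ, 2 ≤ K → ∀ k : ℤ, |(k : ℝ) - muK g K| ≤ Y →
      |((Sset g K k).card : ℝ) - (g : ℝ) ^ K / √(2 * π * (((g : ℝ) ^ 2 - 1) / 12) * K)| ≤
        c * (g : ℝ) ^ K * (K : ℝ) ^ (-(3 : ℝ) / 2) := by
  have hg' : (2 : ℝ) ≤ g := by exact_mod_cast hg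
  have hv : 0 < ((g : ℝ) ^ 2 - 1) / 12 := by nlinarith
  have hβ : 0 < 1 / ((g : ℝ) * π ^ 2) / 2 := by positivity
  set β : ℝ := 1 / ((g : ℝ) * π ^ 2) / 2 with hβ_def
  set v : ℝ := ((g : ℝ) ^ 2 - 1) / 12 with hv_def
  refine ⟨(16 * (g : ℝ) ^ 4 / β ^ 2 + (Y ^ 2 + 2) / β) * √(2 * π / β) / (2 * π),
    by positivity, fun K hK k hk => ?_⟩
  have hK' : (0 : ℝ) < K := by exact_mod_cast (by omega : 0 < K)
  have hmain := abs_integral_sub_gaussian_le hg hK hk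
  have hcard := card_Sset_eq_integral (by omega : 1 < g) K k
  rw [← hβ_def, ← hv_def] at hmain
  set I : ℝ := ∫ t in (-π)..π, digitCharFun g t ^ K * cos (((k : ℝ) - muK g K) * t)
  have hpi : 0 < 2 * π := by positivity
  have hsqrt : √(π / (K * (v / 2))) = 2 * π / √(2 * π * v * K) := by
    rw [show π / (K * (v / 2)) = (2 * π) ^ 2 / (2 * π * v * K) by field_simp,
      sqrt_div (by positivity), sqrt_sq hpi.le]
  have hsqrt' : √(π / (β * K / 2)) = √(2 * π / β) * (√(K : ℝ))⁻¹ := by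
    rw [show π / (β * K / 2) = 2 * π / β / K by field_simp, sqrt_div (by positivity),
      div_eq_mul_inv]
  have hS : ((Sset g K k).card : ℝ) - (g : ℝ) ^ K / √(2 * π * v * K) =
      (g : ℝ) ^ K / (2 * π) * (I - √(π / (K * (v / 2)))) := by
    rw [hsqrt, eq_div_of_mul_eq hpi.ne' (mul_comm _ _ |>.trans hcard)]
    field_simp
  rw [hS, abs_mul, abs_of_pos (by positivity), ← inv_mul_inv_sqrt_eq_rpow hK']
  refine (mul_le_mul_of_nonneg_left hmain (by positivity)).trans_eq ?_
  rw [hsqrt']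
  field_simp
  ring

end

theorem statement3 (g : ℕ) (hg : 3 ≤ g) :
    ∃ c : ℝ, 0 < c ∧ ∃ K0 : ℕ, ∀ K : ℕ, K0 ≤ K →
      ∀ k : ℤ, |(k : ℝ) - muK g K| ≤ Cg g →
        |((Sset g K k).card : ℝ) -
            (g : ℝ) ^ K / Real.sqrt (2 * Real.pi * (((g : ℝ) ^ 2 - 1) / 12) * K)| ≤
          c * (g : ℝ) ^ K * (K : ℝ) ^ (-(3 : ℝ) / 2) := by
  obtain ⟨c, hc, h⟩ := exists_abs_card_Sset_sub_le (by omega : 2 ≤ g) (Cg g)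
  exact ⟨c, hc, 2, h⟩
end
end

section
/- Let g ≥ 2 and K ≥ 1 be integers. For every integer k and every real θ, |Σ_{n < g^K, s_g(n) = k} e(nθ)| ≤ g^K · exp( −(1/(2g)) · Σ_{i=0}^{K−1} ‖g^i (g−1) θ‖²_{ℝ/ℤ} ), where ‖x‖_{ℝ/ℤ} denotes the distance from x to the nearest integer. -/
set_option autoImplicit false

noncomputable section

/-- `e(x) = exp(2πix)`. -/
def eC (x : ℝ) : ℂ := Complex.exp (2 * Real.pi * Complex.I * x)

/-- Distance to the nearest integer. -/
def distToInt (x : ℝ) : ℝ := |x - round x|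

theorem eC_add (x y : ℝ) : eC (x + y) = eC x * eC y := by
  simp only [eC, ← Complex.exp_add]
  push_cast
  ring_nf

theorem eC_eq_exp_mul_I (x : ℝ) : eC x = Complex.exp ((2 * Real.pi * x : ℝ) * Complex.I) := by
  simp only [eC]
  push_cast
  ring_nf

theorem eC_zero : eC 0 = 1 := by simp [eC]

theorem norm_eC (x : ℝ) : ‖eC x‖ = 1 := by
  rw [eC_eq_exp_mul_I, Complex.norm_exp_ofReal_mul_I]

@[fun_prop]
theorem continuous_eC : Continuous eC := by
  unfold eC
  fun_prop

theorem integral_eC_int_mul (m : ℤ) :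
    ∫ α in (0 : ℝ)..1, eC (m * α) = if m = 0 then 1 else 0 := by
  split_ifs with h
  · simp [h, eC_zero]
  · have hc : (2 * Real.pi * Complex.I * m : ℂ) ≠ 0 :=
      mul_ne_zero Complex.two_pi_I_ne_zero (by exact_mod_cast h)
    have := integral_exp_mul_complex (a := 0) (b := 1) hc
    have h1 : Complex.exp (2 * Real.pi * Complex.I * m) = 1 := by
      rw [mul_comm]
      exact Complex.exp_int_mul_two_pi_mul_I m
    simp only [Complex.ofReal_one, mul_one, Complex.ofReal_zero, mul_zero, h1, Complex.exp_zero,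
      sub_self, zero_div] at this
    simpa [eC, mul_assoc] using this

theorem norm_one_add_eC_le (β : ℝ) :
    ‖1 + eC β‖ ≤ 3 / 2 + Real.cos (2 * Real.pi * β) / 2 := by
  have h : ‖1 + eC β‖ ^ 2 = 2 + 2 * Real.cos (2 * Real.pi * β) := by
    rw [eC_eq_exp_mul_I, ← Complex.normSq_eq_norm_sq, Complex.normSq_apply]
    simp only [Complex.add_re, Complex.add_im, Complex.exp_ofReal_mul_I_re,
      Complex.exp_ofReal_mul_I_im, Complex.one_re, Complex.one_im]
    nlinarith [Real.sin_sq_add_cos_sq (2 * Real.pi * β)]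
  nlinarith [sq_nonneg (‖1 + eC β‖ - 2)]

/-- A geometric sum of `g` unit phases is bounded by pairing its first two terms. -/
theorem norm_sum_eC_le {g : ℕ} (hg : 2 ≤ g) (β : ℝ) :
    ‖∑ j ∈ Finset.range g, eC (j * β)‖ ≤ g - 1 / 2 + Real.cos (2 * Real.pi * β) / 2 := by
  obtain ⟨h, rfl⟩ := Nat.exists_eq_add_of_le hg
  rw [Finset.sum_range_add]
  have h2 : ‖∑ j ∈ Finset.range h, eC ((2 + j : ℕ) * β)‖ ≤ h := by
    refine (norm_sum_le _ _).trans ?_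
    simp [norm_eC]
  have h1 : ∑ j ∈ Finset.range 2, eC (j * β) = 1 + eC β := by
    simp [Finset.sum_range_succ, eC_zero]
  have := norm_add_le (∑ j ∈ Finset.range 2, eC (j * β))
    (∑ j ∈ Finset.range h, eC ((2 + j : ℕ) * β))
  rw [h1] at this ⊢
  push_cast at this h2 ⊢
  linarith [norm_one_add_eC_le β]

theorem distToInt_nonneg (x : ℝ) : 0 ≤ distToInt x := abs_nonneg _

theorem distToInt_le_half (x : ℝ) : distToInt x ≤ 1 / 2 := abs_sub_round x

theorem distToInt_sub_le (x y : ℝ) : distToInt (x - y) ≤ distToInt x + distToInt y := by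
  have h := round_le (x - y) (round x - round y)
  push_cast at h
  have h' := abs_sub (x - round x) (y - round y)
  unfold distToInt
  calc _ ≤ _ := h
    _ = |(x - round x) - (y - round y)| := by ring_nf
    _ ≤ _ := h'

theorem distToInt_sq_sub_le (x y : ℝ) :
    distToInt (x - y) ^ 2 ≤ 2 * distToInt x ^ 2 + 2 * distToInt y ^ 2 := by
  nlinarith [distToInt_sub_le x y, distToInt_nonneg (x - y), distToInt_nonneg x,
    distToInt_nonneg y, sq_nonneg (distToInt x - distToInt y)]

theorem distToInt_sq_le_quarter (x : ℝ) : distToInt x ^ 2 ≤ 1 / 4 := by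
  nlinarith [distToInt_le_half x, distToInt_nonneg x]

theorem cos_two_pi_mul_le (β : ℝ) :
    Real.cos (2 * Real.pi * β) ≤ 1 - 8 * distToInt β ^ 2 := by
  have h0 : Real.cos (2 * Real.pi * β) = Real.cos (2 * Real.pi * (β - round β)) := by
    rw [← Real.cos_sub_int_mul_two_pi _ (round β)]
    ring_nf
  have h1 := Real.cos_le_one_sub_mul_cos_sq (x := 2 * Real.pi * (β - round β)) (by
    rw [abs_mul, abs_of_pos Real.two_pi_pos]
    nlinarith [abs_sub_round β, Real.pi_pos])
  rw [h0]
  refine h1.trans_eq ?_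
  rw [distToInt, sq_abs]
  field_simp
  ring

theorem norm_sum_eC_le_exp {g : ℕ} (hg : 2 ≤ g) (β : ℝ) :
    ‖∑ j ∈ Finset.range g, eC (j * β)‖ ≤ g * Real.exp (-(4 / g) * distToInt β ^ 2) := by
  have hg0 : (0 : ℝ) < g := by positivity
  calc _ ≤ _ := norm_sum_eC_le hg β
    _ ≤ g * (-(4 / g) * distToInt β ^ 2 + 1) := by
      have : (g : ℝ) * (-(4 / g) * distToInt β ^ 2 + 1) = g - 4 * distToInt β ^ 2 := by
        field_simp
        ring
      linarith [cos_two_pi_mul_le β]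
    _ ≤ _ := mul_le_mul_of_nonneg_left (Real.add_one_le_exp _) hg0.le

/-- Each difference of consecutive frequencies is controlled by the two frequencies. -/
theorem sum_distToInt_sub_sq_le (β : ℕ → ℝ) (M : ℕ) :
    ∑ i ∈ Finset.range M, distToInt (β (i + 1) - β i) ^ 2 ≤
      4 * ∑ i ∈ Finset.range M, distToInt (β i) ^ 2 + 2 * distToInt (β M) ^ 2 := by
  induction M with
  | zero => simp; positivity
  | succ M ih =>
    rw [Finset.sum_range_succ, Finset.sum_range_succ]
    linarith [distToInt_sq_sub_le (β (M + 1)) (β M)]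

theorem digitSum_mul_add {g d : ℕ} (hg : 2 ≤ g) (hd : d < g) (m : ℕ) :
    digitSum g (g * m + d) = d + digitSum g m := by
  unfold digitSum
  by_cases h : m = 0 ∧ d = 0
  · simp [h.1, h.2]
  · rw [add_comm (g * m), Nat.digits_add g hg d m hd (by tauto), List.sum_cons]

theorem sum_range_mul_eq {A : Type*} [AddCommMonoid A] (f : ℕ → A) (g a : ℕ) :
    ∑ n ∈ Finset.range (g * a), f n =
      ∑ m ∈ Finset.range a, ∑ d ∈ Finset.range g, f (g * m + d) := by
  induction a with
  | zero => simp
  | succ a ih => rw [mul_add_one, Finset.sum_range_add, ih, Finset.sum_range_succ]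

theorem sum_eC_digitSum_eq_prod {g : ℕ} (hg : 2 ≤ g) (K : ℕ) (θ α : ℝ) :
    ∑ n ∈ Finset.range (g ^ K), eC (n * θ + digitSum g n * α) =
      ∏ i ∈ Finset.range K, ∑ j ∈ Finset.range g, eC (j * ((g : ℝ) ^ i * θ + α)) := by
  induction K generalizing θ with
  | zero => simp [digitSum, eC_zero]
  | succ K ih =>
    rw [Finset.prod_range_succ', pow_succ', sum_range_mul_eq]
    have hp := ih (g * θ)
    simp only [← mul_assoc, ← pow_succ] at hp
    rw [← hp, Finset.sum_mul_sum]
    refine Finset.sum_congr rfl fun m _ => Finset.sum_congr rfl fun d hd => ?_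
    rw [digitSum_mul_add hg (Finset.mem_range.1 hd), ← eC_add]
    push_cast
    ring_nf

theorem sum_Sset_eq_integral (g K : ℕ) (k : ℤ) (θ : ℝ) :
    ∑ n ∈ Sset g K k, eC (n * θ) = ∫ α in (0 : ℝ)..1,
      eC (-k * α) * ∑ n ∈ Finset.range (g ^ K), eC (n * θ + digitSum g n * α) := by
  simp only [Finset.mul_sum]
  rw [intervalIntegral.integral_finsetSum
    (fun n _ => Continuous.intervalIntegrable (by fun_prop) _ _), Sset, Finset.sum_filter]
  refine Finset.sum_congr rfl fun n _ => ?_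
  have h (α : ℝ) : eC (-k * α) * eC (n * θ + digitSum g n * α) =
      eC (n * θ) * eC (((digitSum g n - k : ℤ) : ℝ) * α) := by
    rw [← eC_add, ← eC_add]
    push_cast
    ring_nf
  simp only [h, intervalIntegral.integral_const_mul, integral_eC_int_mul, sub_eq_zero]
  simp

theorem integral_cos_two_pi_mul_add (c : ℝ) :
    ∫ α in (0 : ℝ)..1, Real.cos (2 * Real.pi * (c + α)) = 0 := by
  simp only [mul_add]
  rw [intervalIntegral.integral_comp_add_mul (fun x => Real.cos x) Real.two_pi_pos.ne',
    integral_cos]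
  simp

theorem statement4 (g K : ℕ) (hg : 2 ≤ g) (hK : 1 ≤ K) (k : ℤ) (θ : ℝ) :
    ‖∑ n ∈ Sset g K k, eC ((n : ℝ) * θ)‖ ≤
      (g : ℝ) ^ K *
        Real.exp (-(1 / (2 * (g : ℝ))) *
          ∑ i ∈ Finset.range K, distToInt ((g : ℝ) ^ i * ((g : ℝ) - 1) * θ) ^ 2) := by
  obtain ⟨M, rfl⟩ := Nat.exists_eq_add_of_le' hK
  have hg0 : (0 : ℝ) < g := by positivity
  set D := ∑ i ∈ Finset.range (M + 1), distToInt ((g : ℝ) ^ i * ((g : ℝ) - 1) * θ) ^ 2 with hD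
  set C := (g : ℝ) ^ M * Real.exp (-(1 / (2 * (g : ℝ))) * D + 1 / (2 * g)) with hC
  have hprod (α : ℝ) : ∏ i ∈ Finset.range M,
      ‖∑ j ∈ Finset.range g, eC (j * ((g : ℝ) ^ i * θ + α))‖ ≤ C := by
    have h1 : D ≤ 4 * ∑ i ∈ Finset.range M, distToInt ((g : ℝ) ^ i * θ + α) ^ 2 + 1 := by
      have h := sum_distToInt_sub_sq_le (fun i => (g : ℝ) ^ i * θ + α) M
      have hd (i : ℕ) : (g : ℝ) ^ (i + 1) * θ + α - (g ^ i * θ + α) = g ^ i * (g - 1) * θ := by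
        ring
      simp only [hd] at h
      rw [hD, Finset.sum_range_succ]
      linarith [distToInt_sq_le_quarter ((g : ℝ) ^ M * (g - 1) * θ),
        distToInt_sq_le_quarter ((g : ℝ) ^ M * θ + α)]
    have hS : 0 ≤ ∑ i ∈ Finset.range M, distToInt ((g : ℝ) ^ i * θ + α) ^ 2 := by positivity
    calc _ ≤ ∏ i ∈ Finset.range M,
          (g * Real.exp (-(4 / g) * distToInt ((g : ℝ) ^ i * θ + α) ^ 2)) :=
        Finset.prod_le_prod (fun _ _ => norm_nonneg _) fun _ _ => norm_sum_eC_le_exp hg _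
      _ = g ^ M * Real.exp (-(4 / g) *
          ∑ i ∈ Finset.range M, distToInt ((g : ℝ) ^ i * θ + α) ^ 2) := by
        rw [Finset.prod_mul_distrib, ← Real.exp_sum, Finset.mul_sum]
        simp
      _ ≤ C := by
        rw [hC]
        gcongr
        field_simp
        linarith
  have hbound (α : ℝ) : ‖eC (-k * α) *
      ∑ n ∈ Finset.range (g ^ (M + 1)), eC (n * θ + digitSum g n * α)‖ ≤
      C * (g - 1 / 2 + Real.cos (2 * Real.pi * ((g : ℝ) ^ M * θ + α)) / 2) := by
    rw [norm_mul, norm_eC, one_mul, sum_eC_digitSum_eq_prod hg, Finset.prod_range_succ, norm_mul,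
      norm_prod]
    exact mul_le_mul (hprod α) (norm_sum_eC_le hg _) (norm_nonneg _) (by positivity)
  rw [sum_Sset_eq_integral]
  calc _ ≤ ∫ α in (0 : ℝ)..1,
        C * (g - 1 / 2 + Real.cos (2 * Real.pi * ((g : ℝ) ^ M * θ + α)) / 2) :=
      intervalIntegral.norm_integral_le_of_norm_le zero_le_one
        (Filter.Eventually.of_forall fun α _ => hbound α)
        (Continuous.intervalIntegrable (by fun_prop) _ _)
    _ = C * (g - 1 / 2) := by
      rw [intervalIntegral.integral_const_mul, intervalIntegral.integral_add
        (by simp) (Continuous.intervalIntegrable (by fun_prop) _ _),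
        intervalIntegral.integral_div, integral_cos_two_pi_mul_add]
      simp
    _ ≤ C * (g * Real.exp (-(1 / (2 * g)))) := by
      gcongr
      have h := Real.add_one_le_exp (-(1 / (2 * (g : ℝ))))
      have h' : (g : ℝ) * (-(1 / (2 * g)) + 1) = g - 1 / 2 := by
        field_simp
        ring
      linarith [mul_le_mul_of_nonneg_left h hg0.le]
    _ = _ := by
      rw [hC, mul_mul_mul_comm, ← Real.exp_add, pow_succ]
      ring_nf
end
end
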